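/- If T is totally transcendental, then T is indiscernibly acyclic if and only if there is no proper cycle of types of length 2 in T^eq, i.e., no two distinct complete imaginary types p ≠ q with p ⟶ q and q ⟶ p. -/

import Mathlib

open FirstOrder FirstOrder.Language Set

universe u v w

namespace Equationality

variable {L : FirstOrder.Language.{u, v}}

section Struc
variable {M : Type w} [L.Structure M]

/-- The instance of the formula `φ(x; y)` at the parameter tuple `b`. -/
def instSet {α β : Type*} (φ : L.Formula (α ⊕ β)) (b : β → M) : Set (α → M) :=
  {a | φ.Realize (Sum.elim a b)}

/-- A sequence of `γ`-tuples indexed by a linear order is indiscernible if any two strictly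
increasing finite subsequences satisfy the same formulas. -/
def IsIndiscernible {I : Type*} [LinearOrder I] {γ : Type*} (a : I → γ → M) : Prop :=
  ∀ (n : ℕ) (i j : Fin n → I), StrictMono i → StrictMono j →
    ∀ φ : L.Formula (Fin n × γ),
      φ.Realize (fun p => a (i p.1) p.2) ↔ φ.Realize (fun p => a (j p.1) p.2)

/-- The complete type of a tuple over `∅`, as the set of formulas it realizes. -/
def typeOf {γ : Type*} (a : γ → M) : Set (L.Formula γ) := {φ | φ.Realize a}

end Struc

variable (T : L.Theory)

/-- `φ(x; y)` is an equation for `T`: in every model of `T`, the family of finite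
intersections of instances of `φ` has the descending chain condition. -/
def IsEquation {α β : Type*} (φ : L.Formula (α ⊕ β)) : Prop :=
  ∀ (M : Theory.ModelType.{u, v, max u v} T) (B : ℕ → Finset (β → M)),
    (Antitone fun n => ⋂ b ∈ B n, instSet φ b) →
    ∃ N, ∀ n, N ≤ n → (⋂ b ∈ B n, instSet φ b) = ⋂ b ∈ B N, instSet φ b

/-- A complete type over `∅` (in the variables `γ`), presented as the set of formulas
realized by some tuple in some model of `T`. -/
def IsRealizedType {γ : Type*} (p : Set (L.Formula γ)) : Prop :=
  ∃ (M : Theory.ModelType.{u, v, max u v} T) (a : γ → M), typeOf a = p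

/-- `p ⟶ q`: there are a model of `T`, a tuple `b` and an indiscernible sequence `(aᵢ)`
with `aᵢ ⊨ p(x, b)` for `i > 0` and `a₀ ⊨ q(x, b)`. -/
def Pf {α β : Type*} (p q : Set (L.Formula (α ⊕ β))) : Prop :=
  ∃ (M : Theory.ModelType.{u, v, max u v} T) (b : β → M) (a : ℕ → α → M),
    IsIndiscernible (L := L) a ∧ (∀ i : ℕ, 0 < i → typeOf (Sum.elim (a i) b) = p) ∧
      typeOf (Sum.elim (a 0) b) = q

section Stab

variable {M : Type w} [L.Structure M]

/-- Indiscernibility over a set `C` of parameters. -/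
def IsIndiscernibleOver (C : Set M) {I : Type*} [LinearOrder I] {γ : Type*}
    (a : I → γ → M) : Prop :=
  ∀ (n m : ℕ) (i j : Fin n → I), StrictMono i → StrictMono j →
    ∀ c : Fin m → M, (∀ t, c t ∈ C) →
      ∀ φ : L.Formula ((Fin n × γ) ⊕ Fin m),
        φ.Realize (Sum.elim (fun p => a (i p.1) p.2) c) ↔
          φ.Realize (Sum.elim (fun p => a (j p.1) p.2) c)

/-- The formula `φ(x, d)` divides over `C`: there is a `C`-indiscernible sequence starting
at `d` along which the instances of `φ` are `k`-inconsistent. -/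
def Divides {α γ : Type*} (φ : L.Formula (α ⊕ γ)) (d : γ → M) (C : Set M) : Prop :=
  ∃ (k : ℕ) (d' : ℕ → γ → M), 0 < k ∧ d' 0 = d ∧ IsIndiscernibleOver (L := L) C d' ∧
    ∀ s : Finset ℕ, s.card = k → ¬ ∃ a : α → M, ∀ i ∈ s, φ.Realize (Sum.elim a (d' i))

/-- `a` is forking-independent from `B` over `C` (in a stable theory, nonforking equals
nondividing): no formula of `tp(a / B ∪ C)` divides over `C`. -/
def IndepOver {α : Type*} (a : α → M) (B C : Set M) : Prop :=
  ∀ (m : ℕ) (c : Fin m → M), (∀ t, c t ∈ B ∪ C) →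
    ∀ φ : L.Formula (α ⊕ Fin m),
      φ.Realize (Sum.elim a c) → ¬ Divides (L := L) φ c C

/-- `p(x, b) ⟶ q(x, b)` for types over the parameter tuple `b` inside the model `M`. -/
def PfOver {α β : Type*} (b : β → M) (p q : Set (L.Formula (α ⊕ β))) : Prop :=
  ∃ a : ℕ → α → M, IsIndiscernible (L := L) a ∧
    (∀ i : ℕ, 0 < i → typeOf (Sum.elim (a i) b) = p) ∧ typeOf (Sum.elim (a 0) b) = q

/-- A sufficiently saturated and homogeneous ("monster") structure: types over small parameter
sets are realized, and small tuples with the same type are conjugate step by step. -/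
structure IsMonster (M : Type w) [L.Structure M] : Prop where
  saturated : ∀ (β : Type w) (b : β → M), Cardinal.mk β < Cardinal.mk M →
    ∀ (α : Type w), Finite α → ∀ Γ : Set (L.Formula (α ⊕ β)),
      (∀ Γ₀ : Finset (L.Formula (α ⊕ β)), ↑Γ₀ ⊆ Γ →
        ∃ a : α → M, ∀ φ ∈ Γ₀, φ.Realize (Sum.elim a b)) →
      ∃ a : α → M, ∀ φ ∈ Γ, φ.Realize (Sum.elim a b)
  homogeneous : ∀ (β : Type w) (b b' : β → M), Cardinal.mk β < Cardinal.mk M →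
    typeOf (L := L) b = typeOf b' → ∀ x : M, ∃ x' : M,
      typeOf (L := L) (Sum.elim (fun _ : Unit => x) b) =
        typeOf (Sum.elim (fun _ : Unit => x') b')

end Stab

/-- `T` is stable: no formula has the order property in a model of `T`. -/
def IsStable : Prop :=
  ∀ (n m : ℕ) (φ : L.Formula (Fin n ⊕ Fin m)) (M : Theory.ModelType.{u, v, max u v} T)
    (a : ℕ → Fin n → M) (b : ℕ → Fin m → M),
    ¬ ∀ i j : ℕ, φ.Realize (Sum.elim (a i) (b j)) ↔ i < j
section Imag

variable {M : Type w} [L.Structure M]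

/-- `E` defines an equivalence relation on `n`-tuples of `M`. -/
def IsEqRelFormula (n : ℕ) (E : L.Formula (Fin n ⊕ Fin n)) (M : Type w) [L.Structure M] :
    Prop :=
  (∀ a : Fin n → M, E.Realize (Sum.elim a a)) ∧
  (∀ a b : Fin n → M, E.Realize (Sum.elim a b) → E.Realize (Sum.elim b a)) ∧
  (∀ a b c : Fin n → M, E.Realize (Sum.elim a b) → E.Realize (Sum.elim b c) →
    E.Realize (Sum.elim a c))

/-- An imaginary element of `M` (an element of `M^eq`): a class of a `∅`-definable
equivalence relation on finite tuples. -/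
structure Im (L : FirstOrder.Language.{u, v}) (M : Type w) [L.Structure M] where
  n : ℕ
  E : L.Formula (Fin n ⊕ Fin n)
  isEqRel : IsEqRelFormula n E M
  cls : Set (Fin n → M)
  isCls : ∃ a : Fin n → M, cls = {b | E.Realize (Sum.elim a b)}

/-- The variable sort corresponding to a finite tuple `e` of imaginaries. -/
abbrev ImVars {k : ℕ} (e : Fin k → Im L M) : Type _ := Σ r : Fin k, Fin ((e r).n)

/-- A choice of representatives for a tuple of imaginaries. -/
def IsRep {k : ℕ} (e : Fin k → Im L M) (c : ∀ r : Fin k, Fin ((e r).n) → M) : Prop :=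
  ∀ r, c r ∈ (e r).cls

/-- A formula with an imaginary-parameter block is invariant if its truth value does not
depend on the choice of representatives. -/
def ImInvariant {γ : Type*} {k : ℕ} (e : Fin k → Im L M)
    (φ : L.Formula (γ ⊕ ImVars e)) : Prop :=
  ∀ (d : γ → M) (c c' : ∀ r, Fin ((e r).n) → M), IsRep e c → IsRep e c' →
    (φ.Realize (Sum.elim d fun q => c q.1 q.2) ↔ φ.Realize (Sum.elim d fun q => c' q.1 q.2))

/-- The complete type of a real tuple `d` over a tuple of imaginaries `e` : the set of
invariant formulas over `e` satisfied by `d`. -/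
def typeOverIm {γ : Type*} {k : ℕ} (e : Fin k → Im L M) (d : γ → M) :
    Set (L.Formula (γ ⊕ ImVars e)) :=
  {φ | ImInvariant (L := L) e φ ∧
    ∀ c : ∀ r, Fin ((e r).n) → M, IsRep e c → φ.Realize (Sum.elim d fun q => c q.1 q.2)}

/-- The imaginary `e` lies in `acl^eq(X)`, for a set `X` of real elements: some `X`-definable
`E`-invariant formula holds of `e` and of only finitely many `E`-classes. -/
def InAclEq (X : Set M) (e : Im L M) : Prop :=
  ∃ (m : ℕ) (c : Fin m → M) (φ : L.Formula (Fin e.n ⊕ Fin m)),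
    (∀ t, c t ∈ X) ∧
    (∀ a b : Fin e.n → M, e.E.Realize (Sum.elim a b) →
      (φ.Realize (Sum.elim a c) ↔ φ.Realize (Sum.elim b c))) ∧
    (∀ a ∈ e.cls, φ.Realize (Sum.elim a c)) ∧
    {D : Set (Fin e.n → M) | (∃ a : Fin e.n → M, D = {b | e.E.Realize (Sum.elim a b)}) ∧
      ∀ a ∈ D, φ.Realize (Sum.elim a c)}.Finite

/-- Indiscernibility of a sequence over an imaginary tuple `e`. -/
def IsIndiscernibleOverIm {k : ℕ} (e : Fin k → Im L M) {I : Type*} [LinearOrder I]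
    {γ : Type*} (a : I → γ → M) : Prop :=
  ∀ (n : ℕ) (i j : Fin n → I), StrictMono i → StrictMono j →
    ∀ φ : L.Formula ((Fin n × γ) ⊕ ImVars e), ImInvariant (L := L) e φ →
      ∀ c : ∀ r, Fin ((e r).n) → M, IsRep e c →
        (φ.Realize (Sum.elim (fun p => a (i p.1) p.2) fun q => c q.1 q.2) ↔
          φ.Realize (Sum.elim (fun p => a (j p.1) p.2) fun q => c q.1 q.2))

/-- The formula `φ(x, d)` divides over the imaginary tuple `e`. -/
def DividesIm {α γ : Type*} {k : ℕ} (φ : L.Formula (α ⊕ γ)) (d : γ → M)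
    (e : Fin k → Im L M) : Prop :=
  ∃ (kk : ℕ) (d' : ℕ → γ → M), 0 < kk ∧ d' 0 = d ∧
    IsIndiscernibleOverIm (L := L) e d' ∧
    ∀ s : Finset ℕ, s.card = kk → ¬ ∃ a : α → M, ∀ i ∈ s, φ.Realize (Sum.elim a (d' i))

/-- `a` is forking-independent from `B` over the imaginary tuple `e`. -/
def IndepOverIm {α : Type*} {k : ℕ} (a : α → M) (B : Set M) (e : Fin k → Im L M) : Prop :=
  ∀ (m : ℕ) (c : Fin m → M), (∀ t, c t ∈ B) →
    ∀ φ : L.Formula (α ⊕ (Fin m ⊕ ImVars e)),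
      (∀ (x : α → M) (c0 : Fin m → M) (r1 r2 : ∀ r, Fin ((e r).n) → M),
        IsRep e r1 → IsRep e r2 →
        (φ.Realize (Sum.elim x (Sum.elim c0 fun q => r1 q.1 q.2)) ↔
          φ.Realize (Sum.elim x (Sum.elim c0 fun q => r2 q.1 q.2)))) →
      ∀ rep : ∀ r, Fin ((e r).n) → M, IsRep e rep →
        φ.Realize (Sum.elim a (Sum.elim c fun q => rep q.1 q.2)) →
        ¬ DividesIm (L := L) φ (Sum.elim c fun q => rep q.1 q.2) e

/-- `d` and `d'` have the same type over `B ∪ e`. -/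
def SameTypeOverIm {γ : Type*} {k : ℕ} (d d' : γ → M) (B : Set M)
    (e : Fin k → Im L M) : Prop :=
  ∀ (m : ℕ) (c : Fin m → M), (∀ t, c t ∈ B) →
    ∀ φ : L.Formula (γ ⊕ (Fin m ⊕ ImVars e)),
      (∀ (x : γ → M) (c0 : Fin m → M) (r1 r2 : ∀ r, Fin ((e r).n) → M),
        IsRep e r1 → IsRep e r2 →
        (φ.Realize (Sum.elim x (Sum.elim c0 fun q => r1 q.1 q.2)) ↔
          φ.Realize (Sum.elim x (Sum.elim c0 fun q => r2 q.1 q.2)))) →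
      ∀ rep : ∀ r, Fin ((e r).n) → M, IsRep e rep →
        (φ.Realize (Sum.elim d (Sum.elim c fun q => rep q.1 q.2)) ↔
          φ.Realize (Sum.elim d' (Sum.elim c fun q => rep q.1 q.2)))

/-- A type over the imaginary tuple `e` is stationary: realizations independent from a set `B`
over `e` all have the same type over `B ∪ e`. -/
def IsStationaryOverIm {γ : Type*} {k : ℕ} (e : Fin k → Im L M)
    (p : Set (L.Formula (γ ⊕ ImVars e))) : Prop :=
  ∀ d d' : γ → M, typeOverIm (L := L) e d = p → typeOverIm (L := L) e d' = p →
    ∀ B : Set M, IndepOverIm (L := L) d B e → IndepOverIm (L := L) d' B e →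
      SameTypeOverIm (L := L) d d' B e

/-- `p ⟶ q` for types over the imaginary tuple `e`, with variable partition `(α; β)`. -/
def PfOverIm {α β : Type*} {k : ℕ} (e : Fin k → Im L M)
    (p q : Set (L.Formula ((α ⊕ β) ⊕ ImVars e))) : Prop :=
  ∃ (b : β → M) (a : ℕ → α → M), IsIndiscernible (L := L) a ∧
    (∀ i : ℕ, 0 < i → typeOverIm (L := L) e (Sum.elim (a i) b) = p) ∧
    typeOverIm (L := L) e (Sum.elim (a 0) b) = q

end Imag
section Teq

variable {M : Type w} [L.Structure M]

/-- A finite product of imaginary sorts of `M^eq`, given by `∅`-definable equivalence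
relations on finite tuples. -/
structure ImSort (L : FirstOrder.Language.{u, v}) (M : Type w) [L.Structure M] where
  k : ℕ
  N : Fin k → ℕ
  E : ∀ r : Fin k, L.Formula (Fin (N r) ⊕ Fin (N r))
  isEqRel : ∀ r, IsEqRelFormula (N r) (E r) M

/-- The variables of the sort `S`. -/
abbrev SortVars (S : ImSort L M) : Type := Σ r : Fin S.k, Fin (S.N r)

/-- Two representative tuples name the same imaginary tuple of sort `S`. -/
def SortEquiv (S : ImSort L M) (c c' : SortVars S → M) : Prop :=
  ∀ r : Fin S.k, (S.E r).Realize (Sum.elim (fun t => c ⟨r, t⟩) fun t => c' ⟨r, t⟩)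

/-- A formula in two imaginary blocks which is invariant under change of representatives,
i.e. a formula of `M^eq` about pairs of imaginary tuples of sorts `S`, `S'`. -/
def SortInvariant₂ (S S' : ImSort L M) (φ : L.Formula (SortVars S ⊕ SortVars S')) : Prop :=
  ∀ (c c' : SortVars S → M) (d d' : SortVars S' → M), SortEquiv (L := L) S c c' →
    SortEquiv (L := L) S' d d' → (φ.Realize (Sum.elim c d) ↔ φ.Realize (Sum.elim c' d'))

/-- The complete `T^eq`-type over `∅` of a pair of imaginary tuples, given by
representatives `c`, `d`. -/
def imTypeOf (S S' : ImSort L M) (c : SortVars S → M) (d : SortVars S' → M) :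
    Set (L.Formula (SortVars S ⊕ SortVars S')) :=
  {φ | SortInvariant₂ (L := L) S S' φ ∧ φ.Realize (Sum.elim c d)}

/-- An indiscernible sequence of imaginary tuples of sort `S`, in the sense of `M^eq`. -/
def ImSortIndiscernible (S : ImSort L M) (a : ℕ → SortVars S → M) : Prop :=
  ∀ (n : ℕ) (i j : Fin n → ℕ), StrictMono i → StrictMono j →
    ∀ φ : L.Formula (Fin n × SortVars S),
      (∀ c c' : Fin n × SortVars S → M,
        (∀ t : Fin n, SortEquiv (L := L) S (fun v => c (t, v)) fun v => c' (t, v)) →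
        (φ.Realize c ↔ φ.Realize c')) →
      (φ.Realize (fun p => a (i p.1) p.2) ↔ φ.Realize (fun p => a (j p.1) p.2))

/-- `p ⟶ q` for complete types of imaginary tuples over `∅` (types in `T^eq`). -/
def PfTeq (S S' : ImSort L M) (p q : Set (L.Formula (SortVars S ⊕ SortVars S'))) : Prop :=
  ∃ (d : SortVars S' → M) (a : ℕ → SortVars S → M), ImSortIndiscernible (L := L) S a ∧
    (∀ i : ℕ, 0 < i → imTypeOf (L := L) S S' (a i) d = p) ∧
    imTypeOf (L := L) S S' (a 0) d = q

end Teq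

/-- `M^eq` admits no proper cycle of imaginary types of length `n`: every cycle
`p₀ ⟶ … ⟶ p_{n-1} ⟶ p₀` of realized imaginary types (encoded as an `n`-periodic sequence)
has two equal members. -/
def NoProperCycleTeq (M : Type w) [L.Structure M] (n : ℕ) : Prop :=
  ∀ (S S' : ImSort L M) (p : ℕ → Set (L.Formula (SortVars S ⊕ SortVars S'))),
    (∀ i, ∃ (c : SortVars S → M) (d : SortVars S' → M), imTypeOf (L := L) S S' c d = p i) →
    (∀ i, p (i + n) = p i) →
    (∀ i, PfTeq (L := L) S S' (p i) (p (i + 1))) →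
    ∃ i j, i < n ∧ j < n ∧ i ≠ j ∧ p i = p j

/-- `T` is indiscernibly acyclic: there is no proper cycle of complete types over `∅` of
length `n ≥ 2`. -/
def IsIndAcyclic : Prop :=
  ∀ (n : ℕ), 2 ≤ n → ∀ (k l : ℕ) (p : ℕ → Set (L.Formula (Fin k ⊕ Fin l))),
    (∀ i, IsRealizedType T (p i)) → (∀ i, p (i + n) = p i) →
    (∀ i, Pf T (p i) (p (i + 1))) → ∃ i j, i < n ∧ j < n ∧ i ≠ j ∧ p i = p j

/-- `T` is totally transcendental: no model admits a binary tree of nonempty definable sets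
(equivalently, every formula has ordinal-valued Morley rank). -/
def IsTotallyTranscendental : Prop :=
  ∀ (M : Theory.ModelType.{u, v, max u v} T) (n : ℕ),
    ¬ ∃ X : List Bool → Set (Fin n → M),
      (∀ s, (X s).Nonempty) ∧ (∀ s, (univ : Set ↥M).Definable L (X s)) ∧
      (∀ s b, X (s ++ [b]) ⊆ X s) ∧ ∀ s, Disjoint (X (s ++ [true])) (X (s ++ [false]))


section Basics

/-- Elementary equivalence of tuples, possibly in different structures. -/
def EqT (L : FirstOrder.Language.{u, v}) {N N' : Type*} [L.Structure N] [L.Structure N'] {γ : Type*}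
    (a : γ → N) (b : γ → N') : Prop :=
  ∀ φ : L.Formula γ, φ.Realize a ↔ φ.Realize b

theorem typeOf_eq_iff {N N' : Type*} [L.Structure N] [L.Structure N'] {γ : Type*}
    {a : γ → N} {b : γ → N'} : typeOf (L := L) a = typeOf b ↔ EqT L a b := by
  simp only [typeOf, EqT, Set.ext_iff]; rfl

theorem EqT.symm {N N' : Type*} [L.Structure N] [L.Structure N'] {γ : Type*}
    {a : γ → N} {b : γ → N'} (h : EqT L a b) : EqT L b a := fun φ => (h φ).symm

theorem EqT.trans {N N' N'' : Type*} [L.Structure N] [L.Structure N'] [L.Structure N'']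
    {γ : Type*} {a : γ → N} {b : γ → N'} {c : γ → N''} (h : EqT L a b) (h' : EqT L b c) :
    EqT L a c := fun φ => (h φ).trans (h' φ)

theorem EqT.comp {N N' : Type*} [L.Structure N] [L.Structure N'] {γ δ : Type*}
    {a : γ → N} {b : γ → N'} (h : EqT L a b) (f : δ → γ) : EqT L (a ∘ f) (b ∘ f) := by
  intro φ
  have := h (φ.relabel f)
  simpa [Formula.realize_relabel] using this

theorem finsup {ι : Type*} (φ : L.Formula ι) : ∃ (s : Finset ι) (ψ : L.Formula s),
    ∀ (N : Type w) [L.Structure N] (v : ι → N), φ.Realize v ↔ ψ.Realize (fun x => v x) := by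
  classical
  refine ⟨φ.freeVarFinset, BoundedFormula.restrictFreeVar φ id, ?_⟩
  intro N _ v
  exact (BoundedFormula.realize_restrictFreeVar (φ := φ) (f := id) (v := fun x => v x) v
    (fun _ => rfl)).symm

/-- Same type iff same type on finite subtuples. -/
theorem eqT_of_fin {N : Type*} {N' : Type*} [L.Structure N] [L.Structure N'] {γ : Type*}
    {a : γ → N} {b : γ → N'}
    (h : ∀ s : Finset γ, EqT L (fun x : s => a x) (fun x : s => b x)) : EqT L a b := by
  intro φ
  classical
  have h1 := BoundedFormula.realize_restrictFreeVar (φ := φ) (f := id)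
    (v := fun x : BoundedFormula.freeVarFinset φ => a x) (xs := default) a (fun _ => rfl)
  have h2 := BoundedFormula.realize_restrictFreeVar (φ := φ) (f := id)
    (v := fun x : BoundedFormula.freeVarFinset φ => b x) (xs := default) b (fun _ => rfl)
  exact h1.symm.trans ((h _ _).trans h2)

/-- ω-saturation. -/
def WSat (L : FirstOrder.Language.{u, v}) (M : Type w) [L.Structure M] : Prop :=
  ∀ (δ : Type) [Finite δ] (c : δ → M) (Γ : Set (L.Formula (Unit ⊕ δ))),
    (∀ Γ₀ : Finset (L.Formula (Unit ⊕ δ)), ↑Γ₀ ⊆ Γ →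
      ∃ x : M, ∀ φ ∈ Γ₀, φ.Realize (Sum.elim (fun _ => x) c)) →
    ∃ x : M, ∀ φ ∈ Γ, φ.Realize (Sum.elim (fun _ => x) c)

variable {M : Type w} [L.Structure M]

theorem IsMonster.wsat (hM : IsMonster (L := L) M) : WSat L M := by
  intro δ _ c Γ hΓ
  rcases finite_or_infinite M with hf | hi
  · classical
    by_contra hcon
    push Not at hcon
    choose g hg hg' using hcon
    have : Fintype M := Fintype.ofFinite M
    obtain ⟨x, hx⟩ := hΓ (Finset.univ.image g) (by
      intro φ hφ
      simp only [Finset.coe_image, Finset.coe_univ, image_univ, mem_range] at hφ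
      obtain ⟨y, rfl⟩ := hφ
      exact hg y)
    exact hg' x (hx _ (Finset.mem_image_of_mem _ (Finset.mem_univ _)))
  · let e : Unit ⊕ δ → ULift.{w} Unit ⊕ ULift.{w} δ := Sum.map ULift.up ULift.up
    let Γ' : Set (L.Formula (ULift.{w} Unit ⊕ ULift.{w} δ)) := (fun φ => φ.relabel e) '' Γ
    have key : ∀ (a : ULift.{w} Unit → M) (φ : L.Formula (Unit ⊕ δ)),
        (φ.relabel e).Realize (Sum.elim a (fun d => c d.down)) ↔
          φ.Realize (Sum.elim (fun _ => a ⟨()⟩) c) := by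
      intro a φ
      rw [Formula.realize_relabel]
      refine iff_of_eq (congrArg _ ?_)
      funext x
      rcases x with x | x <;> rfl
    have hlt : Cardinal.mk (ULift.{w} δ) < Cardinal.mk M :=
      lt_of_lt_of_le (Cardinal.lt_aleph0_of_finite _) (Cardinal.aleph0_le_mk M)
    obtain ⟨a, ha⟩ := hM.saturated (ULift.{w} δ) (fun d => c d.down) hlt (ULift.{w} Unit)
      inferInstance Γ' (by
        intro Γ₀ h0
        classical
        obtain ⟨s, hs, rfl⟩ := Finset.subset_set_image_iff.1 h0
        obtain ⟨x, hx⟩ := hΓ s hs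
        refine ⟨fun _ => x, ?_⟩
        intro φ hφ
        obtain ⟨ψ, hψ, rfl⟩ := Finset.mem_image.1 hφ
        exact (key _ _).2 (hx ψ hψ))
    exact ⟨a ⟨()⟩, fun φ hφ => (key a φ).1 (ha _ ⟨φ, hφ, rfl⟩)⟩

/-- Dependent choice along ℕ for local conditions. -/
theorem seq_exists {X : Type*} (Q : ∀ n : ℕ, (Fin n → X) → X → Prop)
    (I : ∀ n : ℕ, (Fin n → X) → Prop) (h0 : ∀ f, I 0 f)
    (hs : ∀ n f, I n f → ∃ x, Q n f x ∧ I (n+1) (Fin.snoc f x)) :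
    ∃ f : ℕ → X, ∀ n, Q n (fun i => f i) (f n) ∧ I n (fun i => f i) := by
  classical
  let S : ∀ n : ℕ, {f : Fin n → X // I n f} := fun n => Nat.rec ⟨Fin.elim0, h0 _⟩
    (fun n f => ⟨Fin.snoc f.1 (hs n f.1 f.2).choose, (hs n f.1 f.2).choose_spec.2⟩) n
  have hS : ∀ n, (S (n+1)).1 = Fin.snoc (S n).1 (hs n (S n).1 (S n).2).choose := fun n => rfl
  let f : ℕ → X := fun n => (S (n+1)).1 (Fin.last n)
  have hf : ∀ n, f n = (hs n (S n).1 (S n).2).choose := by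
    intro n; simp only [f, hS]; exact Fin.snoc_last ..
  have hr : ∀ n, (fun i : Fin n => f i) = (S n).1 := by
    intro n
    induction n with
    | zero => exact Subsingleton.elim _ _
    | succ n ih =>
      funext i
      rw [hS]
      refine Fin.lastCases ?_ (fun j => ?_) i
      · rw [Fin.snoc_last]; exact hf n
      · rw [Fin.snoc_castSucc, ← ih]; rfl
  refine ⟨f, fun n => ⟨?_, ?_⟩⟩
  · rw [hr, hf]; exact (hs n (S n).1 (S n).2).choose_spec.1
  · rw [hr]; exact (S n).2

theorem transfer_one (hM : WSat L M) {N : Type*} [L.Structure N] {δ : Type} [Finite δ]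
    {c : δ → N} {c' : δ → M} (h : EqT L c c') (x : N) :
    ∃ x' : M, EqT L (Sum.elim (fun _ : Unit => x) c) (Sum.elim (fun _ : Unit => x') c') := by
  have key : ∀ φ : L.Formula (Unit ⊕ δ), (∃ x : N, φ.Realize (Sum.elim (fun _ => x) c)) ↔
      ∃ x : M, φ.Realize (Sum.elim (fun _ => x) c') := by
    intro φ
    have := h (Formula.iExs Unit (φ.relabel Sum.swap))
    simp only [Formula.realize_iExs, Formula.realize_relabel] at this
    have e1 : ∀ (i : Unit → N), (Sum.elim c i) ∘ Sum.swap = Sum.elim i c := by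
      intro i; funext z; rcases z with z | z <;> rfl
    have e2 : ∀ (i : Unit → M), (Sum.elim c' i) ∘ Sum.swap = Sum.elim i c' := by
      intro i; funext z; rcases z with z | z <;> rfl
    simp only [e1, e2] at this
    constructor
    · rintro ⟨x, hx⟩
      obtain ⟨i, hi⟩ := this.1 ⟨fun _ => x, hx⟩
      exact ⟨i (), hi⟩
    · rintro ⟨x, hx⟩
      obtain ⟨i, hi⟩ := this.2 ⟨fun _ => x, hx⟩
      exact ⟨i (), hi⟩
  obtain ⟨x', hx'⟩ := hM δ c' {φ | φ.Realize (Sum.elim (fun _ => x) c)} (by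
    intro Γ₀ h0
    have hψψ : (∀ φ ∈ Γ₀, φ.Realize (Sum.elim (fun _ => x) c)) := fun φ hφ => h0 hφ
    obtain ⟨y, hy⟩ := (key (BoundedFormula.iInf (fun φ : Γ₀ => (φ : L.Formula (Unit ⊕ δ))))).1
      ⟨x, by simpa [Formula.Realize] using hψψ⟩
    exact ⟨y, by simpa [Formula.Realize] using hy⟩)
  refine ⟨x', fun φ => ⟨fun hφ => hx' φ hφ, fun hφ => ?_⟩⟩
  by_contra hcon
  exact (Formula.realize_not.1 (hx' φ.not (Formula.realize_not.2 hcon))) hφ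

theorem transfer_nat (hM : WSat L M) {N : Type*} [L.Structure N] {δ : Type} [Finite δ]
    {c : δ → N} {c' : δ → M} (h : EqT L c c') (x : ℕ → N) :
    ∃ x' : ℕ → M, EqT L (Sum.elim x c) (Sum.elim x' c') := by
  obtain ⟨f, hf⟩ := seq_exists (X := M) (fun _ _ _ => True)
    (fun n f => EqT L (Sum.elim (fun i : Fin n => x i) c) (Sum.elim f c'))
    (by
      intro f
      have := h.comp (Sum.elim Fin.elim0 id : Fin 0 ⊕ δ → δ)
      convert this using 1 <;>
      · funext z; rcases z with z | z
        · exact z.elim0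
        · rfl)
    (by
      intro n f hf
      obtain ⟨y, hy⟩ := transfer_one hM hf (x n)
      refine ⟨y, trivial, ?_⟩
      have := hy.comp (Sum.elim (fun i : Fin (n+1) =>
        Fin.lastCases (motive := fun _ => Unit ⊕ (Fin n ⊕ δ)) (Sum.inl ())
          (fun j => Sum.inr (Sum.inl j)) i) (fun d => Sum.inr (Sum.inr d)))
      convert this using 1
      · funext z; rcases z with z | z
        · refine Fin.lastCases ?_ (fun j => ?_) z <;> simp
        · rfl
      · funext z; rcases z with z | z
        · refine Fin.lastCases ?_ (fun j => ?_) z <;> simp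
        · rfl)
  refine ⟨f, eqT_of_fin ?_⟩
  intro s
  have hb : ∃ n, ∀ z ∈ s, ∀ i, z = Sum.inl i → i < n := by
    refine ⟨s.sup (Sum.elim (fun i => i + 1) (fun _ => 0)), ?_⟩
    intro z hz i hi
    have := Finset.le_sup (f := (Sum.elim (fun i => i + 1) (fun _ => 0) : ℕ ⊕ δ → ℕ)) hz
    subst hi
    exact this
  obtain ⟨n, hn⟩ := hb
  let g : s → Fin n ⊕ δ := fun z => match z with
    | ⟨Sum.inl i, hz⟩ => Sum.inl ⟨i, hn _ hz i rfl⟩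
    | ⟨Sum.inr d, _⟩ => Sum.inr d
  have := (hf n).2.comp g
  convert this using 1 <;>
  · funext z; rcases z with ⟨z | z, hz⟩ <;> rfl

theorem transfer (hM : WSat L M) {N : Type*} [L.Structure N] {δ : Type} [Finite δ]
    {c : δ → N} {c' : δ → M} (h : EqT L c c') {ι : Type*} [Countable ι] (x : ι → N) :
    ∃ x' : ι → M, EqT L (Sum.elim x c) (Sum.elim x' c') := by
  rcases isEmpty_or_nonempty ι with hι | hι
  · refine ⟨isEmptyElim, ?_⟩
    have := h.comp (Sum.elim isEmptyElim id : ι ⊕ δ → δ)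
    convert this using 1 <;>
    · funext z; rcases z with z | z
      · exact isEmptyElim z
      · rfl
  · obtain ⟨e, he⟩ := exists_surjective_nat ι
    obtain ⟨x', hx'⟩ := transfer_nat hM h (x ∘ e)
    refine ⟨x' ∘ Function.surjInv he, ?_⟩
    have := hx'.comp (Sum.map (Function.surjInv he) id)
    convert this using 1
    · funext z; rcases z with z | z
      · simp [Function.surjInv_eq he]
      · rfl
    · funext z; rcases z with z | z <;> rfl

open Filter in
/-- realize an ultrafilter type -/
theorem real (hM : WSat L M) [Nonempty M] {Ω : Type*} (W : Ultrafilter Ω) {ι : Type*} [Countable ι]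
    (f : Ω → ι → M) {δ : Type} [Finite δ] (c : δ → M) :
    ∃ x : ι → M, ∀ φ : L.Formula (ι ⊕ δ),
      φ.Realize (Sum.elim x c) ↔ ∀ᶠ ω in (W : Filter Ω), φ.Realize (Sum.elim (f ω) c) := by
  have h : EqT L (fun d => ((fun _ => c d : Ω → M) : (W : Filter Ω).Product (fun _ => M))) c := by
    intro φ
    refine (Ultraproduct.realize_formula_cast φ (fun d _ => c d)).trans ?_
    simp
  obtain ⟨x, hx⟩ := transfer hM h
    (fun i => ((fun ω => f ω i : Ω → M) : (W : Filter Ω).Product (fun _ => M)))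
  refine ⟨x, fun φ => (hx φ).symm.trans ?_⟩
  have := Ultraproduct.realize_formula_cast (u := W) (M := fun _ => M) φ
    (fun z ω => Sum.elim (f ω) c z)
  refine Iff.trans ?_ this
  refine iff_of_eq (congrArg _ ?_)
  funext z; rcases z with z | z <;> rfl

theorem univ_def_of {γ δ : Type*} (c : δ → M) (φ : L.Formula (γ ⊕ δ)) :
    (univ : Set M).Definable L {v : γ → M | φ.Realize (Sum.elim v c)} := by
  rw [definable_iff_exists_formula_sum]
  refine ⟨φ.relabel (Sum.elim Sum.inr (fun d => Sum.inl ⟨c d, trivial⟩)), ?_⟩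
  ext v
  simp only [Set.mem_ofPred_eq, Formula.realize_relabel]
  refine iff_of_eq (congrArg _ ?_)
  funext z; rcases z with z | z <;> rfl

theorem univ_def_iff {γ : Type*} {s : Set (γ → M)} : (univ : Set M).Definable L s ↔
    ∃ (r : ℕ) (c : Fin r → M) (φ : L.Formula (γ ⊕ Fin r)),
      s = {v : γ → M | φ.Realize (Sum.elim v c)} := by
  constructor
  · intro h
    rw [definable_iff_exists_formula_sum] at h
    obtain ⟨φ, rfl⟩ := h
    obtain ⟨t, ψ, hψ⟩ := finsup.{u, v, w} φ
    classical
    let t' : Finset (univ : Set M) := t.toLeft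
    let e := t'.equivFin
    refine ⟨_, fun i => (e.symm i : (univ : Set M)), ψ.relabel (fun z => match z with
      | ⟨Sum.inl a, h⟩ => Sum.inr (e ⟨a, Finset.mem_toLeft.2 h⟩)
      | ⟨Sum.inr a, _⟩ => Sum.inl a), ?_⟩
    ext v
    simp only [Set.mem_ofPred_eq, hψ, Formula.realize_relabel]
    refine iff_of_eq (congrArg _ ?_)
    funext z; rcases z with ⟨z | z, hz⟩
    · simp
    · rfl
  · rintro ⟨r, c, φ, rfl⟩
    exact univ_def_of c φ

theorem empty_def_of {γ : Type*} (φ : L.Formula γ) :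
    (∅ : Set M).Definable L {v : γ → M | φ.Realize v} := empty_definable_iff.2 ⟨φ, rfl⟩

theorem EqT.mem_iff {γ : Type*} {a b : γ → M} (h : EqT L a b) {s : Set (γ → M)}
    (hs : (∅ : Set M).Definable L s) : a ∈ s ↔ b ∈ s := by
  obtain ⟨φ, rfl⟩ := empty_definable_iff.1 hs
  exact h φ

theorem eqT_iff_mem {γ : Type*} {a b : γ → M} :
    EqT L a b ↔ ∀ s, (∅ : Set M).Definable L s → (a ∈ s ↔ b ∈ s) :=
  ⟨fun h _ hs => h.mem_iff hs, fun h φ => h _ (empty_def_of φ)⟩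

end Basics


section TreeOrd

/-- No binary tree of definable sets. -/
def TT (L : FirstOrder.Language.{u, v}) (N : Type w) [L.Structure N] : Prop :=
  ∀ n : ℕ, ¬ ∃ X : List Bool → Set (Fin n → N),
      (∀ s, (X s).Nonempty) ∧ (∀ s, (univ : Set N).Definable L (X s)) ∧
      (∀ s b, X (s ++ [b]) ⊆ X s) ∧ ∀ s, Disjoint (X (s ++ [true])) (X (s ++ [false]))

theorem tree {N : Type w} [L.Structure N] (h : TT L N) {Γ : Type*} [Finite Γ]
    (G : Set (Set (Γ → N))) (hne : G.Nonempty)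
    (hd : ∀ X ∈ G, X.Nonempty ∧ (univ : Set N).Definable L X)
    (hs : ∀ X ∈ G, ∃ Y ∈ G, ∃ Z ∈ G, Y ⊆ X ∧ Z ⊆ X ∧ Disjoint Y Z) : False := by
  obtain ⟨n, ⟨e⟩⟩ := Finite.exists_equiv_fin Γ
  obtain ⟨X0, hX0⟩ := hne
  choose! Y hY Z hZ hYX hZX hYZ using hs
  let F : List Bool → Set (Γ → N) := fun s => s.foldl (fun X b => if b then Y X else Z X) X0
  have hF : ∀ s b, F (s ++ [b]) = if b then Y (F s) else Z (F s) := by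
    intro s b; simp only [F, List.foldl_append]; rfl
  have hG : ∀ s, F s ∈ G := by
    intro s
    induction s using List.reverseRecOn with
    | nil => exact hX0
    | append_singleton s b ih =>
      rw [hF]; split_ifs
      · exact hY _ ih
      · exact hZ _ ih
  refine h n ⟨fun s => (fun g : Γ → N => g ∘ e.symm) '' F s, ?_, ?_, ?_, ?_⟩
  · exact fun s => (hd _ (hG s)).1.image _
  · exact fun s => (hd _ (hG s)).2.image_comp_equiv e.symm
  · intro s b
    apply image_mono
    rw [hF]; split_ifs
    · exact hYX _ (hG s)
    · exact hZX _ (hG s)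
  · intro s
    rw [disjoint_image_iff]
    · rw [hF, hF]; exact hYZ _ (hG s)
    · intro g g' hg
      funext x
      have := congrFun hg (e x)
      simpa using this

/-- No order property (with parameters). -/
def NoOrd (L : FirstOrder.Language.{u, v}) (M : Type w) [L.Structure M] : Prop :=
  ∀ (Γ Δ : Type) [Finite Γ] [Finite Δ] (s : Set (Γ ⊕ Δ → M)), (univ : Set M).Definable L s →
    ∀ (x : ℕ → Γ → M) (y : ℕ → Δ → M), ¬ ∀ i j, Sum.elim (x i) (y j) ∈ s ↔ i < j

open Filter in
theorem noOrd {M : Type w} [L.Structure M] [Nonempty M]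
    (h : TT L ((hyperfilter ℕ : Filter ℕ).Product (fun _ => M))) : NoOrd L M := by
  intro Γ Δ _ _ s hs x y hxy
  obtain ⟨r, c, φ, rfl⟩ := univ_def_iff.1 hs
  let xx : (ℕ → ℕ) → Γ → (hyperfilter ℕ : Filter ℕ).Product (fun _ => M) :=
    fun i a => ((fun n => x (i n) a : ℕ → M) : (hyperfilter ℕ : Filter ℕ).Product (fun _ => M))
  let yy : (ℕ → ℕ) → Δ → (hyperfilter ℕ : Filter ℕ).Product (fun _ => M) :=
    fun i a => ((fun n => y (i n) a : ℕ → M) : (hyperfilter ℕ : Filter ℕ).Product (fun _ => M))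
  let cc : Fin r → (hyperfilter ℕ : Filter ℕ).Product (fun _ => M) :=
    fun a => ((fun n => c a : ℕ → M) : (hyperfilter ℕ : Filter ℕ).Product (fun _ => M))
  have key : ∀ i k : ℕ → ℕ, φ.Realize (Sum.elim (Sum.elim (xx i) (yy k)) cc) ↔
      ∀ᶠ n in hyperfilter ℕ, i n < k n := by
    intro i k
    have := Ultraproduct.realize_formula_cast (u := hyperfilter ℕ) (M := fun _ => M) φ
      (fun z n => Sum.elim (Sum.elim (x (i n)) (y (k n))) c z)
    refine Iff.trans (Iff.trans ?_ this) ?_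
    · refine iff_of_eq (congrArg _ ?_)
      funext z; rcases z with (z | z) | z <;> rfl
    · refine Filter.eventually_congr (Eventually.of_forall fun n => ?_)
      exact hxy (i n) (k n)
  let G : Set (Set (Γ → (hyperfilter ℕ : Filter ℕ).Product (fun _ => M))) :=
    {X | (univ : Set _).Definable L X ∧ ∃ f g : ℕ → ℕ,
      (∀ k, ∀ᶠ n in hyperfilter ℕ, f n + k ≤ g n) ∧
      ∀ i : ℕ → ℕ, (∀ᶠ n in hyperfilter ℕ, f n ≤ i n ∧ i n < g n) → xx i ∈ X}
  refine tree h G ⟨univ, definable_univ, fun _ => 0, id, ?_, fun _ _ => mem_univ _⟩ ?_ ?_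
  · intro k
    have : ∀ᶠ n in atTop, 0 + k ≤ id n := by
      simpa using eventually_ge_atTop k
    exact this.filter_mono (by rw [← Nat.cofinite_eq_atTop]; exact hyperfilter_le_cofinite)
  · rintro X ⟨hX, f, g, hfg, hi⟩
    refine ⟨⟨xx f, hi f ?_⟩, hX⟩
    filter_upwards [hfg 1] with n hn
    omega
  · rintro X ⟨hX, f, g, hfg, hi⟩
    let k : ℕ → ℕ := fun n => (f n + g n) / 2
    let D : Set (Γ → (hyperfilter ℕ : Filter ℕ).Product (fun _ => M)) :=
      {v | φ.Realize (Sum.elim (Sum.elim v (yy k)) cc)}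
    have hD : (univ : Set _).Definable L D := by
      have := univ_def_of (Sum.elim (yy k) cc) (φ.relabel (Equiv.sumAssoc Γ Δ (Fin r)))
      convert this using 1
      ext v
      simp only [D, Set.mem_ofPred_eq, Formula.realize_relabel]
      refine iff_of_eq (congrArg _ ?_)
      funext z; rcases z with (z | z) | z <;> rfl
    refine ⟨X ∩ D, ⟨hX.inter hD, f, k, ?_, ?_⟩, X \ D, ⟨hX.sdiff hD, k, g, ?_, ?_⟩,
      inter_subset_left, sdiff_subset, ?_⟩
    · intro m
      filter_upwards [hfg (2 * m)] with n hn
      simp only [k]; omega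
    · intro i h1
      refine ⟨hi i ?_, (key i k).2 ?_⟩
      · filter_upwards [h1, hfg 0] with n h1 h2
        simp only [k] at h1; omega
      · filter_upwards [h1] with n h1
        exact h1.2
    · intro m
      filter_upwards [hfg (2 * m)] with n hn
      simp only [k]; omega
    · intro i h1
      refine ⟨hi i ?_, fun hcon => ?_⟩
      · filter_upwards [h1, hfg 0] with n h1 h2
        simp only [k] at h1; omega
      · have := ((key i k).1 hcon).and h1
        obtain ⟨n, hn⟩ := this.exists
        omega
    · exact disjoint_sdiff_right.mono_left inter_subset_right

variable {M : Type w} [L.Structure M]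

open Filter in
theorem comm_aux (hM : NoOrd L M) {Γ Δ : Type} [Finite Γ] [Finite Δ] (U : Ultrafilter (Γ → M))
    (V : Ultrafilter (Δ → M)) {s : Set (Γ ⊕ Δ → M)} (hs : (univ : Set M).Definable L s)
    (h : ∀ᶠ x in U, ∀ᶠ y in V, Sum.elim x y ∈ s) : ∀ᶠ y in V, ∀ᶠ x in U, Sum.elim x y ∈ s := by
  by_contra hcon
  rw [← Ultrafilter.eventually_not] at hcon
  simp only [← Ultrafilter.eventually_not] at hcon
  obtain ⟨f, hf⟩ := seq_exists (X := (Γ → M) × (Δ → M))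
    (fun n f z => (∀ i, Sum.elim z.1 (f i).2 ∉ s) ∧ (∀ i, Sum.elim (f i).1 z.2 ∈ s) ∧
      Sum.elim z.1 z.2 ∈ s)
    (fun n f => ∀ i, (∀ᶠ y in V, Sum.elim (f i).1 y ∈ s) ∧ ∀ᶠ x in U, Sum.elim x (f i).2 ∉ s)
    (fun f i => i.elim0)
    (by
      intro n f hf
      obtain ⟨x, hx, hx'⟩ := (h.and (eventually_all.2 fun i => (hf i).2)).exists
      obtain ⟨y, hy, hy', hy''⟩ := (hcon.and ((eventually_all.2 fun i => (hf i).1).and hx)).exists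
      refine ⟨(x, y), ⟨hx', hy', hy''⟩, ?_⟩
      intro i
      refine Fin.lastCases ?_ (fun j => ?_) i
      · simp only [Fin.snoc_last]; exact ⟨hx, hy⟩
      · simp only [Fin.snoc_castSucc]; exact hf j)
  refine hM Γ Δ s hs (fun i => (f (i+1)).1) (fun j => (f j).2) ?_
  intro i j
  constructor
  · intro hij
    by_contra hlt
    exact (hf (i+1)).1.1 ⟨j, by omega⟩ hij
  · intro hij
    rcases Nat.lt_or_ge (i+1) j with hlt | hge
    · exact (hf j).1.2.1 ⟨i+1, hlt⟩
    · obtain rfl : j = i + 1 := by omega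
      exact (hf (i+1)).1.2.2

open Filter in
theorem comm (hM : NoOrd L M) {Γ Δ : Type} [Finite Γ] [Finite Δ] (U : Ultrafilter (Γ → M))
    (V : Ultrafilter (Δ → M)) {s : Set (Γ ⊕ Δ → M)} (hs : (univ : Set M).Definable L s) :
    (∀ᶠ x in U, ∀ᶠ y in V, Sum.elim x y ∈ s) ↔ ∀ᶠ y in V, ∀ᶠ x in U, Sum.elim x y ∈ s := by
  refine ⟨comm_aux hM U V hs, fun h => ?_⟩
  by_contra hcon
  rw [← Ultrafilter.eventually_not] at hcon
  simp only [← Ultrafilter.eventually_not] at hcon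
  have := comm_aux hM U V (s := sᶜ) hs.compl hcon
  obtain ⟨y, hy, hy'⟩ := (h.and this).exists
  obtain ⟨x, hx, hx'⟩ := (hy.and hy').exists
  exact hx' hx

end TreeOrd


section Mu
open Filter

/-- Iterated (Fubini) product of ultrafilters. -/
noncomputable def mu {A : Type*} : (m : ℕ) → (Fin m → Ultrafilter A) → Ultrafilter (Fin m → A)
  | 0, _ => pure Fin.elim0
  | (m+1), U => (U 0).bind (fun a => (mu m (fun i => U i.succ)).map (Fin.cons a))

theorem mu_zero {A : Type*} (U : Fin 0 → Ultrafilter A) (P : (Fin 0 → A) → Prop) :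
    (∀ᶠ x in mu 0 U, P x) ↔ P Fin.elim0 := Iff.rfl

theorem mu_succ {A : Type*} {m : ℕ} (U : Fin (m+1) → Ultrafilter A) (P : (Fin (m+1) → A) → Prop) :
    (∀ᶠ x in mu (m+1) U, P x) ↔
      ∀ᶠ a in U 0, ∀ᶠ x in mu m (fun i => U i.succ), P (Fin.cons a x) := Iff.rfl

theorem bind_iff {A B : Type*} (U : Ultrafilter A) (V : A → Ultrafilter B) (P : B → Prop) :
    (∀ᶠ x in U.bind V, P x) ↔ ∀ᶠ a in U, ∀ᶠ x in V a, P x := Iff.rfl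

theorem map_iff {A B : Type*} (U : Ultrafilter A) (f : A → B) (P : B → Prop) :
    (∀ᶠ x in U.map f, P x) ↔ ∀ᶠ a in U, P (f a) := Iff.rfl

theorem eventually_const_iff {A : Type*} (U : Ultrafilter A) (P : Prop) :
    (∀ᶠ _ in (U : Filter A), P) ↔ P := by simp

theorem mu_map {A B : Type*} {m : ℕ} (U : Fin m → Ultrafilter A) (f : A → B)
    (P : (Fin m → B) → Prop) :
    (∀ᶠ x in mu m (fun i => (U i).map f), P x) ↔ ∀ᶠ x in mu m U, P (f ∘ x) := by
  induction m with
  | zero =>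
    rw [mu_zero, mu_zero]
    exact iff_of_eq (congrArg _ (Subsingleton.elim _ _))
  | succ m ih =>
    rw [mu_succ, mu_succ, map_iff]
    refine eventually_congr (Eventually.of_forall fun a => ?_)
    rw [ih]
    refine eventually_congr (Eventually.of_forall fun x => ?_)
    refine iff_of_eq (congrArg _ ?_)
    funext i
    refine Fin.cases ?_ (fun i => ?_) i <;> simp

theorem mu_comp {A : Type*} {n m : ℕ} (U : Fin n → Ultrafilter A) (e : Fin m → Fin n)
    (he : StrictMono e) (P : (Fin m → A) → Prop) :
    (∀ᶠ x in mu n U, P (x ∘ e)) ↔ ∀ᶠ x in mu m (fun i => U (e i)), P x := by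
  induction n generalizing m with
  | zero =>
    obtain rfl : m = 0 := by
      by_contra h
      exact (e ⟨0, Nat.pos_of_ne_zero h⟩).elim0
    rw [mu_zero, mu_zero]
    exact iff_of_eq (congrArg _ (Subsingleton.elim _ _))
  | succ n ih =>
    cases m with
    | zero =>
      rw [mu_zero]
      have : ∀ x : Fin (n+1) → A, x ∘ e = Fin.elim0 := fun x => Subsingleton.elim _ _
      simp only [this, eventually_const_iff]
    | succ m =>
      by_cases h0 : e 0 = 0
      · have hpos : ∀ i : Fin m, e i.succ ≠ 0 := fun i h => by
          have := he (Fin.succ_pos i); rw [h, h0] at this; exact lt_irrefl _ this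
        let e' : Fin m → Fin n := fun i => (e i.succ).pred (hpos i)
        have he' : StrictMono e' := fun i j hij => by
          simp only [e', Fin.pred_lt_pred_iff]; exact he (Fin.succ_lt_succ_iff.2 hij)
        have h1 : ∀ i, (e' i).succ = e i.succ := fun i => Fin.succ_pred _ _
        rw [mu_succ, mu_succ, h0]
        refine eventually_congr (Eventually.of_forall fun a => ?_)
        have := ih (fun i => U i.succ) e' he' (fun x => P (Fin.cons a x))
        simp only [h1] at this
        rw [← this]
        refine eventually_congr (Eventually.of_forall fun x => ?_)
        refine iff_of_eq (congrArg _ ?_)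
        funext i
        refine Fin.cases ?_ (fun i => ?_) i
        · simp [h0]
        · simp [← h1]
      · have hpos : ∀ i, e i ≠ 0 := fun i h => by
          rcases Fin.eq_zero_or_eq_succ i with rfl | ⟨j, rfl⟩
          · exact h0 h
          · have := he (Fin.succ_pos j); rw [h] at this; exact absurd this (Fin.not_lt_zero _)
        let e' : Fin (m+1) → Fin n := fun i => (e i).pred (hpos i)
        have he' : StrictMono e' := fun i j hij => by
          simp only [e', Fin.pred_lt_pred_iff]; exact he hij
        have h1 : ∀ i, (e' i).succ = e i := fun i => Fin.succ_pred _ _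
        rw [mu_succ]
        have h2 : ∀ (a : A) (x : Fin n → A), (Fin.cons a x : Fin (n+1) → A) ∘ e = x ∘ e' := by
          intro a x; funext i; simp [← h1]
        simp only [h2, eventually_const_iff]
        rw [ih (fun i => U i.succ) e' he' P]
        simp only [h1]

theorem mu_snoc {A : Type*} {m : ℕ} (U : Fin (m+1) → Ultrafilter A) (P : (Fin (m+1) → A) → Prop) :
    (∀ᶠ x in mu (m+1) U, P x) ↔
      ∀ᶠ x in mu m (fun i => U i.castSucc), ∀ᶠ a in U (Fin.last m), P (Fin.snoc x a) := by
  induction m with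
  | zero =>
    rw [mu_succ, mu_zero]
    refine eventually_congr (Eventually.of_forall fun a => ?_)
    rw [mu_zero]
    refine iff_of_eq (congrArg _ ?_)
    funext i
    obtain rfl : i = 0 := Fin.fin_one_eq_zero i
    simp [Fin.snoc]
  | succ m ih =>
    rw [mu_succ, mu_succ]
    refine eventually_congr (Eventually.of_forall fun a => ?_)
    rw [ih]
    simp only [Fin.succ_castSucc, Fin.succ_last]
    refine eventually_congr (Eventually.of_forall fun x => ?_)
    refine eventually_congr (Eventually.of_forall fun b => ?_)
    rw [Fin.cons_snoc_eq_snoc_cons]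

variable {M : Type w} [L.Structure M]

theorem sec_right {Γ Δ : Type*} {s : Set (Γ ⊕ Δ → M)} (hs : (univ : Set M).Definable L s)
    (a : Γ → M) : (univ : Set M).Definable L {y : Δ → M | Sum.elim a y ∈ s} := by
  obtain ⟨r, c, φ, rfl⟩ := univ_def_iff.1 hs
  have := univ_def_of (Sum.elim a c) (φ.relabel
    (Sum.elim (Sum.elim (fun z => Sum.inr (Sum.inl z)) Sum.inl) (fun z => Sum.inr (Sum.inr z))))
  convert this using 1
  ext v
  simp only [Set.mem_ofPred_eq, Formula.realize_relabel]
  refine iff_of_eq (congrArg _ ?_)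
  funext z; rcases z with (z | z) | z <;> rfl

theorem sec_left {Γ Δ : Type*} {s : Set (Γ ⊕ Δ → M)} (hs : (univ : Set M).Definable L s)
    (b : Δ → M) : (univ : Set M).Definable L {x : Γ → M | Sum.elim x b ∈ s} := by
  have := sec_right (hs.preimage_comp (Sum.swap : Γ ⊕ Δ → Δ ⊕ Γ)) b
  convert this using 1
  ext v
  simp only [Set.mem_ofPred_eq, Set.mem_preimage]
  refine iff_of_eq (congrArg (· ∈ s) ?_)
  funext z; rcases z with z | z <;> rfl

/-- agreement on definable sets -/
def UEq (L : FirstOrder.Language.{u, v}) {M : Type w} [L.Structure M] {Γ : Type*}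
    (U V : Ultrafilter (Γ → M)) : Prop :=
  ∀ s, (univ : Set M).Definable L s → ((∀ᶠ x : Γ → M in U, x ∈ s) ↔ ∀ᶠ x : Γ → M in V, x ∈ s)

/-- flattening -/
def flat {I Γ : Type*} {M : Type*} (x : I → Γ → M) : I × Γ → M := fun p => x p.1 p.2

theorem comm' (hM : NoOrd L M) {Γ Δ Ξ : Type} [Finite Γ] [Finite Δ] (U : Ultrafilter (Γ → M))
    {B : Type*} (V : Ultrafilter B) (g : B → Δ → M) (f : Ξ → Γ ⊕ Δ) {s : Set (Ξ → M)}
    (hs : (univ : Set M).Definable L s) :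
    (∀ᶠ x in U, ∀ᶠ y in V, Sum.elim x (g y) ∘ f ∈ s) ↔
      ∀ᶠ y in V, ∀ᶠ x in U, Sum.elim x (g y) ∘ f ∈ s :=
  comm hM U (V.map g) (hs.preimage_comp f)

theorem flat_cons {Γ : Type*} {M : Type*} {m : ℕ} (a : Γ → M) (x : Fin m → Γ → M) :
    flat (Fin.cons a x : Fin (m+1) → Γ → M) = Sum.elim a (flat x) ∘
      (fun p : Fin (m+1) × Γ => (Fin.cases (Sum.inl p.2) (fun i => Sum.inr (i, p.2)) p.1 :
        Γ ⊕ (Fin m × Γ))) := by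
  funext ⟨i, z⟩
  refine Fin.cases ?_ (fun i => ?_) i <;> simp [flat]

theorem te (hM : NoOrd L M) {Γ : Type} [Finite Γ] {m : ℕ} (U V : Fin m → Ultrafilter (Γ → M))
    (h : ∀ i, UEq L (U i) (V i)) (s : Set (Fin m × Γ → M)) (hs : (univ : Set M).Definable L s) :
    (∀ᶠ x in mu m U, flat x ∈ s) ↔ ∀ᶠ x in mu m V, flat x ∈ s := by
  induction m with
  | zero => rw [mu_zero, mu_zero]
  | succ m ih =>
    have hs' := hs.preimage_comp (fun p : Fin (m+1) × Γ =>
        (Fin.cases (Sum.inl p.2) (fun i => Sum.inr (i, p.2)) p.1 : Γ ⊕ (Fin m × Γ)))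
    rw [mu_succ, mu_succ]
    simp only [flat_cons]
    have h1 : ∀ a : Γ → M, _ := fun a => ih (fun i => U i.succ) (fun i => V i.succ)
      (fun i => h i.succ) _ (sec_right hs' a)
    refine (eventually_congr (Eventually.of_forall fun a => h1 a)).trans ?_
    refine (comm hM (U 0) ((mu m (fun i => V i.succ)).map flat) hs').trans ?_
    refine Iff.trans ?_ (comm hM (V 0) ((mu m (fun i => V i.succ)).map flat) hs').symm
    refine eventually_congr (Eventually.of_forall fun x => ?_)
    exact h 0 _ (sec_left hs' x)

theorem mu_hyper_gt (m a : ℕ) : ∀ᶠ x : Fin m → ℕ in mu m (fun _ => hyperfilter ℕ), ∀ i, a < x i := by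
  induction m with
  | zero => rw [mu_zero]; exact fun i => i.elim0
  | succ m ih =>
    rw [mu_succ]
    have : ∀ᶠ n in (hyperfilter ℕ : Filter ℕ), a < n :=
      (eventually_gt_atTop a).filter_mono
        (by rw [← Nat.cofinite_eq_atTop]; exact hyperfilter_le_cofinite)
    filter_upwards [this] with n hn
    filter_upwards [ih] with x hx i
    refine Fin.cases ?_ (fun i => ?_) i
    · simpa using hn
    · simpa using hx i

theorem mu_hyper_mono (m : ℕ) : ∀ᶠ x : Fin m → ℕ in mu m (fun _ => hyperfilter ℕ), StrictMono x := by
  induction m with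
  | zero => rw [mu_zero]; exact fun i => i.elim0
  | succ m ih =>
    rw [mu_succ]
    refine Eventually.of_forall fun a => ?_
    filter_upwards [ih, mu_hyper_gt m a] with x hx hx' i j
    refine Fin.cases ?_ (fun i => ?_) i <;> refine Fin.cases ?_ (fun j => ?_) j
    · simp
    · simp [hx' j]
    · simp
    · simpa using fun h => hx h

theorem ev_hyper {P : ℕ → Prop} (k : ℕ) (h : ∀ n, k ≤ n → P n) : ∀ᶠ n in hyperfilter ℕ, P n :=
  ((eventually_ge_atTop k).filter_mono
        (by rw [← Nat.cofinite_eq_atTop]; exact hyperfilter_le_cofinite)).mono h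

theorem exists_R : ∃ R : Ultrafilter (ℕ → ℕ), ∀ (r : ℕ) (J : Fin r → ℕ), StrictMono J →
    ∀ P : (Fin r → ℕ) → Prop,
      (∀ᶠ x in R, P (x ∘ J)) ↔ ∀ᶠ x in mu r (fun _ => hyperfilter ℕ), P x := by
  refine ⟨(hyperfilter ℕ).bind (fun n => (mu n (fun _ => hyperfilter ℕ)).map
    (fun x i => if h : i < n then x ⟨i, h⟩ else 0)), ?_⟩
  intro r J hJ P
  rw [bind_iff]
  refine Iff.trans ?_ (eventually_const_iff (hyperfilter ℕ) _)
  obtain ⟨k, hk⟩ : ∃ k, ∀ i, J i < k :=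
    ⟨Finset.univ.sup (fun i => J i + 1), fun i =>
      Finset.le_sup (f := fun i => J i + 1) (Finset.mem_univ i)⟩
  refine eventually_congr (ev_hyper k fun n hn => ?_)
  rw [map_iff]
  have := mu_comp (fun _ : Fin n => hyperfilter ℕ) (fun i => ⟨J i, (hk i).trans_le hn⟩)
    (fun i j hij => hJ hij) P
  rw [← this]
  refine eventually_congr (Eventually.of_forall fun x => ?_)
  refine iff_of_eq (congrArg _ ?_)
  funext i
  simp [(hk i).trans_le hn]

theorem exists_R' : ∃ R : Ultrafilter (ℕ → ℕ), ∀ (r : ℕ) (J : Fin r → ℕ), StrictMono J →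
    ∀ P : (Fin r → ℕ) → Prop,
      (∀ᶠ x in R, P (x ∘ J)) ↔ ∀ᶠ x in mu r (fun _ => hyperfilter ℕ), P (x ∘ Fin.rev) := by
  obtain ⟨R, hR⟩ := exists_R
  refine ⟨(hyperfilter ℕ).bind (fun n => R.map (fun x t => x (n - t))), ?_⟩
  intro r J hJ P
  rw [bind_iff]
  refine Iff.trans ?_ (eventually_const_iff (hyperfilter ℕ) _)
  obtain ⟨k, hk⟩ : ∃ k, ∀ i, J i < k :=
    ⟨Finset.univ.sup (fun i => J i + 1), fun i =>
      Finset.le_sup (f := fun i => J i + 1) (Finset.mem_univ i)⟩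
  refine eventually_congr (ev_hyper k fun n hn => ?_)
  rw [map_iff]
  have := hR r (fun t => n - J t.rev) (fun i j hij => by
    have h1 := hJ (Fin.rev_lt_rev.2 hij)
    have h2 := hk i.rev
    dsimp only; omega) (fun x => P (x ∘ Fin.rev))
  rw [← this]
  refine eventually_congr (Eventually.of_forall fun x => ?_)
  refine iff_of_eq (congrArg _ ?_)
  funext i
  simp

theorem ext_aux (hM : WSat L M) [Nonempty M] {α δ : Type} [Countable α] [Finite δ] (a : ℕ → α → M)
    (c : δ → M) (σ : ∀ {r : ℕ}, Fin r → Fin r)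
    (hR : ∃ R : Ultrafilter (ℕ → ℕ), ∀ (r : ℕ) (J : Fin r → ℕ), StrictMono J →
    ∀ P : (Fin r → ℕ) → Prop,
      (∀ᶠ x in R, P (x ∘ J)) ↔ ∀ᶠ x in mu r (fun _ => hyperfilter ℕ), P (x ∘ σ)) :
    ∃ a' : ℕ → α → M, ∀ (r : ℕ) (φ : L.Formula ((Fin r × α) ⊕ δ)),
      (∀ J J' : Fin r → ℕ, StrictMono J → StrictMono J' →
        (φ.Realize (Sum.elim (fun p => a' (J p.1) p.2) c) ↔
          φ.Realize (Sum.elim (fun p => a' (J' p.1) p.2) c))) ∧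
      ((∀ J : Fin r → ℕ, StrictMono J →
        φ.Realize (Sum.elim (fun p => a (J (σ p.1)) p.2) c)) →
        ∀ J : Fin r → ℕ, StrictMono J → φ.Realize (Sum.elim (fun p => a' (J p.1) p.2) c)) := by
  obtain ⟨R, hR⟩ := hR
  obtain ⟨x, hx⟩ := real hM R (fun x (p : ℕ × α) => a (x p.1) p.2) c
  have key : ∀ (r : ℕ) (φ : L.Formula ((Fin r × α) ⊕ δ)) (J : Fin r → ℕ), StrictMono J →
      (φ.Realize (Sum.elim (fun p => x (J p.1, p.2)) c) ↔
       ∀ᶠ y : Fin r → ℕ in mu r (fun _ => hyperfilter ℕ),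
         φ.Realize (Sum.elim (fun p => a (y (σ p.1)) p.2) c)) := by
    intro r φ J hJ
    have h1 := hx (φ.relabel (Sum.map (fun p => (J p.1, p.2)) id))
    simp only [Formula.realize_relabel, Sum.elim_comp_map] at h1
    refine h1.trans ?_
    exact hR r J hJ (fun y => φ.Realize (Sum.elim (fun p => a (y p.1) p.2) c))
  refine ⟨fun i z => x (i, z), fun r φ => ⟨fun J J' hJ hJ' => ?_, fun h J hJ => ?_⟩⟩
  · exact (key r φ J hJ).trans (key r φ J' hJ').symm
  · rw [key r φ J hJ]
    exact (mu_hyper_mono r).mono fun y hy => h y hy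

/-- Extraction of an indiscernible sequence over `c`. -/
theorem extr (hM : WSat L M) [Nonempty M] {α δ : Type} [Countable α] [Finite δ] (a : ℕ → α → M)
    (c : δ → M) :
    ∃ a' : ℕ → α → M, ∀ (r : ℕ) (φ : L.Formula ((Fin r × α) ⊕ δ)),
      (∀ J J' : Fin r → ℕ, StrictMono J → StrictMono J' →
        (φ.Realize (Sum.elim (fun p => a' (J p.1) p.2) c) ↔
          φ.Realize (Sum.elim (fun p => a' (J' p.1) p.2) c))) ∧
      ((∀ J : Fin r → ℕ, StrictMono J → φ.Realize (Sum.elim (fun p => a (J p.1) p.2) c)) →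
        ∀ J : Fin r → ℕ, StrictMono J → φ.Realize (Sum.elim (fun p => a' (J p.1) p.2) c)) :=
  ext_aux hM a c id exists_R

theorem extr_rev (hM : WSat L M) [Nonempty M] {α δ : Type} [Countable α] [Finite δ] (a : ℕ → α → M)
    (c : δ → M) :
    ∃ a' : ℕ → α → M, ∀ (r : ℕ) (φ : L.Formula ((Fin r × α) ⊕ δ)),
      (∀ J J' : Fin r → ℕ, StrictMono J → StrictMono J' →
        (φ.Realize (Sum.elim (fun p => a' (J p.1) p.2) c) ↔
          φ.Realize (Sum.elim (fun p => a' (J' p.1) p.2) c))) ∧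
      ((∀ J : Fin r → ℕ, StrictAnti J → φ.Realize (Sum.elim (fun p => a (J p.1) p.2) c)) →
        ∀ J : Fin r → ℕ, StrictMono J → φ.Realize (Sum.elim (fun p => a' (J p.1) p.2) c)) := by
  obtain ⟨a', h⟩ := ext_aux hM a c Fin.rev exists_R'
  refine ⟨a', fun r φ => ⟨(h r φ).1, fun h1 => (h r φ).2 fun J hJ => ?_⟩⟩
  exact h1 (fun t => J t.rev) (fun i j hij => hJ (Fin.rev_lt_rev.2 hij))

end Mu


section Cyc
open Filter Relation

theorem closure_serial {X : Type*} [TopologicalSpace X] [CompactSpace X] [T2Space X]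
    {R : X → X → Prop} (hR : IsClosed {p : X × X | R p.1 p.2}) {S : Set X}
    (hS : ∀ x ∈ S, ∃ y ∈ S, R x y) : ∀ x ∈ closure S, ∃ y ∈ closure S, R x y := by
  have hc : IsClosed (Prod.fst '' ({p : X × X | R p.1 p.2} ∩ (Prod.snd ⁻¹' closure S))) :=
    ((hR.inter (isClosed_closure.preimage continuous_snd)).isCompact.image continuous_fst).isClosed
  have hsub : closure S ⊆ Prod.fst '' ({p : X × X | R p.1 p.2} ∩ (Prod.snd ⁻¹' closure S)) := by
    apply closure_minimal _ hc
    intro x hx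
    obtain ⟨y, hy, hxy⟩ := hS x hx
    exact ⟨(x, y), ⟨hxy, subset_closure hy⟩, rfl⟩
  intro x hx
  obtain ⟨⟨x', y⟩, ⟨h1, h2⟩, rfl⟩ := hsub hx
  exact ⟨y, h2, h1⟩

theorem cyc {X : Type*} [TopologicalSpace X] [CompactSpace X] [T2Space X]
    (R : X → X → Prop) (hR : IsClosed {p : X × X | R p.1 p.2}) (K : Set X) (hK : IsClosed K)
    (hscat : ∀ C ⊆ K, IsClosed C → C.Nonempty → ∃ x ∈ C, ∃ O, IsOpen O ∧ x ∈ O ∧ O ∩ C ⊆ {x})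
    (P : ℕ → X) (hP : ∀ n, P n ∈ K) (hRP : ∀ n, R (P n) (P (n+1))) : ∃ x, TransGen R x x := by
  let F : Set (Set X) := {C | C ⊆ K ∧ IsClosed C ∧ C.Nonempty ∧ ∀ x ∈ C, ∃ y ∈ C, R x y}
  have h0 : closure (range P) ∈ F := by
    refine ⟨closure_minimal (by rintro _ ⟨n, rfl⟩; exact hP n) hK, isClosed_closure,
      ⟨P 0, subset_closure ⟨0, rfl⟩⟩, closure_serial hR ?_⟩
    rintro _ ⟨n, rfl⟩
    exact ⟨_, ⟨n+1, rfl⟩, hRP n⟩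
  obtain ⟨C, hC⟩ := zorn_superset F (by
    intro c hc hch
    rcases c.eq_empty_or_nonempty with rfl | hne
    · exact ⟨_, h0, fun s hs => hs.elim⟩
    have hdir : DirectedOn (· ⊇ ·) c := by
      intro a ha b hb
      rcases hch.total ha hb with h | h
      · exact ⟨a, ha, subset_rfl, h⟩
      · exact ⟨b, hb, h, subset_rfl⟩
    refine ⟨⋂₀ c, ⟨?_, ?_, ?_, ?_⟩, fun s hs => sInter_subset_of_mem hs⟩
    · obtain ⟨s, hs⟩ := hne
      exact (sInter_subset_of_mem hs).trans (hc hs).1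
    · exact isClosed_sInter fun s hs => (hc hs).2.1
    · have := hne.to_subtype
      exact IsCompact.nonempty_sInter_of_directed_nonempty_isCompact_isClosed hdir
        (fun s hs => (hc hs).2.2.1) (fun s hs => (hc hs).2.1.isCompact) (fun s hs => (hc hs).2.1)
    · intro x hx
      have hcl : IsClosed {y | R x y} := hR.preimage (Continuous.prodMk_right x)
      have := (hne.image (fun s => s ∩ {y | R x y})).to_subtype
      have := IsCompact.nonempty_sInter_of_directed_nonempty_isCompact_isClosed
        (S := (fun s => s ∩ {y | R x y}) '' c)
        (by
          rintro _ ⟨a, ha, rfl⟩ _ ⟨b, hb, rfl⟩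
          obtain ⟨d, hd, h1, h2⟩ := hdir a ha b hb
          exact ⟨_, ⟨d, hd, rfl⟩, inter_subset_inter_left _ h1, inter_subset_inter_left _ h2⟩)
        (by
          rintro _ ⟨a, ha, rfl⟩
          obtain ⟨y, hy, hxy⟩ := (hc ha).2.2.2 x (hx a ha)
          exact ⟨y, hy, hxy⟩)
        (by
          rintro _ ⟨a, ha, rfl⟩
          exact ((hc ha).2.1.inter hcl).isCompact)
        (by
          rintro _ ⟨a, ha, rfl⟩
          exact ((hc ha).2.1.inter hcl))
      obtain ⟨y, hy⟩ := this
      refine ⟨y, fun s hs => (hy _ ⟨s, hs, rfl⟩).1, ?_⟩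
      obtain ⟨s, hs⟩ := hne
      exact (hy _ ⟨s, hs, rfl⟩).2)
  obtain ⟨⟨hCK, hCc, hCne, hCs⟩, hmin⟩ := hC
  obtain ⟨x, hxC, O, hO, hxO, hOC⟩ := hscat C hCK hCc hCne
  let D : Set X := {y | TransGen (fun a b => R a b ∧ b ∈ C) x y}
  have hDC : D ⊆ C := by
    intro y hy
    rcases hy with h | ⟨_, h⟩ <;> exact h.2
  have hD : closure D ∈ F := by
    refine ⟨(closure_minimal hDC hCc).trans hCK, isClosed_closure, ?_, closure_serial hR ?_⟩
    · obtain ⟨y, hy, hxy⟩ := hCs x hxC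
      exact ⟨y, subset_closure (TransGen.single ⟨hxy, hy⟩)⟩
    · intro y hy
      obtain ⟨z, hz, hyz⟩ := hCs y (hDC hy)
      exact ⟨z, TransGen.tail hy ⟨hyz, hz⟩, hyz⟩
  have hxD : x ∈ closure D := hmin hD (closure_minimal hDC hCc) hxC
  obtain ⟨y, hyO, hyD⟩ := mem_closure_iff.1 hxD O hO hxO
  obtain rfl : y = x := hOC ⟨hyO, hDC hyD⟩
  exact ⟨y, TransGen.mono (r := fun a b => R a b ∧ b ∈ C) (fun a b h => h.1) _ _ hyD⟩

theorem simple_cycle {X : Type*} {r : X → X → Prop} (hirr : ∀ x, ¬ r x x) {x : X}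
    (h : TransGen r x x) : ∃ N : ℕ, 2 ≤ N ∧ ∃ f : ℕ → X, (∀ i, f (i + N) = f i) ∧
      (∀ i, r (f i) (f (i+1))) ∧ ∀ i j, i < N → j < N → f i = f j → i = j := by
  classical
  have hw : ∀ y, TransGen r x y → ∃ n : ℕ, 0 < n ∧ ∃ g : ℕ → X, g 0 = x ∧ g n = y ∧
      ∀ i < n, r (g i) (g (i+1)) := by
    intro y hy
    induction hy with
    | single h =>
      rename_i y
      exact ⟨1, one_pos, fun i => if i = 0 then x else y, by simp, by simp, by
        intro i hi; obtain rfl : i = 0 := by omega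
        simpa using h⟩
    | @tail y z _ h ih =>
      obtain ⟨n, hn, g, h0, h1, h2⟩ := ih
      refine ⟨n+1, by omega, fun i => if i ≤ n then g i else z, by simpa using h0, by simp, ?_⟩
      intro i hi
      rcases Nat.lt_or_ge i n with hlt | hge
      · have e1 : i ≤ n := by omega
        have e2 : i + 1 ≤ n := by omega
        simp only [e1, e2, if_true]; exact h2 i hlt
      · obtain rfl : i = n := by omega
        simp only [le_refl, if_true, Nat.not_succ_le_self, if_false]
        rw [h1]; exact h
  have hex : ∃ n : ℕ, 0 < n ∧ ∃ g : ℕ → X, g 0 = g n ∧ ∀ i < n, r (g i) (g (i+1)) := by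
    obtain ⟨n, hn, g, h0, h1, h2⟩ := hw x h
    exact ⟨n, hn, g, h0.trans h1.symm, h2⟩
  obtain ⟨hpos, g, hg, hgr⟩ := Nat.find_spec hex
  have hmin := fun m => Nat.find_min (m := m) hex
  generalize hN : Nat.find hex = N at *
  have hN2 : 2 ≤ N := by
    by_contra hlt
    obtain rfl : N = 1 := by omega
    have := hgr 0 one_pos
    rw [hg] at this
    exact hirr _ this
  have hinj : ∀ i j, i < j → j < N → g i ≠ g j := by
    intro i j hij hj he
    refine hmin (j - i) (by omega) ⟨by omega, fun t => g (i + t), ?_, ?_⟩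
    · simp only [add_zero]; rw [he]; congr 1; omega
    · intro t ht
      exact hgr (i + t) (by omega)
  refine ⟨N, hN2, fun i => g (i % N), fun i => by simp, ?_, ?_⟩
  · intro i
    change r (g (i % N)) (g ((i + 1) % N))
    have hlt := Nat.mod_lt i hpos
    rcases Nat.lt_or_ge (i % N + 1) N with h1 | h1
    · have : (i + 1) % N = i % N + 1 := by
        rw [Nat.add_mod, Nat.mod_eq_of_lt (show 1 < N by omega), Nat.mod_eq_of_lt h1]
      rw [this]; exact hgr _ hlt
    · have h2 : i % N + 1 = N := by omega
      have : (i + 1) % N = 0 := by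
        rw [Nat.add_mod, Nat.mod_eq_of_lt (show 1 < N by omega), h2, Nat.mod_self]
      rw [this, hg]
      have := hgr _ hlt
      rwa [h2] at this
  · intro i j hi hj he
    simp only [Nat.mod_eq_of_lt hi, Nat.mod_eq_of_lt hj] at he
    by_contra hne
    rcases Nat.lt_or_gt_of_ne hne with h | h
    · exact hinj i j h hj he
    · exact hinj j i h hi he.symm

end Cyc

section TypeSpace
open Filter
variable {M : Type w} [L.Structure M]

/-- Definable sets over `A`. -/
abbrev Inst (L : FirstOrder.Language.{u, v}) {M : Type w} [L.Structure M] (A : Set M) (Γ : Type) :=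
  {s : Set (Γ → M) // A.Definable L s}

open Classical in
/-- membership in an ultrafilter as a boolean -/
noncomputable def mb {Ω : Type*} (s : Set Ω) (U : Ultrafilter Ω) : Bool := decide (s ∈ U)

theorem mb_true {Ω : Type*} {s : Set Ω} {U : Ultrafilter Ω} : mb s U = true ↔ s ∈ U := by
  simp [mb]

theorem mb_eq {Ω Ω' : Type*} {s : Set Ω} {U : Ultrafilter Ω} {s' : Set Ω'} {U' : Ultrafilter Ω'} :
    mb s U = mb s' U' ↔ (s ∈ U ↔ s' ∈ U') := by
  simp [mb]

theorem continuous_mb {Ω : Type*} (s : Set Ω) : Continuous (mb s) := by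
  rw [continuous_bool_rng true]
  have : mb s ⁻¹' {true} = {U | s ∈ U} := by
    ext U; simp [mb_true]
  rw [this]
  exact ⟨ultrafilter_isClosed_basic s, ultrafilter_isOpen_basic s⟩

/-- The `A`-type of the ultrafilter pushed along `g`. -/
noncomputable def ty (L : FirstOrder.Language.{u, v}) {M : Type w} [L.Structure M] (A : Set M)
    {Γ : Type} {Ω : Type*} (g : Ω → Γ → M)
    (U : Ultrafilter Ω) : Inst L A Γ → Bool := fun s => mb (g ⁻¹' s.1) U

theorem ty_true {A : Set M} {Γ : Type} {Ω : Type*} {g : Ω → Γ → M} {U : Ultrafilter Ω}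
    {s : Inst L A Γ} : ty L A g U s = true ↔ ∀ᶠ ω in U, g ω ∈ s.1 := mb_true

theorem ty_eq {A : Set M} {Γ : Type} {Ω Ω' : Type*} {g : Ω → Γ → M} {U : Ultrafilter Ω}
    {g' : Ω' → Γ → M} {U' : Ultrafilter Ω'} : ty L A g U = ty L A g' U' ↔
      ∀ s : Set (Γ → M), A.Definable L s → ((∀ᶠ ω in U, g ω ∈ s) ↔ ∀ᶠ ω in U', g' ω ∈ s) := by
  constructor
  · intro h s hs
    exact mb_eq.1 (congrFun h ⟨s, hs⟩)
  · intro h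
    funext s
    exact mb_eq.2 (h s.1 s.2)

theorem continuous_ty {A : Set M} {Γ : Type} {Ω : Type*} (g : Ω → Γ → M) :
    Continuous (ty L A g) := continuous_pi fun _ => continuous_mb _

/-- space of types -/
def TS (L : FirstOrder.Language.{u, v}) {M : Type w} [L.Structure M] (A : Set M) (Γ : Type) :
    Set (Inst L A Γ → Bool) := range (ty L A (id : (Γ → M) → Γ → M))

theorem isClosed_TS {A : Set M} {Γ : Type} : IsClosed (TS L A Γ) :=
  (isCompact_range (continuous_ty _)).isClosed

theorem ty_mem_TS {A : Set M} {Γ : Type} {Ω : Type*} (g : Ω → Γ → M) (U : Ultrafilter Ω) :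
    ty L A g U ∈ TS L A Γ := ⟨U.map g, rfl⟩

theorem scat (hM : TT L M) {A : Set M} {Γ : Type} [Finite Γ] (C : Set (Inst L A Γ → Bool))
    (hC : C ⊆ TS L A Γ) (hne : C.Nonempty) :
    ∃ x ∈ C, ∃ O, IsOpen O ∧ x ∈ O ∧ O ∩ C ⊆ {x} := by
  by_contra hcon
  push Not at hcon
  obtain ⟨τ₀, hτ₀⟩ := hne
  refine tree hM {X : Set (Γ → M) | ∃ h : A.Definable L X, ∃ τ ∈ C, τ ⟨X, h⟩ = true}
    ⟨univ, definable_univ, τ₀, hτ₀, ?_⟩ ?_ ?_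
  · obtain ⟨U, rfl⟩ := hC hτ₀
    exact ty_true.2 univ_mem
  · rintro X ⟨h, τ, hτ, hX⟩
    obtain ⟨U, rfl⟩ := hC hτ
    exact ⟨(ty_true.1 hX).exists, h.mono (subset_univ _)⟩
  · rintro X ⟨h, τ, hτ, hX⟩
    have := hcon τ hτ {σ | σ ⟨X, h⟩ = true}
      (by
        have h1 : Continuous (fun σ : Inst L A Γ → Bool => σ ⟨X, h⟩) := continuous_apply _
        exact (isOpen_discrete {true}).preimage h1) hX
    rw [not_subset] at this
    obtain ⟨τ', ⟨hX', hτ'⟩, hneq⟩ := this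
    obtain ⟨⟨Y, hY⟩, hne⟩ := Function.ne_iff.1 hneq
    obtain ⟨U, rfl⟩ := hC hτ
    obtain ⟨U', rfl⟩ := hC hτ'
    rw [Set.mem_ofPred_eq, ty_true] at hX'
    rw [ty_true] at hX
    have hXY : A.Definable L (X ∩ Y) := h.inter hY
    have hXY' : A.Definable L (X \ Y) := h.sdiff hY
    have hdis : Disjoint (X ∩ Y) (X \ Y) := disjoint_sdiff_right.mono_left inter_subset_right
    by_cases hYU : ∀ᶠ ω in U, ω ∈ Y
    · have hYU' : ¬ ∀ᶠ ω in U', ω ∈ Y := by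
        intro hYU'
        exact hne (mb_eq.2 ⟨fun _ => hYU, fun _ => hYU'⟩)
      rw [← Ultrafilter.eventually_not] at hYU'
      exact ⟨X ∩ Y, ⟨hXY, _, hτ, ty_true.2 (hX.and hYU)⟩, X \ Y,
        ⟨hXY', _, hτ', ty_true.2 (hX'.and hYU')⟩, inter_subset_left, sdiff_subset, hdis⟩
    · have hYU' : ∀ᶠ ω in U', ω ∈ Y := by
        by_contra hYU'
        exact hne (mb_eq.2 ⟨fun h => absurd h hYU', fun h => absurd h hYU⟩)
      rw [← Ultrafilter.eventually_not] at hYU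
      exact ⟨X ∩ Y, ⟨hXY, _, hτ', ty_true.2 (hX'.and hYU')⟩, X \ Y,
        ⟨hXY', _, hτ, ty_true.2 (hX.and hYU)⟩, inter_subset_left, sdiff_subset, hdis⟩

/-- configurations -/
abbrev Conf (M : Type w) (α β : Type) := (ℕ → α → M) × (β → M)

/-- The `j`-th pair of a configuration. -/
def pr {M : Type w} {α β : Type} (j : ℕ) (ω : Conf M α β) : α ⊕ β → M := Sum.elim (ω.1 j) ω.2

/-- Indiscernibility over `A` of an ultrafilter on configurations. -/
def UInd (L : FirstOrder.Language.{u, v}) {M : Type w} [L.Structure M] (A : Set M) {α β : Type}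
    (W : Ultrafilter (Conf M α β)) : Prop :=
  ∀ (r : ℕ) (J J' : Fin r → ℕ), StrictMono J → StrictMono J' →
    ∀ s : Set (Fin r × α → M), A.Definable L s →
      ((∀ᶠ ω : Conf M α β in W, (fun p : Fin r × α => ω.1 (J p.1) p.2) ∈ s) ↔
        ∀ᶠ ω : Conf M α β in W, (fun p : Fin r × α => ω.1 (J' p.1) p.2) ∈ s)

/-- The relation on `A`-types. -/
def RA (L : FirstOrder.Language.{u, v}) {M : Type w} [L.Structure M] (A : Set M) {α β : Type}
    (P Q : Inst L A (α ⊕ β) → Bool) : Prop :=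
  ∃ W : Ultrafilter (Conf M α β), UInd L A W ∧ (∀ j, ty L A (pr (j+1)) W = P) ∧
    ty L A (pr 0) W = Q

theorem isClosed_RA {A : Set M} {α β : Type} :
    IsClosed {p : (Inst L A (α ⊕ β) → Bool) × (Inst L A (α ⊕ β) → Bool) | RA L A p.1 p.2} := by
  have h1 : IsClosed {W : Ultrafilter (Conf M α β) | UInd L A W ∧
      ∀ j, ty L A (pr (j+1)) W = ty L A (pr 1) W} := by
    have e1 : IsClosed (⋂ (r : ℕ) (J : Fin r → ℕ) (J' : Fin r → ℕ) (_ : StrictMono J)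
        (_ : StrictMono J') (s : Set (Fin r × α → M)) (_ : A.Definable L s),
        {W : Ultrafilter (Conf M α β) |
          mb {ω : Conf M α β | (fun p : Fin r × α => ω.1 (J p.1) p.2) ∈ s} W =
          mb {ω : Conf M α β | (fun p : Fin r × α => ω.1 (J' p.1) p.2) ∈ s} W}) :=
      isClosed_iInter fun r => isClosed_iInter fun J => isClosed_iInter fun J' =>
        isClosed_iInter fun hJ => isClosed_iInter fun hJ' => isClosed_iInter fun s =>
        isClosed_iInter fun hs => isClosed_eq (continuous_mb _) (continuous_mb _)
    have e2 : IsClosed (⋂ j, {W : Ultrafilter (Conf M α β) |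
          ty L A (pr (j+1)) W = ty L A (pr 1) W}) :=
        isClosed_iInter fun j => isClosed_eq (continuous_ty _) (continuous_ty _)
    convert e1.inter e2 using 1
    ext W
    simp only [Set.mem_ofPred_eq, mem_inter_iff, mem_iInter, mb_eq, UInd]
    rfl
  have h2 := h1.isCompact.image ((continuous_ty (L := L) (A := A) (pr 1 : Conf M α β → _)).prodMk
    (continuous_ty (L := L) (A := A) (pr 0)))
  convert h2.isClosed using 1
  ext ⟨P, Q⟩
  constructor
  · rintro ⟨W, hW, h, h'⟩
    exact ⟨W, ⟨hW, fun j => (h j).trans (h 0).symm⟩, Prod.ext (h 0) h'⟩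
  · rintro ⟨W, ⟨hW, h⟩, h'⟩
    obtain ⟨rfl, rfl⟩ := Prod.ext_iff.1 h'
    exact ⟨W, hW, h, rfl⟩

end TypeSpace


section Lift
open Filter
variable {M : Type w} [L.Structure M]

theorem fip_ultra {Ω : Type*} [Nonempty Ω] (F : Set (Set Ω)) (hne : ∀ s ∈ F, s.Nonempty)
    (hdir : ∀ s ∈ F, ∀ t ∈ F, ∃ u ∈ F, u ⊆ s ∩ t) : ∃ U : Ultrafilter Ω, ∀ s ∈ F, s ∈ U := by
  rcases F.eq_empty_or_nonempty with rfl | hF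
  · exact ⟨Ultrafilter.of ⊤, fun s hs => hs.elim⟩
  have : Nonempty F := hF.to_subtype
  have hb : (⨅ s : F, 𝓟 (s : Set Ω)).NeBot := by
    apply iInf_neBot_of_directed'
    · intro s t
      obtain ⟨u, hu, h⟩ := hdir s.1 s.2 t.1 t.2
      exact ⟨⟨u, hu⟩, principal_mono.2 (h.trans inter_subset_left),
        principal_mono.2 (h.trans inter_subset_right)⟩
    · intro s
      exact principal_neBot_iff.2 (hne _ s.2)
  refine ⟨Ultrafilter.of (⨅ s : F, 𝓟 (s : Set Ω)), fun s hs => Ultrafilter.of_le _ ?_⟩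
  exact mem_iInf_of_mem ⟨s, hs⟩ (mem_principal_self _)

theorem fip_real (hM : WSat L M) [Nonempty M] {ι : Type*} [Countable ι] {δ : Type} [Finite δ]
    (c : δ → M) (F : Set (Set (ι ⊕ δ → M))) (hd : ∀ s ∈ F, (∅ : Set M).Definable L s)
    (hne : ∀ s ∈ F, ∃ x : ι → M, Sum.elim x c ∈ s)
    (hdir : ∀ s ∈ F, ∀ t ∈ F, ∃ u ∈ F, u ⊆ s ∩ t) : ∃ x : ι → M, ∀ s ∈ F, Sum.elim x c ∈ s := by
  obtain ⟨U, hU⟩ := fip_ultra ((fun s => {x : ι → M | Sum.elim x c ∈ s}) '' F)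
    (by rintro _ ⟨s, hs, rfl⟩; exact hne s hs)
    (by
      rintro _ ⟨s, hs, rfl⟩ _ ⟨t, ht, rfl⟩
      obtain ⟨u, hu, h⟩ := hdir s hs t ht
      exact ⟨_, ⟨u, hu, rfl⟩, fun x hx => h hx⟩)
  obtain ⟨x, hx⟩ := real hM U id c
  refine ⟨x, fun s hs => ?_⟩
  obtain ⟨φ, rfl⟩ := empty_definable_iff.1 (hd s hs)
  exact (hx φ).2 (hU _ ⟨_, hs, rfl⟩)

/-- Extraction on the tail of a sequence, over its first term and `c`. -/
theorem tailext (hM : WSat L M) [Nonempty M] {α δ : Type} [Finite α] [Finite δ] (a : ℕ → α → M)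
    (c : δ → M) : ∃ a' : ℕ → α → M, a' 0 = a 0 ∧
      (∀ (r : ℕ) (s : Set ((Fin r × α) ⊕ (α ⊕ δ) → M)), (∅ : Set M).Definable L s →
        ∀ J J' : Fin r → ℕ, StrictMono J → StrictMono J' →
          (Sum.elim (fun p => a' (J p.1 + 1) p.2) (Sum.elim (a 0) c) ∈ s ↔
          Sum.elim (fun p => a' (J' p.1 + 1) p.2) (Sum.elim (a 0) c) ∈ s)) ∧
      (∀ (s : Set (α ⊕ δ → M)), (∅ : Set M).Definable L s →
        (∀ j, Sum.elim (a (j+1)) c ∈ s) → ∀ j, Sum.elim (a' (j+1)) c ∈ s) ∧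
      (∀ (r : ℕ) (s : Set (Fin r × α → M)), (∅ : Set M).Definable L s →
        (∀ J : Fin r → ℕ, StrictMono J → (fun p : Fin r × α => a (J p.1) p.2) ∈ s) →
        ∀ J : Fin r → ℕ, StrictMono J → (fun p : Fin r × α => a' (J p.1) p.2) ∈ s) := by
  obtain ⟨b, hb⟩ := extr hM (fun j => a (j+1)) (Sum.elim (a 0) c)
  have key : ∀ (r : ℕ) (s : Set ((Fin r × α) ⊕ (α ⊕ δ) → M)), (∅ : Set M).Definable L s →
      (∀ J : Fin r → ℕ, StrictMono J →
        Sum.elim (fun p => a (J p.1 + 1) p.2) (Sum.elim (a 0) c) ∈ s) →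
      ∀ J : Fin r → ℕ, StrictMono J →
        Sum.elim (fun p => b (J p.1) p.2) (Sum.elim (a 0) c) ∈ s := by
    intro r s hs
    obtain ⟨φ, rfl⟩ := empty_definable_iff.1 hs
    exact (hb r φ).2
  refine ⟨fun n => Nat.casesOn n (a 0) b, rfl, ?_, ?_, ?_⟩
  · intro r s hs J J' hJ hJ'
    obtain ⟨φ, rfl⟩ := empty_definable_iff.1 hs
    exact (hb r φ).1 J J' hJ hJ'
  · intro s hs h j
    have := key 1 _ (hs.preimage_comp (Sum.elim (fun x => Sum.inl (0, x)) (fun x => Sum.inr (Sum.inr x)) :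
      α ⊕ δ → (Fin 1 × α) ⊕ (α ⊕ δ))) (by
        intro J hJ
        rw [mem_preimage]
        convert h (J 0) using 1
        funext x; rcases x with x | x <;> rfl) (fun _ => j) (by
          intro x y hxy; exact absurd (Subsingleton.elim x y) hxy.ne)
    rw [mem_preimage] at this
    convert this using 1
    funext x; rcases x with x | x <;> rfl
  · intro r s hs h J hJ
    by_cases h0 : ∀ t, J t ≠ 0
    · have := key r _ (hs.preimage_comp (Sum.inl : _ → (Fin r × α) ⊕ (α ⊕ δ))) (by
        intro J hJ
        exact h (fun t => J t + 1) (fun x y hxy => Nat.succ_lt_succ (hJ hxy))) (fun t => J t - 1) (by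
          intro x y hxy
          have := hJ hxy
          have := h0 x
          change J x - 1 < J y - 1
          omega)
      rw [mem_preimage] at this
      convert this using 1
      funext p
      obtain ⟨t, x⟩ := p
      change (Nat.casesOn (J t) (a 0) b : α → M) x = b (J t - 1) x
      obtain ⟨k, hk⟩ := Nat.exists_eq_succ_of_ne_zero (h0 t)
      rw [hk]; rfl
    · push Not at h0
      obtain ⟨t, ht⟩ := h0
      cases r with
      | zero => exact t.elim0
      | succ r =>
        have hJ0 : J 0 = 0 := by
          have := hJ.monotone (Fin.zero_le t)
          omega
        have hJs : ∀ i : Fin r, J i.succ ≠ 0 := fun i => by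
          have := hJ (Fin.succ_pos i)
          omega
        let f : Fin (r+1) × α → (Fin r × α) ⊕ (α ⊕ δ) := fun p =>
          Fin.cases (Sum.inr (Sum.inl p.2)) (fun i => Sum.inl (i, p.2)) p.1
        have := key r _ (hs.preimage_comp f) (by
          intro J hJ
          rw [mem_preimage]
          convert h (Fin.cons 0 (fun t => J t + 1)) (by
            intro x y hxy
            induction x using Fin.cases with
            | zero =>
              induction y using Fin.cases with
              | zero => exact absurd hxy (lt_irrefl _)
              | succ y => simp
            | succ x =>
              induction y using Fin.cases with
              | zero => exact absurd hxy (Fin.not_lt_zero _)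
              | succ y => simpa using hJ (Fin.succ_lt_succ_iff.1 hxy)) using 1
          funext p
          obtain ⟨t, x⟩ := p
          induction t using Fin.cases <;> rfl) (fun t => J t.succ - 1) (by
            intro x y hxy
            have := hJ (Fin.succ_lt_succ_iff.2 hxy)
            have := hJs x
            change J x.succ - 1 < J y.succ - 1
            omega)
        rw [mem_preimage] at this
        convert this using 1
        funext p
        obtain ⟨t, x⟩ := p
        induction t using Fin.cases with
        | zero => simp [f, hJ0]
        | succ i =>
          obtain ⟨k, hk⟩ := Nat.exists_eq_succ_of_ne_zero (hJs i)
          simp [f, hk]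

end Lift


section Lift2
open Filter
variable {M : Type w} [L.Structure M]

/-- invariance in all blocks but the first one, which is kept fixed -/
def MInv {α : Type} (e : (α → M) → (α → M) → Prop) {n : ℕ} (s : Set (Fin n × α → M)) : Prop :=
  ∀ v v' : Fin n × α → M, (∀ t : Fin n, t.1 = 0 → ∀ x, v (t, x) = v' (t, x)) →
    (∀ t : Fin n, e (fun x => v (t, x)) (fun x => v' (t, x))) → (v ∈ s ↔ v' ∈ s)

def FInv {α : Type} (e : (α → M) → (α → M) → Prop) {n : ℕ} (s : Set (Fin n × α → M)) : Prop :=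
  ∀ v v' : Fin n × α → M,
    (∀ t : Fin n, e (fun x => v (t, x)) (fun x => v' (t, x))) → (v ∈ s ↔ v' ∈ s)

/-- im-indiscernible -/
def FInd (L : FirstOrder.Language.{u, v}) {M : Type w} [L.Structure M] {α : Type}
    (e : (α → M) → (α → M) → Prop) (a : ℕ → α → M) : Prop :=
  ∀ (n : ℕ) (s : Set (Fin n × α → M)), (∅ : Set M).Definable L s → FInv e s →
    ∀ J J' : Fin n → ℕ, StrictMono J → StrictMono J' →
    ((fun p : Fin n × α => a (J p.1) p.2) ∈ s ↔ (fun p : Fin n × α => a (J' p.1) p.2) ∈ s)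

theorem FInv.minv {α : Type} {e : (α → M) → (α → M) → Prop} {n : ℕ} {s : Set (Fin n × α → M)}
    (h : FInv e s) : MInv e s := fun v v' _ h' => h v v' h'

theorem MInv.compl {α : Type} {e : (α → M) → (α → M) → Prop} {n : ℕ} {s : Set (Fin n × α → M)}
    (h : MInv e s) : MInv e sᶜ := fun v v' h1 h' => not_congr (h v v' h1 h')

theorem strictMono_val (n : ℕ) : StrictMono (fun t : Fin n => (t : ℕ)) := fun _ _ h => h

theorem mixed_seq (hM : WSat L M) [Nonempty M] {α : Type} [Finite α]
    (e : (α → M) → (α → M) → Prop) (he : Equivalence e) (a : ℕ → α → M) (ha : FInd L e a) :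
    ∃ A : ℕ → α → M, ∀ n (s : Set (Fin n × α → M)), (∅ : Set M).Definable L s → MInv e s →
      ((fun p : Fin n × α => a p.1 p.2) ∈ s → (fun p : Fin n × α => A p.1.rev p.2) ∈ s) := by
  obtain ⟨A, hA⟩ := seq_exists (X := α → M) (fun _ _ _ => True)
    (fun n f => ∀ (s : Set (Fin n × α → M)), (∅ : Set M).Definable L s → MInv e s →
      ((fun p : Fin n × α => a p.1 p.2) ∈ s → (fun p : Fin n × α => f p.1.rev p.2) ∈ s))
    (by
      intro f s hs hi h
      convert h using 1
      funext p; exact p.1.elim0)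
    (by
      intro n f hf
      let g : Fin (n+1) × α → α ⊕ (Fin n × α) := fun p =>
          Fin.cases (Sum.inl p.2) (fun i => Sum.inr (i, p.2)) p.1
      have hg : ∀ (x : α → M) (y : Fin n → α → M),
          Sum.elim x (fun p : Fin n × α => y p.1 p.2) ∘ g =
          fun p : Fin (n+1) × α => (Fin.cons x y : Fin (n+1) → α → M) p.1 p.2 := by
        intro x y
        funext p
        obtain ⟨t, z⟩ := p
        induction t using Fin.cases <;> rfl
      obtain ⟨x, hx⟩ := fip_real hM (ι := α) (fun p : Fin n × α => f p.1.rev p.2)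
        {s' | ∃ s : Set (Fin (n+1) × α → M), (∅ : Set M).Definable L s ∧ MInv e s ∧
          (fun p : Fin (n+1) × α => a p.1 p.2) ∈ s ∧ s' = (fun v => v ∘ g) ⁻¹' s}
        (by
          rintro _ ⟨s, hs, -, -, rfl⟩
          exact hs.preimage_comp g)
        (by
          rintro _ ⟨s, hs, hi, h, rfl⟩
          let s1 : Set (Fin n × α → M) := (fun v : α ⊕ (Fin n × α) → M => v ∘ Sum.inr) ''
            ((fun v : α ⊕ (Fin n × α) → M => v ∘ g) ⁻¹' s)
          have hs1 : (∅ : Set M).Definable L s1 := (hs.preimage_comp g).image_comp Sum.inr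
          have hfi : ∀ v v' : Fin n × α → M,
              (∀ t : Fin n, e (fun x => v (t, x)) (fun x => v' (t, x))) → (v ∈ s1 → v' ∈ s1) := by
            rintro v v' hvv ⟨w, hw, rfl⟩
            refine ⟨Sum.elim (w ∘ Sum.inl) v', ?_, by simp⟩
            rw [mem_preimage] at hw ⊢
            refine (hi _ _ ?_ ?_).1 hw
            · intro t ht x
              obtain rfl : t = 0 := Fin.ext ht
              rfl
            · intro t
              induction t using Fin.cases with
              | zero => exact he.refl _
              | succ t => exact hvv t
          have hfi' : FInv e s1 := fun v v' h => ⟨hfi v v' h, hfi v' v (fun t => he.symm (h t))⟩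
          have m1 : (fun p : Fin n × α => a (p.1.1 + 1) p.2) ∈ s1 := by
            refine ⟨Sum.elim (a 0) (fun p : Fin n × α => a (p.1.1 + 1) p.2), ?_, by simp⟩
            rw [mem_preimage, hg (a 0) (fun t => a (t + 1))]
            convert h using 1
            funext p
            obtain ⟨t, z⟩ := p
            induction t using Fin.cases <;> rfl
          have m2 : (fun p : Fin n × α => a p.1.1 p.2) ∈ s1 :=
            (ha n s1 hs1 hfi' (fun t => t + 1) (fun t => t)
              (fun _ _ h => Nat.succ_lt_succ h) (strictMono_val n)).1 m1
          obtain ⟨w, hw, hw'⟩ := hf s1 hs1 hfi'.minv m2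
          refine ⟨w ∘ Sum.inl, ?_⟩
          rw [← hw']
          simpa using hw)
        (by
          rintro _ ⟨s, hs, hi, h, rfl⟩ _ ⟨t, ht, hi', h', rfl⟩
          refine ⟨_, ⟨s ∩ t, hs.inter ht, ?_, ⟨h, h'⟩, rfl⟩, subset_rfl⟩
          intro v v' h1 h2
          exact and_congr (hi v v' h1 h2) (hi' v v' h1 h2))
      refine ⟨x, trivial, ?_⟩
      intro s hs hi h
      have := hx _ ⟨s, hs, hi, h, rfl⟩
      rw [mem_preimage, hg x (fun t => f t.rev)] at this
      convert this using 1
      funext p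
      obtain ⟨t, z⟩ := p
      induction t using Fin.cases with
      | zero => simp
      | succ t => simp [Fin.rev_succ])
  exact ⟨A, fun n => (hA n).2⟩

theorem mixed_ind (hM : WSat L M) [Nonempty M] {α : Type} [Finite α]
    (e : (α → M) → (α → M) → Prop) (he : Equivalence e) (a : ℕ → α → M) (ha : FInd L e a)
    (hta : ∀ (r : ℕ) (s : Set ((Fin r × α) ⊕ α → M)), (∅ : Set M).Definable L s →
        ∀ J J' : Fin r → ℕ, StrictMono J → StrictMono J' →
          (Sum.elim (fun p => a (J p.1 + 1) p.2) (a 0) ∈ s ↔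
          Sum.elim (fun p => a (J' p.1 + 1) p.2) (a 0) ∈ s)) :
    ∃ A : ℕ → α → M, IsIndiscernible (L := L) A ∧
      ∀ n (s : Set (Fin n × α → M)), (∅ : Set M).Definable L s → MInv e s →
      ((fun p : Fin n × α => A p.1 p.2) ∈ s → (fun p : Fin n × α => a p.1 p.2) ∈ s) := by
  obtain ⟨B, hB⟩ := mixed_seq hM e he a ha
  obtain ⟨A, hA⟩ := extr_rev hM B (Empty.elim : Empty → M)
  refine ⟨A, ?_, ?_⟩
  · intro n i j hi hj φ
    have := (hA n (φ.relabel Sum.inl)).1 i j hi hj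
    simpa [Formula.realize_relabel, Function.comp_def] using this
  · intro n s hs hi h
    by_contra hcon
    have key : ∀ J : Fin n → ℕ, StrictAnti J → (fun p : Fin n × α => B (J p.1) p.2) ∈ sᶜ := by
      intro J hJ
      cases n with
      | zero =>
        convert hcon using 2
        funext p; exact p.1.elim0
      | succ n =>
        -- indices
        have hle : ∀ t, J t ≤ J 0 := fun t => hJ.antitone (Fin.zero_le t)
        let f : Fin (n+1) × α → Fin (J 0 + 1) × α := fun p => (⟨J 0 - J p.1, by omega⟩, p.2)
        have h1 := hB (J 0 + 1) _ (hs.compl.preimage_comp f) (by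
          intro v v' h1 h2
          refine hi.compl _ _ ?_ ?_
          · intro t ht x
            obtain rfl : t = 0 := Fin.ext ht
            exact h1 _ (by simp) x
          · intro t
            exact h2 ⟨J 0 - J t, by omega⟩) ?_
        · rw [mem_preimage] at h1
          convert h1 using 1
          funext p
          simp only [Function.comp, f, Fin.rev]
          congr 1
          have := hle p.1
          change J p.1 = J 0 + 1 - (J 0 - J p.1 + 1)
          omega
        · let g : Fin (n+1) × α → (Fin n × α) ⊕ α := fun p =>
            Fin.cases (Sum.inr p.2) (fun i => Sum.inl (i, p.2)) p.1
          have h2 := hta n _ (hs.compl.preimage_comp g) (fun t => t)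
            (fun t => J 0 - J t.succ - 1) (strictMono_val n) (by
              intro x y hxy
              have := hJ (Fin.succ_lt_succ_iff.2 hxy)
              have := hJ (Fin.succ_pos x)
              have := hJ (Fin.succ_pos y)
              change J 0 - J x.succ - 1 < J 0 - J y.succ - 1
              omega)
          rw [mem_preimage, mem_preimage] at h2
          rw [mem_preimage]
          have h3 := h2.1 (by
            convert hcon using 2
            funext p
            obtain ⟨t, z⟩ := p
            induction t using Fin.cases <;> rfl)
          convert h3 using 1
          funext p
          obtain ⟨t, z⟩ := p
          induction t using Fin.cases with
          | zero => simp [f, g]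
          | succ t =>
            simp only [Function.comp, f, g, Fin.cases_succ, Sum.elim_inl]
            congr 1
            have := hJ (Fin.succ_pos t)
            omega
    obtain ⟨φ, hφ⟩ := empty_definable_iff.1 hs.compl
    have h4 := (hA n (φ.relabel Sum.inl)).2 (by
      intro J hJ
      have := key J hJ
      rw [hφ] at this
      simpa [Formula.realize_relabel, Function.comp_def] using this) (fun t => t) (strictMono_val n)
    have h5 : (fun p : Fin n × α => A p.1 p.2) ∈ sᶜ := by
      rw [hφ]
      simpa [Formula.realize_relabel, Function.comp_def] using h4
    exact h5 h

end Lift2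


section Lift3
open Filter
variable {M : Type w} [L.Structure M]

def Inv2 {α β : Type} (e : (α → M) → (α → M) → Prop) (e' : (β → M) → (β → M) → Prop)
    (s : Set (α ⊕ β → M)) : Prop :=
  ∀ (c c' : α → M) (d d' : β → M), e c c' → e' d d' → (Sum.elim c d ∈ s ↔ Sum.elim c' d' ∈ s)

theorem lift_step1 (hM : WSat L M) [Nonempty M] {α β : Type} [Finite α] [Finite β]
    {e : (α → M) → (α → M) → Prop} (he : Equivalence e)
    (hed : (∅ : Set M).Definable L {v : α ⊕ α → M | e (v ∘ Sum.inl) (v ∘ Sum.inr)})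
    {e' : (β → M) → (β → M) → Prop} (he' : Equivalence e')
    (hed' : (∅ : Set M).Definable L {v : β ⊕ β → M | e' (v ∘ Sum.inl) (v ∘ Sum.inr)})
    (a0 C : α → M) (d D : β → M)
    (hq : ∀ s : Set (α ⊕ β → M), (∅ : Set M).Definable L s → Inv2 e e' s → Sum.elim C D ∈ s →
      Sum.elim a0 d ∈ s) :
    ∃ a1 d1, e a1 a0 ∧ e' d1 d ∧ EqT L (Sum.elim a1 d1) (Sum.elim C D) := by
  let f1 : α ⊕ α → (α ⊕ β) ⊕ (α ⊕ β) := Sum.map Sum.inl Sum.inl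
  let f2 : β ⊕ β → (α ⊕ β) ⊕ (α ⊕ β) := Sum.map Sum.inr Sum.inr
  let G : Set (α ⊕ β → M) → Set ((α ⊕ β) ⊕ (α ⊕ β) → M) := fun s =>
    ((fun v => v ∘ Sum.inl) ⁻¹' s ∩
      ((fun v => v ∘ f1) ⁻¹' {v : α ⊕ α → M | e (v ∘ Sum.inl) (v ∘ Sum.inr)} ∩
        (fun v => v ∘ f2) ⁻¹' {v : β ⊕ β → M | e' (v ∘ Sum.inl) (v ∘ Sum.inr)}))
  have hGd : ∀ s, (∅ : Set M).Definable L s → (∅ : Set M).Definable L (G s) := fun s hs =>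
    (hs.preimage_comp _).inter ((hed.preimage_comp f1).inter (hed'.preimage_comp f2))
  have hG : ∀ s x y, Sum.elim x y ∈ G s ↔ x ∈ s ∧ e (x ∘ Sum.inl) (y ∘ Sum.inl) ∧
      e' (x ∘ Sum.inr) (y ∘ Sum.inr) := fun s x y => Iff.rfl
  obtain ⟨x, hx⟩ := fip_real hM (ι := α ⊕ β) (Sum.elim a0 d)
    {s' | ∃ s, (∅ : Set M).Definable L s ∧ Sum.elim C D ∈ s ∧ s' = G s}
    (by rintro _ ⟨s, hs, -, rfl⟩; exact hGd s hs)
    (by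
      rintro _ ⟨s, hs, h, rfl⟩
      have hmem : ∀ y, y ∈ (fun v : (α ⊕ β) ⊕ (α ⊕ β) → M => v ∘ Sum.inr) '' G s ↔
          ∃ x, Sum.elim x y ∈ G s := by
        intro y
        constructor
        · rintro ⟨v, hv, rfl⟩
          exact ⟨v ∘ Sum.inl, by simpa using hv⟩
        · rintro ⟨x, hx⟩
          exact ⟨_, hx, by simp⟩
      have := hq _ ((hGd s hs).image_comp Sum.inr) (by
        have : ∀ (c c' : α → M) (d d' : β → M), e c c' → e' d d' →
          (∃ x, Sum.elim x (Sum.elim c d) ∈ G s) → (∃ x, Sum.elim x (Sum.elim c' d') ∈ G s) := by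
          rintro c c' d d' h1 h2 ⟨x, hx⟩
          rw [hG] at hx
          refine ⟨x, (hG _ _ _).2 ⟨hx.1, he.trans hx.2.1 h1, he'.trans hx.2.2 h2⟩⟩
        intro c c' d d' h1 h2
        rw [hmem, hmem]
        exact ⟨this _ _ _ _ h1 h2, this _ _ _ _ (he.symm h1) (he'.symm h2)⟩)
        ((hmem _).2 ⟨Sum.elim C D, (hG _ _ _).2 ⟨h, he.refl _, he'.refl _⟩⟩)
      exact (hmem _).1 this)
    (by
      rintro _ ⟨s, hs, h, rfl⟩ _ ⟨t, ht, h', rfl⟩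
      refine ⟨_, ⟨s ∩ t, hs.inter ht, ⟨h, h'⟩, rfl⟩, ?_⟩
      rintro v ⟨h1, h2⟩
      exact ⟨⟨h1.1, h2⟩, ⟨h1.2, h2⟩⟩)
  refine ⟨x ∘ Sum.inl, x ∘ Sum.inr, ?_, ?_, ?_⟩
  · exact ((hG _ _ _).1 (hx _ ⟨univ, definable_univ, mem_univ _, rfl⟩)).2.1
  · exact ((hG _ _ _).1 (hx _ ⟨univ, definable_univ, mem_univ _, rfl⟩)).2.2
  · rw [Sum.elim_comp_inl_inr]
    apply EqT.symm
    rw [eqT_iff_mem]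
    intro s hs
    constructor
    · intro h
      exact ((hG _ _ _).1 (hx _ ⟨s, hs, h, rfl⟩)).1
    · intro h
      by_contra h'
      exact ((hG _ _ _).1 (hx _ ⟨sᶜ, hs.compl, h', rfl⟩)).1 h

theorem definable_forall {A : Set M} {ι γ : Type*} [Finite ι] (s : ι → Set (γ → M))
    (hs : ∀ i, A.Definable L (s i)) : A.Definable L {v | ∀ i, v ∈ s i} := by
  have := Fintype.ofFinite ι
  have h := Set.definable_biInter_finset (A := A) (L := L) hs Finset.univ
  convert h using 1
  ext v; simp

theorem lift_step4 (hM : WSat L M) [Nonempty M] {α β : Type} [Finite α] [Finite β]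
    {e : (α → M) → (α → M) → Prop} (he : Equivalence e)
    (hed : (∅ : Set M).Definable L {v : α ⊕ α → M | e (v ∘ Sum.inl) (v ∘ Sum.inr)})
    {e' : (β → M) → (β → M) → Prop} (he' : Equivalence e')
    (a Y : ℕ → α → M) (d : β → M)
    (hY : ∀ n (s : Set (Fin n × α → M)), (∅ : Set M).Definable L s → MInv e s →
      ((fun p : Fin n × α => Y p.1 p.2) ∈ s → (fun p : Fin n × α => a p.1 p.2) ∈ s)) :
    ∃ X : ℕ → α → M, X 0 = a 0 ∧
      (∀ n (s : Set (Fin n × α → M)), (∅ : Set M).Definable L s →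
        (fun p : Fin n × α => Y p.1 p.2) ∈ s → (fun p : Fin n × α => X p.1 p.2) ∈ s) ∧
      (∀ u : Set (α ⊕ β → M), (∅ : Set M).Definable L u → Inv2 e e' u →
        (∀ t, Sum.elim (a (t+1)) d ∈ u) → ∀ t, Sum.elim (X (t+1)) d ∈ u) := by
  let G : ∀ n, Set (Fin n × α → M) → Set (α ⊕ β → M) → Set ((ℕ × α) ⊕ (α ⊕ β) → M) := fun n s u =>
    {v | (fun p : Fin n × α => v (Sum.inl (p.1.1, p.2))) ∈ s} ∩
    ({v | ∀ x, v ∈ {v | v (Sum.inl (0, x)) = v (Sum.inr (Sum.inl x))}} ∩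
    {v | ∀ t : Fin n, v ∈ {v | t.1 ≠ 0 → Sum.elim (fun x => v (Sum.inl (t.1, x)))
      (fun y => v (Sum.inr (Sum.inr y))) ∈ u}})
  have hGd : ∀ n s u, (∅ : Set M).Definable L s → (∅ : Set M).Definable L u →
      (∅ : Set M).Definable L (G n s u) := by
    intro n s u hs hu
    refine (hs.preimage_comp (fun p : Fin n × α => (Sum.inl (p.1.1, p.2) : (ℕ × α) ⊕ (α ⊕ β)))).inter
      ((definable_forall _ ?_).inter (definable_forall _ ?_))
    · intro x
      exact empty_definable_iff.2 ⟨Term.equal (Term.var (Sum.inl (0, x))) (Term.var (Sum.inr (Sum.inl x))), by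
        ext v; simp [Formula.realize_equal]⟩
    · intro t
      by_cases ht : t.1 = 0
      · simp only [ht, ne_eq, not_true, false_imp_iff]
        exact definable_univ
      · simp only [ht, ne_eq, not_false_eq_true, true_imp_iff]
        convert hu.preimage_comp (Sum.elim (fun x => Sum.inl (t.1, x)) (fun y => Sum.inr (Sum.inr y)) :
          α ⊕ β → (ℕ × α) ⊕ (α ⊕ β)) using 1
        ext v
        rw [mem_preimage, Sum.comp_elim]
        rfl
  obtain ⟨X, hX⟩ := fip_real hM (ι := ℕ × α) (Sum.elim (a 0) d)
    {g | ∃ n s u, (∅ : Set M).Definable L s ∧ (∅ : Set M).Definable L u ∧ Inv2 e e' u ∧ 1 ≤ n ∧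
      (fun p : Fin n × α => Y p.1 p.2) ∈ s ∧ (∀ t, Sum.elim (a (t+1)) d ∈ u) ∧ g = G n s u}
    (by rintro _ ⟨n, s, u, hs, hu, -, -, -, -, rfl⟩; exact hGd n s u hs hu)
    (by
      rintro _ ⟨n, s, u, hs, hu, hui, hn, h, h', rfl⟩
      let s1 : Set ((Fin n × α) ⊕ (Fin n × α) → M) :=
        (fun v => v ∘ Sum.inl) ⁻¹' s ∩
          ({v | ∀ p : Fin n × α, v ∈ {v | p.1.1 = 0 → v (Sum.inl p) = v (Sum.inr p)}} ∩
          {v | ∀ t : Fin n, v ∈ (fun v => v ∘ (Sum.map (fun x => (t, x)) (fun x => (t, x)) :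
            α ⊕ α → (Fin n × α) ⊕ (Fin n × α))) ⁻¹'
              {v : α ⊕ α → M | e (v ∘ Sum.inl) (v ∘ Sum.inr)}})
      have hs1 : (∅ : Set M).Definable L s1 := by
        refine (hs.preimage_comp _).inter ((definable_forall _ ?_).inter (definable_forall _ ?_))
        · intro p
          by_cases ht : p.1.1 = 0
          · simp only [ht, true_imp_iff]
            exact empty_definable_iff.2 ⟨Term.equal (Term.var (Sum.inl p)) (Term.var (Sum.inr p)), by
              ext v; simp [Formula.realize_equal]⟩
          · simp only [ht, false_imp_iff]
            exact definable_univ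
        · intro t
          exact hed.preimage_comp _
      have hmem : ∀ x y, Sum.elim x y ∈ s1 ↔ x ∈ s ∧ (∀ p : Fin n × α, p.1.1 = 0 → x p = y p) ∧
          ∀ t : Fin n, e (fun z => x (t, z)) (fun z => y (t, z)) := fun x y => Iff.rfl
      have hmem2 : ∀ y, y ∈ (fun v : (Fin n × α) ⊕ (Fin n × α) → M => v ∘ Sum.inr) '' s1 ↔
          ∃ x, Sum.elim x y ∈ s1 := by
        intro y
        constructor
        · rintro ⟨v, hv, rfl⟩
          exact ⟨v ∘ Sum.inl, by simpa using hv⟩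
        · rintro ⟨x, hx⟩
          exact ⟨_, hx, by simp⟩
      have := hY n _ (hs1.image_comp Sum.inr) (by
        have : ∀ v v' : Fin n × α → M, (∀ t : Fin n, t.1 = 0 → ∀ x, v (t, x) = v' (t, x)) →
          (∀ t : Fin n, e (fun x => v (t, x)) (fun x => v' (t, x))) →
            (∃ x, Sum.elim x v ∈ s1) → (∃ x, Sum.elim x v' ∈ s1) := by
          rintro v v' h1 h2 ⟨x, hx⟩
          rw [hmem] at hx
          exact ⟨x, (hmem _ _).2 ⟨hx.1, fun p hp => (hx.2.1 p hp).trans (h1 p.1 hp p.2),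
            fun t => he.trans (hx.2.2 t) (h2 t)⟩⟩
        intro v v' h1 h2
        rw [hmem2, hmem2]
        exact ⟨this _ _ h1 h2, this _ _ (fun t ht x => (h1 t ht x).symm) (fun t => he.symm (h2 t))⟩)
        ((hmem2 _).2 ⟨fun p : Fin n × α => Y p.1 p.2, (hmem _ _).2 ⟨h, fun _ _ => rfl,
          fun t => he.refl _⟩⟩)
      obtain ⟨x, hx⟩ := (hmem2 _).1 this
      rw [hmem] at hx
      refine ⟨fun p => if hp : p.1 < n then x (⟨p.1, hp⟩, p.2) else a 0 p.2, ?_, ?_, ?_⟩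
      · change (fun p : Fin n × α => _) ∈ s
        convert hx.1 using 1
        funext p
        simp
      · intro z
        have h0 : 0 < n := hn
        simpa [h0] using hx.2.1 (⟨0, hn⟩, z) rfl
      · intro t ht
        have := hx.2.2 t
        refine (hui _ _ _ _ ?_ (he'.refl d)).1 (h' (t.1 - 1))
        have e1 : t.1 - 1 + 1 = t.1 := by omega
        rw [e1]
        convert he.symm this using 1
        funext z
        simp)
    (by
      rintro _ ⟨n, s, u, hs, hu, hui, hn, h, h', rfl⟩ _ ⟨n1, s', u', hs', hu', hui', hn1, k, k', rfl⟩
      let f1 : Fin n × α → Fin (max n n1) × α := fun p => (⟨p.1.1, by have := p.1.2; omega⟩, p.2)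
      let f2 : Fin n1 × α → Fin (max n n1) × α := fun p => (⟨p.1.1, by have := p.1.2; omega⟩, p.2)
      refine ⟨_, ⟨max n n1, (fun v => v ∘ f1) ⁻¹' s ∩ (fun v => v ∘ f2) ⁻¹' s', u ∩ u',
        (hs.preimage_comp f1).inter (hs'.preimage_comp f2), hu.inter hu', ?_, by omega, ⟨h, k⟩,
        fun t => ⟨h' t, k' t⟩, rfl⟩, ?_⟩
      · intro c c' d d' h1 h2
        exact and_congr (hui _ _ _ _ h1 h2) (hui' _ _ _ _ h1 h2)
      · rintro v ⟨⟨h1, h1'⟩, h2, h3⟩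
        refine ⟨⟨h1, h2, fun t ht => (h3 ⟨t.1, by have := t.2; omega⟩ ht).1⟩,
          ⟨h1', h2, fun t ht => (h3 ⟨t.1, by have := t.2; omega⟩ ht).2⟩⟩)
  refine ⟨fun n x => X (n, x), ?_, ?_, ?_⟩
  · have := hX _ ⟨1, univ, univ, definable_univ, definable_univ, fun _ _ _ _ _ _ => Iff.rfl, le_rfl,
      mem_univ _, fun _ => mem_univ _, rfl⟩
    funext x
    exact this.2.1 x
  · intro n s hs h
    cases n with
    | zero =>
      convert h using 1
      funext p; exact p.1.elim0
    | succ n =>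
      exact (hX _ ⟨n+1, s, univ, hs, definable_univ, fun _ _ _ _ _ _ => Iff.rfl, by omega,
        h, fun _ => mem_univ _, rfl⟩).1
  · intro u hu hui h t
    exact (hX _ ⟨t+2, univ, u, definable_univ, hu, hui, by omega,
        mem_univ _, h, rfl⟩).2.2 ⟨t+1, by omega⟩ (by simp)

theorem lift (hM : WSat L M) [Nonempty M] {α β : Type} [Finite α] [Finite β]
    {e : (α → M) → (α → M) → Prop} (he : Equivalence e)
    (hed : (∅ : Set M).Definable L {v : α ⊕ α → M | e (v ∘ Sum.inl) (v ∘ Sum.inr)})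
    {e' : (β → M) → (β → M) → Prop} (he' : Equivalence e')
    (hed' : (∅ : Set M).Definable L {v : β ⊕ β → M | e' (v ∘ Sum.inl) (v ∘ Sum.inr)})
    (a : ℕ → α → M) (ha : FInd L e a) (C c1 : α → M) (d D d1 : β → M)
    (hq : ∀ s : Set (α ⊕ β → M), (∅ : Set M).Definable L s → Inv2 e e' s → Sum.elim C D ∈ s →
      Sum.elim (a 0) d ∈ s)
    (hp : ∀ s : Set (α ⊕ β → M), (∅ : Set M).Definable L s → Inv2 e e' s → Sum.elim c1 d1 ∈ s →
      ∀ j, Sum.elim (a (j+1)) d ∈ s) :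
    ∃ (A : ℕ → α → M) (B : β → M), IsIndiscernible (L := L) A ∧
      EqT L (Sum.elim (A 0) B) (Sum.elim C D) ∧
      (∀ j, EqT L (Sum.elim (A (j+1)) B) (Sum.elim (A 1) B)) ∧
      ∀ s : Set (α ⊕ β → M), (∅ : Set M).Definable L s → Inv2 e e' s → Sum.elim c1 d1 ∈ s →
        Sum.elim (A 1) B ∈ s := by
  obtain ⟨x0, B, hx0, hB, hEq⟩ := lift_step1 hM he hed he' hed' (a 0) C d D hq
  -- replace the first term
  let b : ℕ → α → M := fun n => if n = 0 then x0 else a n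
  have hba : ∀ n, e (b n) (a n) := by
    intro n
    by_cases h : n = 0
    · subst h; simpa [b] using hx0
    · simp only [b, h, if_false]; exact he.refl _
  have hb : FInd L e b := by
    intro n s hs hi J J' hJ hJ'
    exact (hi _ (fun p : Fin n × α => a (J p.1) p.2) (fun t => hba (J t))).trans
      ((ha n s hs hi J J' hJ hJ').trans
      (hi _ (fun p : Fin n × α => a (J' p.1) p.2) (fun t => hba (J' t))).symm)
  obtain ⟨a', h0, h1, h2, h3⟩ := tailext hM b B
  have ha' : FInd L e a' := by
    have hh : ∀ (n : ℕ) (s : Set (Fin n × α → M)), (∅ : Set M).Definable L s → FInv e s →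
      ∀ J J' : Fin n → ℕ, StrictMono J → StrictMono J' →
      ((fun p : Fin n × α => a' (J p.1) p.2) ∈ s → (fun p : Fin n × α => a' (J' p.1) p.2) ∈ s) := by
      intro n s hs hi J J' hJ hJ' h
      by_cases hc : (fun p : Fin n × α => b (J p.1) p.2) ∈ s
      · exact h3 n s hs (fun J'' hJ'' => (hb n s hs hi J J'' hJ hJ'').1 hc) J' hJ'
      · exact absurd h (h3 n sᶜ hs.compl (fun J'' hJ'' h' => hc ((hb n s hs hi J J'' hJ hJ'').2 h')) J hJ)
    intro n s hs hi J J' hJ hJ'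
    exact ⟨hh n s hs hi J J' hJ hJ', hh n s hs hi J' J hJ' hJ⟩
  obtain ⟨Y, hYi, hY⟩ := mixed_ind hM e he a' ha' (by
    intro r s hs J J' hJ hJ'
    have := h1 r _ (hs.preimage_comp (Sum.map id Sum.inl : _ → (Fin r × α) ⊕ (α ⊕ β))) J J' hJ hJ'
    rw [mem_preimage, mem_preimage, Sum.elim_comp_map, Sum.elim_comp_map] at this
    rw [h0]
    exact this)
  obtain ⟨X, hX0, hX1, hX2⟩ := lift_step4 hM he hed he' a' Y B hY
  have hXi : ∀ (r : ℕ) (s : Set (Fin r × α → M)), (∅ : Set M).Definable L s →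
      ∀ J J' : Fin r → ℕ, StrictMono J → StrictMono J' →
      (fun p : Fin r × α => X (J p.1) p.2) ∈ s → (fun p : Fin r × α => X (J' p.1) p.2) ∈ s := by
    have hg : ∀ (r : ℕ) (s : Set (Fin r × α → M)), (∅ : Set M).Definable L s →
      ∀ J : Fin r → ℕ, 
      (fun p : Fin r × α => Y (J p.1) p.2) ∈ s → (fun p : Fin r × α => X (J p.1) p.2) ∈ s := by
      intro r s hs J h
      obtain ⟨N, hN⟩ := (Set.finite_range J).bddAbove
      let f : Fin r × α → Fin (N+1) × α := fun p =>
        (⟨J p.1, Nat.lt_succ_of_le (hN ⟨p.1, rfl⟩)⟩, p.2)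
      exact hX1 (N+1) _ (hs.preimage_comp f) h
    intro r s hs J J' hJ hJ' h
    apply hg r s hs J'
    by_contra hc
    obtain ⟨φ, rfl⟩ := empty_definable_iff.1 hs
    have : (fun p : Fin r × α => Y (J p.1) p.2) ∈ (Set.ofPred φ.Realize)ᶜ :=
      fun h' => hc ((hYi r J J' hJ hJ' φ).1 h')
    exact hg r _ hs.compl J this h
  obtain ⟨A, k0, k1, k2, k3⟩ := tailext hM X B
  have hb0 : b 0 = x0 := if_pos rfl
  refine ⟨A, B, ?_, ?_, ?_, ?_⟩
  · intro n i j hi hj φ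
    have hh : ∀ (s : Set (Fin n × α → M)), (∅ : Set M).Definable L s → 
      ((fun p : Fin n × α => A (i p.1) p.2) ∈ s → (fun p : Fin n × α => A (j p.1) p.2) ∈ s) := by
      intro s hs h
      by_cases hc : (fun p : Fin n × α => X (i p.1) p.2) ∈ s
      · exact k3 n s hs (fun J'' hJ'' => hXi n s hs i J'' hi hJ'' hc) j hj
      · exact absurd h (k3 n sᶜ hs.compl (fun J'' hJ'' h' => hc (hXi n s hs J'' i hJ'' hi h')) i hi)
    refine ⟨hh _ (empty_def_of φ), fun h => ?_⟩
    by_contra hc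
    exact hh _ (empty_def_of φ).compl hc h
  · rw [k0, hX0, h0, hb0]; exact hEq
  · intro j
    rw [eqT_iff_mem]
    intro s hs
    let f : α ⊕ β → (Fin 1 × α) ⊕ (α ⊕ β) := Sum.map (fun x => (0, x)) Sum.inr
    have := k1 1 _ (hs.preimage_comp f) (fun _ => j) (fun _ => 0) (Subsingleton.strictMono _)
      (Subsingleton.strictMono _)
    rw [mem_preimage, mem_preimage, Sum.elim_comp_map, Sum.elim_comp_map] at this
    exact this
  · intro s hs hi h
    refine k2 s hs (hX2 s hs hi (h2 s hs ?_)) 0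
    intro j
    have := hp s hs hi h j
    have e1 : b (j+1) = a (j+1) := if_neg (by omega)
    rw [e1]
    exact (hi _ _ _ _ (he.refl _) (he'.symm hB)).1 this

end Lift3


section Dir1
open Filter

theorem acyc_RA {T : L.Theory} (hac : IsIndAcyclic T) (M : Theory.ModelType.{u, v, max u v} T)
    (hM : WSat L M) {α β : Type} [Finite α] [Finite β] (N : ℕ) (hN : 2 ≤ N)
    (f : ℕ → Inst L (∅ : Set M) (α ⊕ β) → Bool) (hper : ∀ i, f (i + N) = f i)
    (hR : ∀ i, RA L (∅ : Set M) (f i) (f (i+1))) : ∃ i j, i < N ∧ j < N ∧ i ≠ j ∧ f i = f j := by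
  obtain ⟨k, ⟨e1⟩⟩ := Finite.exists_equiv_fin α
  obtain ⟨l, ⟨e2⟩⟩ := Finite.exists_equiv_fin β
  let g : Fin k ⊕ Fin l → α ⊕ β := Sum.map e1.symm e2.symm
  let pre : L.Formula (Fin k ⊕ Fin l) → Inst L (∅ : Set M) (α ⊕ β) := fun φ =>
    ⟨(fun v => v ∘ g) ⁻¹' {v | φ.Realize v}, (empty_def_of φ).preimage_comp g⟩
  let p : ℕ → Set (L.Formula (Fin k ⊕ Fin l)) := fun i => {φ | f i (pre φ) = true}
  have hPf : ∀ i, Pf T (p i) (p (i+1)) := by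
    intro i
    obtain ⟨W, hW, h1, h0⟩ := hR i
    obtain ⟨x, hx⟩ := real hM W (fun ω : Conf M α β => (Sum.elim (fun q : ℕ × Fin k => ω.1 q.1 (e1.symm q.2))
      (fun y : Fin l => ω.2 (e2.symm y)) : (ℕ × Fin k) ⊕ Fin l → M)) (Empty.elim : Empty → M)
    have hx' : ∀ {ξ : Type} (h : ξ → (ℕ × Fin k) ⊕ Fin l) (φ : L.Formula ξ), φ.Realize (x ∘ h) ↔
        ∀ᶠ ω : Conf M α β in W, φ.Realize ((Sum.elim (fun q : ℕ × Fin k => ω.1 q.1 (e1.symm q.2))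
      (fun y : Fin l => ω.2 (e2.symm y)) : (ℕ × Fin k) ⊕ Fin l → M) ∘ h) := by
      intro ξ h φ
      have := hx (φ.relabel (Sum.inl ∘ h))
      simp only [Formula.realize_relabel, ← Function.comp_assoc, Sum.elim_comp_inl] at this
      exact this
    have hty : ∀ j, typeOf (L := L) (Sum.elim (fun z => x (Sum.inl (j, z))) (fun y => x (Sum.inr y))) =
        {φ | ty L (∅ : Set M) (pr j) W (pre φ) = true} := by
      intro j
      ext φ
      have := hx' (Sum.map (fun z => (j, z)) id : Fin k ⊕ Fin l → _) φ
      rw [Set.mem_ofPred_eq, ty_true]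
      have e0 : x ∘ (Sum.map (fun z => (j, z)) id : Fin k ⊕ Fin l → _) =
        (Sum.elim (fun z => x (Sum.inl (j, z))) (fun y => x (Sum.inr y))) := by
        funext z; rcases z with z | z <;> rfl
      rw [e0] at this
      refine this.trans ?_
      apply iff_of_eq
      congr 1
      funext ω
      apply propext
      apply iff_of_eq
      change φ.Realize _ = φ.Realize _
      congr 1
      funext z; rcases z with z | z <;> rfl
    refine ⟨M, fun y => x (Sum.inr y), fun j z => x (Sum.inl (j, z)), ?_, ?_, ?_⟩
    · intro n J J' hJ hJ' φ
      have hh : ∀ J : Fin n → ℕ, φ.Realize (fun p : Fin n × Fin k => x (Sum.inl (J p.1, p.2))) ↔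
          ∀ᶠ ω : Conf M α β in W, (fun p : Fin n × α => ω.1 (J p.1) p.2) ∈
            (fun v : Fin n × α → M => v ∘ (fun p : Fin n × Fin k => (p.1, e1.symm p.2))) ⁻¹'
              {v | φ.Realize v} := fun J =>
        hx' (fun p : Fin n × Fin k => Sum.inl (J p.1, p.2)) φ
      exact (hh J).trans ((hW n J J' hJ hJ' _ ((empty_def_of φ).preimage_comp _)).trans (hh J').symm)
    · intro j hj
      obtain ⟨j, rfl⟩ := Nat.exists_eq_succ_of_ne_zero hj.ne'
      rw [hty, h1 j]
    · rw [hty, h0]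
  obtain ⟨i, j, hi, hj, hij, h⟩ := hac N hN k l p (by
    intro i
    obtain ⟨M', b, a, -, h, -⟩ := hPf i
    exact ⟨M', _, h 1 one_pos⟩) (by
    intro i; simp only [p, hper]) hPf
  refine ⟨i, j, hi, hj, hij, ?_⟩
  funext ⟨s, hs⟩
  obtain ⟨φ, hφ⟩ := empty_definable_iff.1 hs
  have e0 : (⟨s, hs⟩ : Inst L (∅ : Set M) (α ⊕ β)) = pre (φ.relabel (Sum.map e1 e2)) := by
    apply Subtype.ext
    change s = (fun v => v ∘ g) ⁻¹' {v | (φ.relabel (Sum.map e1 e2)).Realize v}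
    rw [hφ]
    ext v
    simp only [mem_preimage, Set.mem_ofPred_eq, Formula.realize_relabel]
    apply iff_of_eq
    congr 1
    funext z
    rcases z with z | z <;> simp [g]
  rw [e0]
  have h2 : (f i (pre (φ.relabel (Sum.map e1 e2))) = true) ↔
    (f j (pre (φ.relabel (Sum.map e1 e2))) = true) := Set.ext_iff.1 h _
  exact Bool.eq_iff_iff.2 h2

variable {M : Type w} [L.Structure M]

theorem sortEquiv_equiv (S : ImSort L M) : Equivalence (SortEquiv (L := L) S) :=
  ⟨fun _ r => (S.isEqRel r).1 _, fun h r => (S.isEqRel r).2.1 _ _ (h r),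
    fun h h' r => (S.isEqRel r).2.2 _ _ _ (h r) (h' r)⟩

theorem sortEquiv_def (S : ImSort L M) : (∅ : Set M).Definable L
    {v : SortVars S ⊕ SortVars S → M | SortEquiv (L := L) S (v ∘ Sum.inl) (v ∘ Sum.inr)} := by
  have := definable_forall (L := L) (A := (∅ : Set M)) (γ := SortVars S ⊕ SortVars S)
    (fun r : Fin S.k => (fun v => v ∘
    (Sum.map (fun t => ⟨r, t⟩) (fun t => ⟨r, t⟩) : Fin (S.N r) ⊕ Fin (S.N r) → SortVars S ⊕ SortVars S))
    ⁻¹' {v | (S.E r).Realize v}) (fun r => (empty_def_of _).preimage_comp _)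
  convert this using 1
  ext v
  simp only [SortEquiv, Set.mem_ofPred_eq, mem_preimage]
  refine forall_congr' fun r => iff_of_eq ?_
  congr 1
  funext z
  rcases z with z | z <;> rfl

theorem imType_iff (S S' : ImSort L M) {c c' : SortVars S → M} {d d' : SortVars S' → M} :
    imTypeOf (L := L) S S' c d = imTypeOf S S' c' d' ↔
    ∀ s : Set (SortVars S ⊕ SortVars S' → M), (∅ : Set M).Definable L s →
      Inv2 (SortEquiv (L := L) S) (SortEquiv (L := L) S') s →
        (Sum.elim c d ∈ s ↔ Sum.elim c' d' ∈ s) := by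
  constructor
  · intro h s hs hi
    obtain ⟨φ, rfl⟩ := empty_definable_iff.1 hs
    have := Set.ext_iff.1 h φ
    constructor
    · intro h1
      exact (this.1 ⟨hi, h1⟩).2
    · intro h1
      exact (this.2 ⟨hi, h1⟩).2
  · intro h
    ext φ
    exact and_congr_right fun hi => h _ (empty_def_of φ) hi

theorem fInd_of (S : ImSort L M) {a : ℕ → SortVars S → M} (h : ImSortIndiscernible (L := L) S a) :
    FInd L (SortEquiv (L := L) S) a := by
  intro n s hs hi J J' hJ hJ'
  obtain ⟨φ, rfl⟩ := empty_definable_iff.1 hs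
  exact h n J J' hJ hJ' φ hi

theorem dir1 {T : L.Theory} (M : Theory.ModelType.{u, v, max u v} T) (hTT : TT L M)
    (hM : WSat L M) (hac : IsIndAcyclic T) (S S' : ImSort L M)
    (p q : Set (L.Formula (SortVars S ⊕ SortVars S')))
    (hp : ∃ c d, imTypeOf (L := L) S S' c d = p) (hq : ∃ c d, imTypeOf (L := L) S S' c d = q)
    (hpq : PfTeq (L := L) S S' p q) (hqp : PfTeq (L := L) S S' q p) : p = q := by
  by_contra hne
  have hne' : Nonempty M := inferInstance
  obtain ⟨cp, dp, hp⟩ := hp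
  obtain ⟨cq, dq, hq⟩ := hq
  have hlift : ∀ {p q : Set (L.Formula (SortVars S ⊕ SortVars S'))} {C : SortVars S → M}
      {D : SortVars S' → M}, PfTeq (L := L) S S' p q → imTypeOf (L := L) S S' C D = q →
      ∃ (A : ℕ → SortVars S → M) (B : SortVars S' → M), IsIndiscernible (L := L) A ∧
      EqT L (Sum.elim (A 0) B) (Sum.elim C D) ∧
      (∀ j, EqT L (Sum.elim (A (j+1)) B) (Sum.elim (A 1) B)) ∧
      imTypeOf (L := L) S S' (A 1) B = p := by
    rintro p q C D ⟨d, a, ha, h1, h0⟩ hC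
    obtain ⟨A, B, k1, k2, k3, k4⟩ := lift hM (sortEquiv_equiv S) (sortEquiv_def S)
      (sortEquiv_equiv S') (sortEquiv_def S')
      a (fInd_of S ha) C (a 1) d D d
      (fun s hs hi h => ((imType_iff S S').1 (h0.trans hC.symm) s hs hi).2 h)
      (fun s hs hi h j => ((imType_iff S S').1 ((h1 (j+1) (Nat.succ_pos j)).trans (h1 1 one_pos).symm)
        s hs hi).2 h)
    refine ⟨A, B, k1, k2, k3, ?_⟩
    rw [← h1 1 one_pos, imType_iff]
    intro s hs hi
    refine ⟨fun h => ?_, k4 s hs hi⟩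
    by_contra h'
    exact k4 sᶜ hs.compl (fun c c' d d' x y => not_congr (hi c c' d d' x y)) h' h
  -- the type space
  let X := Inst L (∅ : Set M) (SortVars S ⊕ SortVars S') → Bool
  let lab : (SortVars S → M) → (SortVars S' → M) → Set X := fun c d =>
    {τ | ∀ (s : Inst L (∅ : Set M) (SortVars S ⊕ SortVars S')),
      Inv2 (SortEquiv (L := L) S) (SortEquiv (L := L) S') s.1 → τ s = mb s.1 (pure (Sum.elim c d))}
  have hlabc : ∀ c d, IsClosed (lab c d) := by
    intro c d
    have : lab c d = ⋂ (s : Inst L (∅ : Set M) (SortVars S ⊕ SortVars S'))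
      (_ : Inv2 (SortEquiv (L := L) S) (SortEquiv (L := L) S') s.1),
        {τ | τ s = mb s.1 (pure (Sum.elim c d))} := by
      ext τ; simp [lab]
    rw [this]
    exact isClosed_iInter fun s => isClosed_iInter fun _ => isClosed_eq (continuous_apply s) continuous_const
  let tp : (SortVars S → M) → (SortVars S' → M) → X := fun c d =>
    ty L (∅ : Set M) id (pure (Sum.elim c d))
  have hlab : ∀ c d c' d', imTypeOf (L := L) S S' c d = imTypeOf S S' c' d' → tp c d ∈ lab c' d' := by
    intro c d c' d' h s hi
    exact mb_eq.2 ((imType_iff S S').1 h s.1 s.2 hi)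
  have hdisj : ∀ τ, τ ∈ lab cp dp → τ ∈ lab cq dq → False := by
    intro τ h1 h2
    apply hne
    rw [← hp, ← hq, imType_iff]
    intro s hs hi
    have := (h1 ⟨s, hs⟩ hi).symm.trans (h2 ⟨s, hs⟩ hi)
    exact mb_eq.1 this
  let R : X → X → Prop := fun τ σ => RA L (∅ : Set M) σ τ ∧
    ((τ ∈ lab cp dp ∧ σ ∈ lab cq dq) ∨ (τ ∈ lab cq dq ∧ σ ∈ lab cp dp))
  have hRc : IsClosed {x : X × X | R x.1 x.2} := by
    have h1 : IsClosed {x : X × X | RA L (∅ : Set M) x.2 x.1} :=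
      isClosed_RA.preimage continuous_swap
    have h2 : ∀ c d c' d', IsClosed {x : X × X | x.1 ∈ lab c d ∧ x.2 ∈ lab c' d'} := fun c d c' d' =>
      ((hlabc c d).preimage continuous_fst).inter ((hlabc c' d').preimage continuous_snd)
    exact h1.inter ((h2 _ _ _ _).union (h2 _ _ _ _))
  -- the walk
  obtain ⟨w, hw⟩ : ∃ w : ℕ → (SortVars S → M) × (SortVars S' → M),
      ∀ n, R (tp (w n).1 (w n).2) (tp (w (n+1)).1 (w (n+1)).2) := by
    have hstep : ∀ x : {x : (SortVars S → M) × (SortVars S' → M) //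
        imTypeOf (L := L) S S' x.1 x.2 = p ∨ imTypeOf (L := L) S S' x.1 x.2 = q},
        ∃ y : {x : (SortVars S → M) × (SortVars S' → M) //
        imTypeOf (L := L) S S' x.1 x.2 = p ∨ imTypeOf (L := L) S S' x.1 x.2 = q},
        R (tp x.1.1 x.1.2) (tp y.1.1 y.1.2) := by
      have hra : ∀ {C D} {A : ℕ → SortVars S → M} {B : SortVars S' → M}, IsIndiscernible (L := L) A →
          EqT L (Sum.elim (A 0) B) (Sum.elim C D) →
          (∀ j, EqT L (Sum.elim (A (j+1)) B) (Sum.elim (A 1) B)) →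
          RA L (∅ : Set M) (tp (A 1) B) (tp C D) := by
        intro C D A B h1 h2 h3
        refine ⟨pure (A, B), ?_, ?_, ?_⟩
        · intro r J J' hJ hJ' s hs
          obtain ⟨φ, rfl⟩ := empty_definable_iff.1 hs
          exact h1 r J J' hJ hJ' φ
        · intro j
          exact ty_eq.2 fun s hs => (h3 j).mem_iff hs
        · exact ty_eq.2 fun s hs => h2.mem_iff hs
      rintro ⟨⟨C, D⟩, hx | hx⟩
      · obtain ⟨A, B, h1, h2, h3, h4⟩ := hlift hqp hx
        exact ⟨⟨(A 1, B), Or.inr h4⟩, hra h1 h2 h3, Or.inl ⟨hlab _ _ _ _ (hx.trans hp.symm),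
          hlab _ _ _ _ (h4.trans hq.symm)⟩⟩
      · obtain ⟨A, B, h1, h2, h3, h4⟩ := hlift hpq hx
        exact ⟨⟨(A 1, B), Or.inl h4⟩, hra h1 h2 h3, Or.inr ⟨hlab _ _ _ _ (hx.trans hq.symm),
          hlab _ _ _ _ (h4.trans hp.symm)⟩⟩
    choose nx hnx using hstep
    refine ⟨fun n => (nx^[n] ⟨(cp, dp), Or.inl hp⟩).1, fun n => ?_⟩
    simp only [Function.iterate_succ_apply']
    exact hnx _
  obtain ⟨x, hx⟩ := cyc R hRc (TS L (∅ : Set M) _) isClosed_TS (fun C hC _ hne => scat hTT C hC hne)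
    (fun n => tp (w n).1 (w n).2) (fun n => ty_mem_TS _ _) hw
  obtain ⟨N, hN, f, hper, hstep, hinj⟩ := simple_cycle (r := Function.swap R)
    (by
      intro x hx
      rcases hx.2 with h | h
      · exact hdisj _ h.1 h.2
      · exact hdisj _ h.2 h.1) (Relation.transGen_swap.2 hx)
  obtain ⟨i, j, hi, hj, hij, h⟩ := acyc_RA hac M hM N hN f hper (fun i => (hstep i).1)
  exact hij (hinj i j hi hj h)

end Dir1


section Good
open Filter
variable {M : Type w} [L.Structure M]

theorem definable_exists {A : Set M} {ι γ : Type*} [Finite ι] (s : ι → Set (γ → M))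
    (hs : ∀ i, A.Definable L (s i)) : A.Definable L {v | ∃ i, v ∈ s i} := by
  have := (definable_forall (fun i => (s i)ᶜ) (fun i => (hs i).compl)).compl
  convert this using 1
  ext v; simp

/-- invariant filters -/
def FilInv (L : FirstOrder.Language.{u, v}) {M : Type w} [L.Structure M] {Δ : Type}
    (F : Filter (Δ → M)) : Prop :=
  ∀ (δ : Type) [Finite δ] (c c' : δ → M) (s : Set (Δ ⊕ δ → M)), (∅ : Set M).Definable L s →
    EqT L c c' → (∀ᶠ x in F, Sum.elim x c ∈ s) → ∀ᶠ x in F, Sum.elim x c' ∈ s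

theorem exists_min_inv (hM : WSat L M) {Δ : Type} [Finite Δ] (m : Δ → M) :
    ∃ F : Filter (Δ → M), F.NeBot ∧ FilInv L F ∧ (∀ᶠ x in F, EqT L x m) ∧
      ∀ F' : Filter (Δ → M), F'.NeBot → FilInv L F' → F' ≤ F → F' = F := by
  let 𝒮 : Set (Filter (Δ → M)) := {F | F.NeBot ∧ FilInv L F ∧ ∀ᶠ x in F, EqT L x m}
  have h0 : 𝓟 {x : Δ → M | EqT L x m} ∈ 𝒮 := by
    refine ⟨principal_neBot_iff.2 ⟨m, fun φ => Iff.rfl⟩, ?_, mem_principal_self _⟩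
    intro δ _ c c' s hs hc h
    rw [eventually_principal] at h ⊢
    intro x hx
    obtain ⟨x', hx'⟩ := transfer hM hc.symm x
    rw [hx'.mem_iff hs]
    refine h x' ?_
    have := (hx'.comp (Sum.inl : Δ → Δ ⊕ δ)).symm
    simp only [Sum.elim_comp_inl] at this
    exact this.trans hx
  obtain ⟨F, hF⟩ := zorn_le₀ (α := (Filter (Δ → M))ᵒᵈ) 𝒮 (by
    intro (C : Set (Filter (Δ → M))) hC hch
    rcases C.eq_empty_or_nonempty with rfl | hne
    · exact ⟨_, h0, fun z hz => hz.elim⟩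
    have hdir : DirectedOn (fun x1 x2 : Filter (Δ → M) => x1 ≥ x2) C := by
      intro a ha b hb
      rcases hch.total ha hb with h | h
      · exact ⟨b, hb, h, le_refl b⟩
      · exact ⟨a, ha, le_refl a, h⟩
    have hmem : ∀ s : Set (Δ → M), s ∈ (sInf C : Filter (Δ → M)) ↔
        ∃ f : Filter (Δ → M), f ∈ C ∧ s ∈ f := fun s => by
      rw [sInf_eq_iInf, mem_biInf_of_directed (f := fun f : Filter (Δ → M) => f) hdir hne]
    refine ⟨(sInf C : Filter (Δ → M)), ⟨?_, ?_, ?_⟩, fun z hz => ?_⟩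
    · have hM' : Nonempty (Δ → M) := ⟨m⟩
      exact Filter.sInf_neBot_of_directed hdir (fun hb => (hC hb).1.ne rfl)
    · intro δ _ c c' s hs hc h
      obtain ⟨f, hf, h⟩ := (hmem _).1 h
      exact (hmem _).2 ⟨f, hf, (hC hf).2.1 δ c c' s hs hc h⟩
    · obtain ⟨f, hf⟩ := hne
      exact (hmem _).2 ⟨f, hf, (hC hf).2.2⟩
    · exact sInf_le (α := Filter (Δ → M)) hz)
  refine ⟨F, hF.1.1, hF.1.2.1, hF.1.2.2, fun F' h1 h2 h3 => le_antisymm h3 ?_⟩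
  exact hF.2 (y := F') ⟨h1, h2, h3 hF.1.2.2⟩ h3

theorem exists_cover (hM : WSat L M) (hTT : TT L M) {Δ : Type} [Finite Δ] (F : Filter (Δ → M))
    (hne : F.NeBot) (hinv : FilInv L F)
    (hmin : ∀ F' : Filter (Δ → M), F'.NeBot → FilInv L F' → F' ≤ F → F' = F) :
    ∃ (k : ℕ) (X : Fin k → Set (Δ → M)), (∀ᶠ x in F, ∃ i, x ∈ X i) ∧
      ∀ (δ : Type) [Finite δ] (d : δ → M) (s : Set (Δ ⊕ δ → M)), (∅ : Set M).Definable L s → ∀ i,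
        (∀ᶠ x in F, x ∈ X i → Sum.elim x d ∈ s) ∨ (∀ᶠ x in F, x ∈ X i → Sum.elim x d ∉ s) := by
  -- a small definable set
  obtain ⟨X, hXd, hXF, hXs⟩ : ∃ X : Set (Δ → M), (univ : Set M).Definable L X ∧ (∃ᶠ x in F, x ∈ X) ∧
      ∀ s : Set (Δ → M), (univ : Set M).Definable L s → (∀ᶠ x in F, x ∈ X → x ∈ s) ∨
        (∀ᶠ x in F, x ∈ X → x ∉ s) := by
    by_contra hcon
    push Not at hcon
    refine tree hTT {X : Set (Δ → M) | (univ : Set M).Definable L X ∧ ∃ᶠ x in F, x ∈ X}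
      ⟨univ, definable_univ, by simpa using hne⟩ ?_ ?_
    · rintro X ⟨h1, h2⟩
      exact ⟨h2.exists, h1⟩
    · rintro X ⟨h1, h2⟩
      obtain ⟨s, hs, h3, h4⟩ := hcon X h1 h2
      refine ⟨X \ s, ⟨h1.sdiff hs, ?_⟩, X ∩ s, ⟨h1.inter hs, ?_⟩, sdiff_subset, inter_subset_left, ?_⟩
      · exact h3
      · exact h4
      · exact disjoint_sdiff_left.mono_right inter_subset_right
  obtain ⟨r, c, ψ, rfl⟩ := univ_def_iff.1 hXd
  let F' : Filter (Δ → M) :=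
    { sets := {U | ∃ (k : ℕ) (C : Fin k → Fin r → M), (∀ i, EqT L (C i) c) ∧
        ∀ᶠ x in F, x ∈ U ∨ ∃ i, ψ.Realize (Sum.elim x (C i))}
      univ_sets := ⟨0, Fin.elim0, fun i => i.elim0, by simp⟩
      sets_of_superset := by
        rintro U V ⟨k, C, hC, h⟩ hUV
        exact ⟨k, C, hC, h.mono fun x hx => hx.imp_left (@hUV x)⟩
      inter_sets := by
        rintro U V ⟨k, C, hC, h⟩ ⟨k', C', hC', h'⟩
        refine ⟨k + k', Fin.append C C', ?_, ?_⟩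
        · intro i
          induction i using Fin.addCases with
          | left i => rw [Fin.append_left]; exact hC i
          | right i => rw [Fin.append_right]; exact hC' i
        · filter_upwards [h, h'] with x hx hx'
          rcases hx with hx | ⟨i, hx⟩
          · rcases hx' with hx' | ⟨i, hx'⟩
            · exact Or.inl ⟨hx, hx'⟩
            · exact Or.inr ⟨Fin.natAdd k i, by rwa [Fin.append_right]⟩
          · exact Or.inr ⟨Fin.castAdd k' i, by rwa [Fin.append_left]⟩ }
  have hle : F' ≤ F := fun U hU => ⟨0, Fin.elim0, fun i => i.elim0, by
    filter_upwards [hU] with x hx using Or.inl hx⟩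
  have hinv' : FilInv L F' := by
    rintro δ _ d d' s hs hd ⟨k, C, hC, h⟩
    obtain ⟨y, hy⟩ := transfer hM hd (fun p : Fin k × Fin r => C p.1 p.2)
    refine ⟨k, fun i t => y (i, t), ?_, ?_⟩
    · intro i
      exact (hy.comp (fun t : Fin r => Sum.inl (i, t))).symm.trans (hC i)
    · let g1 : Δ ⊕ δ → Δ ⊕ ((Fin k × Fin r) ⊕ δ) := Sum.map id Sum.inr
      let g2 : Fin k → Δ ⊕ Fin r → Δ ⊕ ((Fin k × Fin r) ⊕ δ) := fun i =>
        Sum.map id (fun t => Sum.inl (i, t))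
      have := hinv _ _ _ ((fun v => v ∘ g1) ⁻¹' s ∪
        {v | ∃ i, v ∈ (fun v => v ∘ g2 i) ⁻¹' {v | ψ.Realize v}})
        ((hs.preimage_comp g1).union (definable_exists _ fun i => (empty_def_of ψ).preimage_comp (g2 i)))
        hy (by
          filter_upwards [h] with x hx
          rcases hx with hx | ⟨i, hx⟩
          · left
            rw [mem_preimage, Sum.elim_comp_map]
            exact hx
          · right
            refine ⟨i, ?_⟩
            rw [mem_preimage, Sum.elim_comp_map]
            exact hx)
      filter_upwards [this] with x hx
      rcases hx with hx | ⟨i, hx⟩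
      · left
        rw [mem_preimage, Sum.elim_comp_map] at hx
        exact hx
      · right
        refine ⟨i, ?_⟩
        rw [mem_preimage, Sum.elim_comp_map] at hx
        exact hx
  have hbot : ∅ ∈ F' := by
    rw [empty_mem_iff_bot]
    by_contra hb
    have := hmin F' ⟨hb⟩ hinv' hle
    have h1 : {x : Δ → M | ψ.Realize (Sum.elim x c)}ᶜ ∈ F' :=
      ⟨1, fun _ => c, fun _ _ => Iff.rfl, Eventually.of_forall fun x => by
        by_cases h : ψ.Realize (Sum.elim x c)
        · exact Or.inr ⟨0, h⟩
        · exact Or.inl h⟩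
    rw [this] at h1
    exact hXF h1
  obtain ⟨k, C, hC, h⟩ := hbot
  refine ⟨k, fun i => {x | ψ.Realize (Sum.elim x (C i))}, by simpa using h, ?_⟩
  intro δ _ d s hs i
  obtain ⟨d0, hd0⟩ := transfer hM (hC i) d
  let g1 : Δ ⊕ δ → Δ ⊕ (δ ⊕ Fin r) := Sum.map id Sum.inl
  let g2 : Δ ⊕ Fin r → Δ ⊕ (δ ⊕ Fin r) := Sum.map id Sum.inr
  have key : ∀ s : Set (Δ ⊕ δ → M), (∅ : Set M).Definable L s →
      (∀ᶠ x in F, ψ.Realize (Sum.elim x c) → Sum.elim x d0 ∈ s) →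
      ∀ᶠ x in F, ψ.Realize (Sum.elim x (C i)) → Sum.elim x d ∈ s := by
    intro s hs h
    have := hinv _ _ _ (((fun v => v ∘ g2) ⁻¹' {v | ψ.Realize v})ᶜ ∪ (fun v => v ∘ g1) ⁻¹' s)
      ((((empty_def_of ψ).preimage_comp g2).compl).union (hs.preimage_comp g1)) hd0.symm (by
        filter_upwards [h] with x hx
        by_cases h1 : ψ.Realize (Sum.elim x c)
        · right
          rw [mem_preimage, Sum.elim_comp_map]
          exact hx h1
        · left
          rw [mem_compl_iff, mem_preimage, Sum.elim_comp_map]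
          exact h1)
    filter_upwards [this] with x hx h1
    rcases hx with hx | hx
    · rw [mem_compl_iff, mem_preimage, Sum.elim_comp_map] at hx
      exact absurd h1 hx
    · rw [mem_preimage, Sum.elim_comp_map] at hx
      exact hx
  obtain ⟨φ, hφ⟩ := empty_definable_iff.1 hs
  have hsd : (univ : Set M).Definable L {x : Δ → M | Sum.elim x d0 ∈ s} := by
    rw [hφ]; exact univ_def_of d0 φ
  rcases hXs _ hsd with h1 | h1
  · exact Or.inl (key s hs h1)
  · exact Or.inr (key sᶜ hs.compl h1)

theorem good (hM : WSat L M) (hTT : TT L M) {Δ : Type} [Finite Δ] (m : Δ → M) :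
    ∃ F : Filter (Δ → M), F.NeBot ∧ (∀ᶠ x in F, EqT L x m) ∧
      ∀ (α : Type) [Finite α] (y : ℕ → α → M), IsIndiscernible (L := L) y → ∀ (r : ℕ)
        (s : Set (Δ ⊕ (Fin r × α) → M)), (∅ : Set M).Definable L s →
        ∀ J J' : Fin r → ℕ, StrictMono J → StrictMono J' →
        ∀ᶠ x in F, (Sum.elim x (fun p => y (J p.1) p.2) ∈ s ↔
          Sum.elim x (fun p => y (J' p.1) p.2) ∈ s) := by
  obtain ⟨F, h1, h2, h3, h4⟩ := exists_min_inv hM m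
  refine ⟨F, h1, h3, ?_⟩
  obtain ⟨k, X, hX, hdec⟩ := exists_cover hM hTT F h1 h2 h4
  intro α _ y hy r s hs
  -- pigeonhole
  have hpig : ∃ a b : ℕ, a < b ∧ ∀ᶠ x in F, (Sum.elim x (fun p : Fin r × α => y (a * r + p.1) p.2) ∈ s ↔
          Sum.elim x (fun p : Fin r × α => y (b * r + p.1) p.2) ∈ s) := by
    let v : ℕ → Fin k → Prop := fun a i =>
      ∀ᶠ x in F, x ∈ X i → Sum.elim x (fun p : Fin r × α => y (a * r + p.1) p.2) ∈ s
    obtain ⟨a, b, hab, he⟩ : ∃ a b : ℕ, a < b ∧ v a = v b := by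
      obtain ⟨a, b, hne, he⟩ := Finite.exists_ne_map_eq_of_infinite v
      rcases Nat.lt_or_gt_of_ne hne with h | h
      · exact ⟨a, b, h, he⟩
      · exact ⟨b, a, h, he.symm⟩
    refine ⟨a, b, hab, ?_⟩
    have hall : ∀ i, ∀ᶠ x in F, x ∈ X i →
        (Sum.elim x (fun p : Fin r × α => y (a * r + p.1) p.2) ∈ s ↔
          Sum.elim x (fun p : Fin r × α => y (b * r + p.1) p.2) ∈ s) := by
      intro i
      by_cases hv : v a i
      · have hv' : v b i := by rw [← he]; exact hv
        filter_upwards [hv, hv'] with x h h' hx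
        exact iff_of_true (h hx) (h' hx)
      · have hv' : ¬ v b i := by rw [← he]; exact hv
        have e1 := (hdec _ (fun p : Fin r × α => y (a * r + p.1) p.2) s hs i).resolve_left hv
        have e2 := (hdec _ (fun p : Fin r × α => y (b * r + p.1) p.2) s hs i).resolve_left hv'
        filter_upwards [e1, e2] with x h h' hx
        exact iff_of_false (h hx) (h' hx)
    filter_upwards [hX, eventually_all.2 hall] with x ⟨i, hi⟩ h
    exact h i hi
  obtain ⟨a, b, hab, hev⟩ := hpig
  -- separated blocks
  have hsep : ∀ J J' : Fin r → ℕ, StrictMono J → StrictMono J' → (∀ t t', J t < J' t') →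
      ∀ᶠ x in F, (Sum.elim x (fun p => y (J p.1) p.2) ∈ s ↔
          Sum.elim x (fun p => y (J' p.1) p.2) ∈ s) := by
    intro J J' hJ hJ' hlt
    have hmono : ∀ J J' : Fin r → ℕ, StrictMono J → StrictMono J' → (∀ t t', J t < J' t') →
        StrictMono (Fin.append J J') := by
      intro J J' hJ hJ' hlt x z hxz
      induction x using Fin.addCases with
      | left x =>
        induction z using Fin.addCases with
        | left z => rw [Fin.append_left, Fin.append_left]; exact hJ hxz
        | right z => rw [Fin.append_left, Fin.append_right]; exact hlt _ _
      | right x =>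
        induction z using Fin.addCases with
        | left z =>
          have h := hxz
          rw [Fin.lt_def] at h
          simp at h
          have := z.2
          omega
        | right z =>
          rw [Fin.append_right, Fin.append_right]
          refine hJ' ?_
          simpa using hxz
    have hm1 := hmono (fun t => a * r + t) (fun t => b * r + t)
      (fun _ _ h => Nat.add_lt_add_left h _) (fun _ _ h => Nat.add_lt_add_left h _) (by
        intro t t'
        have h1 := t.2
        have h2 : (a + 1) * r ≤ b * r := Nat.mul_le_mul_right r hab
        have h3 : (a + 1) * r = a * r + r := by ring
        change a * r + t.1 < b * r + t'.1
        omega)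
    have hm2 := hmono J J' hJ hJ' hlt
    have heq : EqT L (fun p : Fin (r + r) × α =>
        y (Fin.append (fun t : Fin r => a * r + t) (fun t : Fin r => b * r + t) p.1) p.2)
        (fun p : Fin (r + r) × α => y (Fin.append J J' p.1) p.2) := fun φ => hy _ _ _ hm1 hm2 φ
    let g1 : Δ ⊕ (Fin r × α) → Δ ⊕ (Fin (r + r) × α) := Sum.map id (fun p => (Fin.castAdd r p.1, p.2))
    let g2 : Δ ⊕ (Fin r × α) → Δ ⊕ (Fin (r + r) × α) := Sum.map id (fun p => (Fin.natAdd r p.1, p.2))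
    have hs1 := hs.preimage_comp g1
    have hs2 := hs.preimage_comp g2
    have E1 : ∀ (x : Δ → M) (J J' : Fin r → ℕ),
      Sum.elim x (fun p : Fin (r + r) × α => y (Fin.append J J' p.1) p.2) ∘ g1 =
        Sum.elim x (fun p => y (J p.1) p.2) := by
      intro x J J'
      rw [Sum.elim_comp_map]
      congr 1
      funext p
      simp only [Function.comp, Fin.append_left]
    have E2 : ∀ (x : Δ → M) (J J' : Fin r → ℕ),
      Sum.elim x (fun p : Fin (r + r) × α => y (Fin.append J J' p.1) p.2) ∘ g2 =
        Sum.elim x (fun p => y (J' p.1) p.2) := by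
      intro x J J'
      rw [Sum.elim_comp_map]
      congr 1
      funext p
      simp only [Function.comp, Fin.append_right]
    have := h2 _ _ _ (((fun v => v ∘ g1) ⁻¹' s ∩ (fun v => v ∘ g2) ⁻¹' s) ∪
      (((fun v => v ∘ g1) ⁻¹' s)ᶜ ∩ ((fun v => v ∘ g2) ⁻¹' s)ᶜ))
      ((hs1.inter hs2).union (hs1.compl.inter hs2.compl)) heq (by
        filter_upwards [hev] with x hx
        rw [iff_iff_and_or_not_and_not] at hx
        simpa only [mem_union, mem_inter_iff, mem_compl_iff, mem_preimage, E1, E2] using hx)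
    filter_upwards [this] with x hx
    rw [iff_iff_and_or_not_and_not]
    simpa only [mem_union, mem_inter_iff, mem_compl_iff, mem_preimage, E1, E2] using hx
  intro J J' hJ hJ'
  obtain ⟨N, hN⟩ := (Set.finite_range J).bddAbove
  obtain ⟨N', hN'⟩ := (Set.finite_range J').bddAbove
  have hm : StrictMono (fun t : Fin r => N + N' + 1 + t.1) := fun _ _ h => Nat.add_lt_add_left h _
  have k1 := hsep J _ hJ hm (fun t t' => by
    have : J t ≤ N := hN ⟨t, rfl⟩
    change J t < N + N' + 1 + t'.1
    omega)
  have k2 := hsep J' _ hJ' hm (fun t t' => by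
    have : J' t ≤ N' := hN' ⟨t, rfl⟩
    change J' t < N + N' + 1 + t'.1
    omega)
  filter_upwards [k1, k2] with x e1 e2
  exact e1.trans e2.symm

end Good


section Chain
open Filter
variable {M : Type w} [L.Structure M]

/-- For a finite tuple `m`, a coheir-like ultrafilter of copies of `w`. -/
theorem ultra_good_fin (hM : WSat L M) (hTT : TT L M) {ι : Type} [Countable ι] (w : ι → M)
    {n : ℕ} (m : Fin n → M) : ∃ W : Ultrafilter (ι → M), (∀ᶠ x : ι → M in W, EqT L x w) ∧
      ∀ (α : Type) [Finite α] (g : ℕ → α → ι), IsIndiscernible (L := L) (fun j z => w (g j z)) →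
        ∀ (r : ℕ) (φ : L.Formula ((Fin r × α) ⊕ Fin n)) (J J' : Fin r → ℕ), StrictMono J →
          StrictMono J' → ∀ᶠ x : ι → M in W,
            (φ.Realize (Sum.elim (fun p : Fin r × α => x (g (J p.1) p.2)) m) ↔
              φ.Realize (Sum.elim (fun p : Fin r × α => x (g (J' p.1) p.2)) m)) := by
  obtain ⟨F, hne, hF1, hF2⟩ := good hM hTT m
  have hw : ∀ x : Fin n → M, ∃ w' : ι → M, EqT L x m → EqT L (Sum.elim w x) (Sum.elim w' m) := by
    intro x
    by_cases hx : EqT L x m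
    · obtain ⟨w', h⟩ := transfer hM hx w
      exact ⟨w', fun _ => h⟩
    · exact ⟨w, fun h => absurd h hx⟩
  choose w' hw' using hw
  refine ⟨(Ultrafilter.of F).map w', ?_, ?_⟩
  · rw [map_iff]
    filter_upwards [Ultrafilter.of_le F hF1] with x hx
    exact ((hw' x hx).comp Sum.inl).symm
  · intro α _ g hg r φ J J' hJ hJ'
    rw [map_iff]
    have h2 := hF2 α (fun j z => w (g j z)) hg r {v | φ.Realize (v ∘ Sum.swap)}
      (by simpa only [Formula.realize_relabel] using empty_def_of (M := M) (φ.relabel Sum.swap)) J J' hJ hJ'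
    filter_upwards [Ultrafilter.of_le F hF1, Ultrafilter.of_le F h2] with x hx h3
    have key : ∀ J : Fin r → ℕ,
        (Sum.elim x (fun p : Fin r × α => w (g (J p.1) p.2)) ∈ {v | φ.Realize (v ∘ Sum.swap)} ↔
          φ.Realize (Sum.elim (fun p : Fin r × α => w' x (g (J p.1) p.2)) m)) := by
      intro J
      have h4 := (hw' x hx).comp (Sum.map (fun p : Fin r × α => g (J p.1) p.2) id) φ
      rw [Sum.elim_comp_map, Sum.elim_comp_map] at h4
      refine Iff.trans (iff_of_eq ?_) h4
      change φ.Realize _ = φ.Realize _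
      congr 1
      funext z; rcases z with z | z <;> rfl
    rw [← key, ← key]
    exact h3

theorem ultra_good [Nonempty M] (hM : WSat L M) (hTT : TT L M) {ι : Type} [Countable ι] (w : ι → M) :
    ∃ W : Ultrafilter (ι → M), (∀ᶠ x : ι → M in W, EqT L x w) ∧
      ∀ (α : Type) [Finite α] (g : ℕ → α → ι), IsIndiscernible (L := L) (fun j z => w (g j z)) →
        ∀ (r : ℕ) (s : Set (Fin r × α → M)), (univ : Set M).Definable L s →
          ∀ (J J' : Fin r → ℕ), StrictMono J → StrictMono J' →
            ((∀ᶠ x : ι → M in W, (fun p : Fin r × α => x (g (J p.1) p.2)) ∈ s) ↔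
              ∀ᶠ x : ι → M in W, (fun p : Fin r × α => x (g (J' p.1) p.2)) ∈ s) := by
  choose W hW1 hW2 using fun m : (Σ n : ℕ, Fin n → M) => ultra_good_fin hM hTT w m.2
  have : Nonempty (Σ n : ℕ, Fin n → M) := ⟨⟨0, Fin.elim0⟩⟩
  obtain ⟨V, hV⟩ := fip_ultra (Ω := Σ n : ℕ, Fin n → M)
    (range fun c : (Σ n : ℕ, Fin n → M) => {m | range c.2 ⊆ range m.2})
    (by rintro _ ⟨c, rfl⟩; exact ⟨c, fun _ h => h⟩)
    (by
      rintro _ ⟨c, rfl⟩ _ ⟨d, rfl⟩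
      refine ⟨_, ⟨⟨c.1 + d.1, Fin.append c.2 d.2⟩, rfl⟩, fun m hm => ⟨?_, ?_⟩⟩
      · refine fun z hz => hm (?_ : z ∈ range (Fin.append c.2 d.2))
        obtain ⟨i, rfl⟩ := hz
        exact ⟨Fin.castAdd _ i, by simp⟩
      · refine fun z hz => hm (?_ : z ∈ range (Fin.append c.2 d.2))
        obtain ⟨i, rfl⟩ := hz
        exact ⟨Fin.natAdd _ i, by simp⟩)
  refine ⟨V.bind W, ?_, ?_⟩
  · rw [bind_iff]
    exact Eventually.of_forall hW1
  · intro α _ g hg r s hs J J' hJ hJ'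
    obtain ⟨n, c, φ, rfl⟩ := univ_def_iff.1 hs
    rw [bind_iff, bind_iff]
    apply eventually_congr
    have h0 : ∀ᶠ m in (V : Filter (Σ n : ℕ, Fin n → M)), range c ⊆ range m.2 := hV _ ⟨⟨n, c⟩, rfl⟩
    filter_upwards [h0] with m hm
    apply eventually_congr
    have h1 : ∀ i, ∃ j, m.2 j = c i := fun i => hm ⟨i, rfl⟩
    choose h hh using h1
    filter_upwards [hW2 m α g hg r (φ.relabel (Sum.map id h)) J J' hJ hJ'] with x hx
    simp only [Formula.realize_relabel, Sum.elim_comp_map] at hx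
    have e : m.2 ∘ h = c := funext hh
    rw [e] at hx
    exact hx

end Chain


section Chain2
open Filter

theorem eqT_empty {T : L.Theory} (hT : T.IsComplete) (N M : Theory.ModelType.{u, v, max u v} T) :
    EqT L (Empty.elim : Empty → N) (Empty.elim : Empty → M) := by
  intro φ
  have h : ∀ N : Theory.ModelType.{u, v, max u v} T, φ.Realize (Empty.elim : Empty → N) ↔
      T ⊨ᵇ (φ : L.Sentence) := by
    intro N
    rw [← hT.realize_sentence_iff φ N]
    apply iff_of_eq
    change Formula.Realize _ _ = Formula.Realize _ _
    congr 1
    funext z; exact z.elim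
  rw [h, h]

variable {M : Type w} [L.Structure M]

theorem indisc_iff {α : Type} {a : ℕ → α → M} : IsIndiscernible (L := L) a ↔
    ∀ (r : ℕ) (s : Set (Fin r × α → M)), (∅ : Set M).Definable L s → ∀ J J' : Fin r → ℕ,
      StrictMono J → StrictMono J' →
      ((fun p : Fin r × α => a (J p.1) p.2) ∈ s ↔ (fun p : Fin r × α => a (J' p.1) p.2) ∈ s) := by
  constructor
  · intro h r s hs J J' hJ hJ'
    obtain ⟨φ, rfl⟩ := empty_definable_iff.1 hs
    exact h r J J' hJ hJ' φ
  · intro h r J J' hJ hJ' φ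
    exact h r _ (empty_def_of φ) J J' hJ hJ'

theorem step_one {T : L.Theory} [Nonempty M] (hM : WSat L M) {k l : ℕ} {p q : Set (L.Formula (Fin k ⊕ Fin l))}
    (h : Pf T p q) (c : Fin k → M) (b : Fin l → M) (hc : typeOf (L := L) (Sum.elim c b) = q) :
    ∃ a : ℕ → Fin k → M, a 0 = c ∧ IsIndiscernible (L := L) a ∧
      (∀ j, typeOf (L := L) (Sum.elim (a (j+1)) b) = p) ∧
      IsIndiscernible (L := L) (fun j => Sum.elim (a (j+1)) (Sum.elim (a 0) b)) := by
  obtain ⟨N, b', a', h1, h2, h3⟩ := h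
  have h4 : EqT L (Sum.elim (a' 0) b') (Sum.elim c b) := typeOf_eq_iff.1 (h3.trans hc.symm)
  obtain ⟨x, hx⟩ := transfer hM h4 (fun p : ℕ × Fin k => a' (p.1 + 1) p.2)
  let g : ℕ × Fin k → (ℕ × Fin k) ⊕ (Fin k ⊕ Fin l) := fun p =>
    match p with
    | (0, z) => Sum.inr (Sum.inl z)
    | (j+1, z) => Sum.inl (j, z)
  let a : ℕ → Fin k → M := fun j z => Sum.elim x (Sum.elim c b) (g (j, z))
  have hg : ∀ p : ℕ × Fin k, Sum.elim (fun p : ℕ × Fin k => a' (p.1 + 1) p.2) (Sum.elim (a' 0) b') (g p) =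
      a' p.1 p.2 := by
    rintro ⟨j | j, z⟩ <;> rfl
  have ha : IsIndiscernible (L := L) a := by
    intro r J J' hJ hJ' φ
    have key : ∀ J : Fin r → ℕ, φ.Realize (fun p : Fin r × Fin k => a (J p.1) p.2) ↔
        φ.Realize (fun p : Fin r × Fin k => a' (J p.1) p.2) := by
      intro J
      have := (hx.comp (fun p : Fin r × Fin k => g (J p.1, p.2))) φ
      refine this.symm.trans (iff_of_eq ?_)
      congr 1
      funext p
      exact hg _
    rw [key, key]
    exact h1 r J J' hJ hJ' φ
  have hp : ∀ j, typeOf (L := L) (Sum.elim (a (j+1)) b) = p := by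
    intro j
    rw [← h2 (j+1) (Nat.succ_pos j), typeOf_eq_iff]
    have := hx.comp (Sum.elim (fun z => Sum.inl (j, z)) (fun y => Sum.inr (Sum.inr y)) : Fin k ⊕ Fin l → _)
    have e1 : Sum.elim x (Sum.elim c b) ∘ (Sum.elim (fun z => Sum.inl (j, z)) (fun y => Sum.inr (Sum.inr y)) : Fin k ⊕ Fin l → _)
        = Sum.elim (a (j+1)) b := by
      funext z; rcases z with z | z <;> rfl
    have e2 : Sum.elim (fun p : ℕ × Fin k => a' (p.1 + 1) p.2) (Sum.elim (a' 0) b') ∘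
        (Sum.elim (fun z => Sum.inl (j, z)) (fun y => Sum.inr (Sum.inr y)) : Fin k ⊕ Fin l → _)
        = Sum.elim (a' (j+1)) b' := by
      funext z; rcases z with z | z <;> rfl
    rw [e1, e2] at this
    exact this.symm
  obtain ⟨a2, h5, h6, h7, h8⟩ := tailext hM a b
  refine ⟨a2, h5, ?_, ?_, ?_⟩
  · intro r J J' hJ hJ' φ
    have key : ∀ J : Fin r → ℕ, StrictMono J → (φ.Realize (fun p : Fin r × Fin k => a2 (J p.1) p.2) ↔
        φ.Realize (fun p : Fin r × Fin k => a (J p.1) p.2)) := by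
      intro J hJ
      by_cases h : φ.Realize (fun p : Fin r × Fin k => a (J p.1) p.2)
      · exact iff_of_true (h8 r _ (empty_def_of φ) (fun J' hJ' => (ha r J J' hJ hJ' φ).1 h) J hJ) h
      · refine iff_of_false ?_ h
        have := h8 r _ (empty_def_of φ.not) (fun J' hJ' => by
          rw [Set.mem_ofPred_eq, Formula.realize_not, ← ha r J J' hJ hJ' φ]; exact h) J hJ
        rwa [Set.mem_ofPred_eq, Formula.realize_not] at this
    rw [key J hJ, key J' hJ']
    exact ha r J J' hJ hJ' φ
  · intro j
    ext φ
    by_cases h : φ ∈ p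
    · refine iff_of_true (h7 _ (empty_def_of φ) (fun j => ?_) j) h
      rw [← hp j] at h
      exact h
    · refine iff_of_false ?_ h
      have := h7 _ (empty_def_of φ.not) (fun j => by
          rw [Set.mem_ofPred_eq, Formula.realize_not]
          rw [← hp j] at h
          exact h) j
      rwa [Set.mem_ofPred_eq, Formula.realize_not] at this
  · rw [indisc_iff]
    intro r s hs J J' hJ hJ'
    let g2 : Fin r × (Fin k ⊕ (Fin k ⊕ Fin l)) → (Fin r × Fin k) ⊕ (Fin k ⊕ Fin l) := fun p =>
      Sum.elim (fun z => Sum.inl (p.1, z)) Sum.inr p.2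
    have e : ∀ J : Fin r → ℕ, (Sum.elim (fun p : Fin r × Fin k => a2 (J p.1 + 1) p.2) (Sum.elim (a 0) b)) ∘ g2 =
      fun p : Fin r × (Fin k ⊕ (Fin k ⊕ Fin l)) =>
        (Sum.elim (a2 (J p.1 + 1)) (Sum.elim (a2 0) b) : Fin k ⊕ (Fin k ⊕ Fin l) → M) p.2 := by
      intro J
      rw [h5]
      funext p
      rcases p with ⟨p, z | z | z⟩ <;> rfl
    have := h6 r _ (hs.preimage_comp g2) J J' hJ hJ'
    rw [mem_preimage, mem_preimage, e, e] at this
    exact this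

theorem chain_exists {T : L.Theory} [Nonempty M] (hM : WSat L M) {k l : ℕ}
    {q : ℕ → Set (L.Formula (Fin k ⊕ Fin l))} (h : ∀ i, Pf T (q (i+1)) (q i)) (c : Fin k → M)
    (b : Fin l → M) (hc : typeOf (L := L) (Sum.elim c b) = q 0) :
    ∃ a : ℕ → ℕ → Fin k → M, ∀ i, a (i+1) 0 = a i 1 ∧ IsIndiscernible (L := L) (a i) ∧
      typeOf (L := L) (Sum.elim (a i 0) b) = q i ∧
      IsIndiscernible (L := L) (fun j => Sum.elim (a i (j+1)) (Sum.elim (a i 0) b)) := by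
  choose! st h0 h1 h2 h3 using fun (i : ℕ) (c : Fin k → M) => step_one hM (h i) c b
  let cc : ℕ → Fin k → M := fun i => Nat.rec c (fun i c => st i c 1) i
  have hcc : ∀ i, typeOf (L := L) (Sum.elim (cc i) b) = q i := by
    intro i
    induction i with
    | zero => exact hc
    | succ i ih => exact h2 i (cc i) ih 0
  refine ⟨fun i => st i (cc i), fun i => ⟨?_, h1 i _ (hcc i), ?_, h3 i _ (hcc i)⟩⟩
  · change st (i+1) (cc (i+1)) 0 = _
    rw [h0 (i+1) _ (hcc (i+1))]
  · change typeOf (Sum.elim (st i (cc i) 0) b) = _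
    rw [h0 i _ (hcc i)]
    exact hcc i

/-- the set of formulas without parameters in a type -/
def res {A : Set M} {Γ : Type} (P : Inst L A Γ → Bool) : Set (L.Formula Γ) :=
  {φ | P ⟨{v | φ.Realize v}, (empty_def_of φ).mono (empty_subset A)⟩ = true}

theorem isClosed_res {A : Set M} {Γ : Type} (q : Set (L.Formula Γ)) :
    IsClosed {P : Inst L A Γ → Bool | res P = q} := by
  have e : {P : Inst L A Γ → Bool | res P = q} = ⋂ φ : L.Formula Γ,
      {P | P ⟨{v | φ.Realize v}, (empty_def_of φ).mono (empty_subset A)⟩ ∈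
        {t : Bool | t = true ↔ φ ∈ q}} := by
    ext P
    simp only [res, Set.ext_iff, mem_iInter, Set.mem_ofPred_eq]
  rw [e]
  exact isClosed_iInter fun φ => (isClosed_discrete _).preimage (continuous_apply _)

theorem chain_types {T : L.Theory} [Nonempty M] (hM : WSat L M) (hTT : TT L M) {k l : ℕ}
    {q : ℕ → Set (L.Formula (Fin k ⊕ Fin l))} (h : ∀ i, Pf T (q (i+1)) (q i)) (c : Fin k → M)
    (b : Fin l → M) (hc : typeOf (L := L) (Sum.elim c b) = q 0) :
    ∃ P : ℕ → Inst L (univ : Set M) (Fin k ⊕ Fin l) → Bool, ∀ i, P i ∈ TS L univ (Fin k ⊕ Fin l) ∧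
      RA L univ (P (i+1)) (P i) ∧ res (P i) = q i := by
  obtain ⟨a, ha⟩ := chain_exists hM h c b hc
  let w : Fin l ⊕ (ℕ × ℕ × Fin k) → M := Sum.elim b (fun p => a p.1 p.2.1 p.2.2)
  obtain ⟨W, hW1, hW2⟩ := ultra_good hM hTT w
  let cf : ℕ → (Fin l ⊕ (ℕ × ℕ × Fin k) → M) → Conf M (Fin k) (Fin l) := fun i x =>
    (fun j z => x (Sum.inr (i, j, z)), fun y => x (Sum.inl y))
  let U : ℕ → Ultrafilter (Conf M (Fin k) (Fin l)) := fun i => W.map (cf i)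
  have hstep : ∀ i, ty L (univ : Set M) (pr 0) (U (i+1)) = ty L (univ : Set M) (pr 1) (U i) := by
    intro i
    rw [ty_eq]
    intro s hs
    rw [map_iff, map_iff]
    apply eventually_congr
    filter_upwards [hW1] with x hx
    have : pr 0 (cf (i+1) x) = pr 1 (cf i x) := by
      funext z
      rcases z with z | z
      · change x (Sum.inr (i+1, 0, z)) = x (Sum.inr (i, 1, z))
        have := hx (Term.equal (var (Sum.inr (i+1, 0, z))) (var (Sum.inr (i, 1, z))))
        simp only [Formula.realize_equal, Term.realize_var] at this
        rw [this]
        exact congrFun (ha i).1 z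
      · rfl
    rw [this]
  refine ⟨fun i => ty L univ (pr 0) (U i), fun i => ⟨ty_mem_TS _ _, ⟨U i, ?_, ?_, rfl⟩, ?_⟩⟩
  · intro r J J' hJ hJ' s hs
    exact hW2 (Fin k) (fun j z => Sum.inr (i, j, z)) (ha i).2.1 r s hs J J' hJ hJ'
  · intro j
    refine Eq.trans ?_ (hstep i).symm
    rw [ty_eq]
    intro s hs
    let g : ℕ → Fin k ⊕ (Fin k ⊕ Fin l) → Fin l ⊕ (ℕ × ℕ × Fin k) := fun j =>
      Sum.elim (fun z => Sum.inr (i, j+1, z)) (Sum.elim (fun z => Sum.inr (i, 0, z)) Sum.inl)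
    let g3 : Fin k ⊕ Fin l → Fin 1 × (Fin k ⊕ (Fin k ⊕ Fin l)) := fun z => (0, Sum.map id Sum.inr z)
    have hg : (fun j z => w (g j z)) = (fun j => Sum.elim (a i (j+1)) (Sum.elim (a i 0) b)) := by
      funext j z
      rcases z with z | z | z <;> rfl
    have := hW2 _ g (by rw [hg]; exact (ha i).2.2.2) 1 _ (hs.preimage_comp g3) (fun _ => j) (fun _ => 0)
      (Subsingleton.strictMono _) (Subsingleton.strictMono _)
    have e : ∀ j x, (fun p : Fin 1 × (Fin k ⊕ (Fin k ⊕ Fin l)) => x (g j p.2)) ∘ g3 = pr (j+1) (cf i x) := by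
      intro j x
      funext z
      rcases z with z | z <;> rfl
    simp only [mem_preimage, e] at this
    exact this
  · rw [← (ha i).2.2.1]
    ext φ
    have h0 : φ ∈ res (ty L (univ : Set M) (pr 0) (U i)) ↔
      ∀ᶠ x in (W : Filter _), φ.Realize (pr 0 (cf i x)) := ty_true
    rw [h0, ← eventually_const_iff W (φ ∈ typeOf (Sum.elim (a i 0) b))]
    apply eventually_congr
    filter_upwards [hW1] with x hx
    have := hx.comp (Sum.elim (fun z => Sum.inr (i, 0, z)) Sum.inl : Fin k ⊕ Fin l → _) φ
    have e1 : x ∘ (Sum.elim (fun z => Sum.inr (i, 0, z)) Sum.inl : Fin k ⊕ Fin l → _) = pr 0 (cf i x) := by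
      funext z; rcases z with z | z <;> rfl
    have e2 : w ∘ (Sum.elim (fun z => Sum.inr (i, 0, z)) Sum.inl : Fin k ⊕ Fin l → _) = Sum.elim (a i 0) b := by
      funext z; rcases z with z | z <;> rfl
    rw [e1, e2] at this
    exact this

theorem cycle_types {T : L.Theory} [Nonempty M] (hM : WSat L M) (hTT : TT L M) {k l : ℕ}
    {q : ℕ → Set (L.Formula (Fin k ⊕ Fin l))} (h : ∀ i, Pf T (q (i+1)) (q i)) (c : Fin k → M)
    (b : Fin l → M) (hc : typeOf (L := L) (Sum.elim c b) = q 0) (n : ℕ) (hn : 0 < n)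
    (hper : ∀ i, q (i + n) = q i) (hne : ∀ i, q i ≠ q (i+1)) :
    ∃ N : ℕ, 2 ≤ N ∧ ∃ f : ℕ → Inst L (univ : Set M) (Fin k ⊕ Fin l) → Bool,
      (∀ i, f (i + N) = f i) ∧ (∀ i, RA L univ (f i) (f (i+1))) ∧
      ∀ i j, i < N → j < N → f i = f j → i = j := by
  obtain ⟨P, hP⟩ := chain_types hM hTT h c b hc
  let R : (Inst L (univ : Set M) (Fin k ⊕ Fin l) → Bool) → (Inst L (univ : Set M) (Fin k ⊕ Fin l) → Bool) → Prop :=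
    fun x y => RA L univ y x ∧ ∃ i ∈ Finset.range n, res x = q i ∧ res y = q (i+1)
  have hR : IsClosed {p : (Inst L (univ : Set M) (Fin k ⊕ Fin l) → Bool) ×
      (Inst L (univ : Set M) (Fin k ⊕ Fin l) → Bool) | R p.1 p.2} := by
    have e : {p : (Inst L (univ : Set M) (Fin k ⊕ Fin l) → Bool) ×
      (Inst L (univ : Set M) (Fin k ⊕ Fin l) → Bool) | R p.1 p.2} =
        Prod.swap ⁻¹' {p : (Inst L (univ : Set M) (Fin k ⊕ Fin l) → Bool) ×
          (Inst L (univ : Set M) (Fin k ⊕ Fin l) → Bool) | RA L univ p.1 p.2} ∩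
        ⋃ i ∈ Finset.range n, (Prod.fst ⁻¹' {P | res P = q i} ∩ Prod.snd ⁻¹' {P | res P = q (i+1)}) := by
      ext p
      simp only [R, mem_inter_iff, mem_preimage, mem_iUnion, Set.mem_ofPred_eq, exists_prop, Prod.fst_swap,
        Prod.snd_swap]
    rw [e]
    refine (isClosed_RA.preimage continuous_swap).inter (isClosed_biUnion_finset fun i _ => ?_)
    exact ((isClosed_res _).preimage continuous_fst).inter ((isClosed_res _).preimage continuous_snd)
  have hmod : ∀ i, q i = q (i % n) := by
    intro i
    induction i using Nat.strong_induction_on with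
    | _ i ih =>
      rcases lt_or_ge i n with h | h
      · rw [Nat.mod_eq_of_lt h]
      · obtain ⟨j, rfl⟩ := Nat.exists_eq_add_of_le' h
        rw [hper, Nat.add_mod_right]
        exact ih j (by omega)
  obtain ⟨x, hx⟩ := cyc R hR _ (isClosed_TS (A := (univ : Set M)) (Γ := Fin k ⊕ Fin l) (L := L))
    (fun C hC _ hne => scat hTT C hC hne) P (fun i => (hP i).1) (fun i => ⟨(hP i).2.1, i % n,
      Finset.mem_range.2 (Nat.mod_lt _ hn), (hP i).2.2.trans (hmod i), (hP (i+1)).2.2.trans (by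
        rw [hmod (i+1), hmod (i % n + 1), Nat.mod_add_mod])⟩)
  obtain ⟨N, hN, f, h1, h2, h3⟩ := simple_cycle (r := Function.swap R) (by
    rintro x ⟨-, i, -, h1, h2⟩
    exact hne i (h1.symm.trans h2)) (Relation.transGen_swap.2 hx)
  exact ⟨N, hN, f, h1, fun i => (h2 i).1, h3⟩

end Chain2


section Sorts
open Filter
variable {M : Type w} [L.Structure M]

theorem mkSort {V : Type} [Finite V] (E : (V → M) → (V → M) → Prop) (hE : Equivalence E)
    (hd : (∅ : Set M).Definable L {v : V ⊕ V → M | E (v ∘ Sum.inl) (v ∘ Sum.inr)}) :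
    ∃ (S : ImSort L M) (e : SortVars S ≃ V),
      ∀ c c', SortEquiv (L := L) S c c' ↔ E (c ∘ e.symm) (c' ∘ e.symm) := by
  obtain ⟨n, ⟨e0⟩⟩ := Finite.exists_equiv_fin V
  obtain ⟨φ, hφ⟩ := empty_definable_iff.1 hd
  have hr : ∀ a b : Fin n → M, (φ.relabel (Sum.map e0 e0)).Realize (Sum.elim a b) ↔ E (a ∘ e0) (b ∘ e0) := by
    intro a b
    rw [Formula.realize_relabel, Sum.elim_comp_map]
    have : Sum.elim (a ∘ e0) (b ∘ e0) ∈ {v : V ⊕ V → M | E (v ∘ Sum.inl) (v ∘ Sum.inr)} ↔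
      Sum.elim (a ∘ e0) (b ∘ e0) ∈ {v | φ.Realize v} := by rw [hφ]
    exact this.symm
  refine ⟨⟨1, fun _ => n, fun _ => φ.relabel (Sum.map e0 e0), fun _ => ⟨?_, ?_, ?_⟩⟩, ?_, ?_⟩
  · intro a; rw [hr]; exact hE.refl _
  · intro a b; rw [hr, hr]; exact hE.symm
  · intro a b c; rw [hr, hr, hr]; exact hE.trans
  · exact { toFun := fun p => e0.symm p.2, invFun := fun z => ⟨0, e0 z⟩,
            left_inv := fun p => by
              rcases p with ⟨r, t⟩
              obtain rfl : r = 0 := Subsingleton.elim _ _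
              simp
            right_inv := fun z => by simp }
  · intro c c'
    constructor
    · intro h
      have := h 0
      rw [hr] at this
      exact this
    · intro h r
      obtain rfl : r = 0 := Subsingleton.elim _ _
      rw [hr]
      exact h

theorem no_two_general
    (hyp : ∀ (S S' : ImSort L M) (p q : Set (L.Formula (SortVars S ⊕ SortVars S'))),
        (∃ (c : SortVars S → M) (d : SortVars S' → M), imTypeOf (L := L) S S' c d = p) →
        (∃ (c : SortVars S → M) (d : SortVars S' → M), imTypeOf (L := L) S S' c d = q) →
        PfTeq (L := L) S S' p q → PfTeq (L := L) S S' q p → p = q)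
    {V V' : Type} [Finite V] [Finite V'] (E : (V → M) → (V → M) → Prop) (hE : Equivalence E)
    (hd : (∅ : Set M).Definable L {v : V ⊕ V → M | E (v ∘ Sum.inl) (v ∘ Sum.inr)})
    (E' : (V' → M) → (V' → M) → Prop) (hE' : Equivalence E')
    (hd' : (∅ : Set M).Definable L {v : V' ⊕ V' → M | E' (v ∘ Sum.inl) (v ∘ Sum.inr)})
    (a1 a2 : ℕ → V → M) (b1 b2 : V' → M) (h1 : IsIndiscernible (L := L) a1)
    (h2 : IsIndiscernible (L := L) a2) (X Y : Set (V ⊕ V' → M) → Prop)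
    (hX1 : ∀ s, (∅ : Set M).Definable L s → Inv2 E E' s → ∀ j, (Sum.elim (a1 (j+1)) b1 ∈ s ↔ X s))
    (hY1 : ∀ s, (∅ : Set M).Definable L s → Inv2 E E' s → (Sum.elim (a1 0) b1 ∈ s ↔ Y s))
    (hY2 : ∀ s, (∅ : Set M).Definable L s → Inv2 E E' s → ∀ j, (Sum.elim (a2 (j+1)) b2 ∈ s ↔ Y s))
    (hX2 : ∀ s, (∅ : Set M).Definable L s → Inv2 E E' s → (Sum.elim (a2 0) b2 ∈ s ↔ X s))
    (s : Set (V ⊕ V' → M)) (hs : (∅ : Set M).Definable L s) (hi : Inv2 E E' s) : X s ↔ Y s := by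
  obtain ⟨S, e, he⟩ := mkSort E hE hd
  obtain ⟨S', e', he'⟩ := mkSort E' hE' hd'
  have key : ∀ (c c' : V → M) (d d' : V' → M), (∀ s, (∅ : Set M).Definable L s → Inv2 E E' s →
      (Sum.elim c d ∈ s ↔ Sum.elim c' d' ∈ s)) →
      imTypeOf (L := L) S S' (c ∘ e) (d ∘ e') = imTypeOf (L := L) S S' (c' ∘ e) (d' ∘ e') := by
    intro c c' d d' h
    rw [imType_iff]
    intro s hs hi
    have := h _ (hs.preimage_comp (Sum.map e e')) (by
      intro c c' d d' hc hd
      rw [mem_preimage, mem_preimage, Sum.elim_comp_map, Sum.elim_comp_map]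
      apply hi
      · rw [he]; simpa only [Function.comp_assoc, Equiv.self_comp_symm, Function.comp_id] using hc
      · rw [he']; simpa only [Function.comp_assoc, Equiv.self_comp_symm, Function.comp_id] using hd)
    rwa [mem_preimage, mem_preimage, Sum.elim_comp_map, Sum.elim_comp_map] at this
  have hind : ∀ a : ℕ → V → M, IsIndiscernible (L := L) a →
      ImSortIndiscernible (L := L) S (fun j => a j ∘ e) := by
    intro a h n J J' hJ hJ' φ _
    have := h n J J' hJ hJ' (φ.relabel (Prod.map id e))
    rw [Formula.realize_relabel, Formula.realize_relabel] at this
    exact this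
  have hpq := hyp S S' (imTypeOf (L := L) S S' (a1 1 ∘ e) (b1 ∘ e')) (imTypeOf (L := L) S S' (a1 0 ∘ e) (b1 ∘ e'))
    ⟨_, _, rfl⟩ ⟨_, _, rfl⟩
    ⟨b1 ∘ e', fun j => a1 j ∘ e, hind _ h1, fun j hj => by
      obtain ⟨j, rfl⟩ := Nat.exists_eq_succ_of_ne_zero hj.ne'
      exact key _ _ _ _ fun s hs hi => (hX1 s hs hi j).trans (hX1 s hs hi 0).symm, rfl⟩
    ⟨b2 ∘ e', fun j => a2 j ∘ e, hind _ h2, fun j hj => by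
      obtain ⟨j, rfl⟩ := Nat.exists_eq_succ_of_ne_zero hj.ne'
      exact key _ _ _ _ fun s hs hi => (hY2 s hs hi j).trans (hY1 s hs hi).symm,
      key _ _ _ _ fun s hs hi => (hX2 s hs hi).trans (hX1 s hs hi 0).symm⟩
  rw [imType_iff] at hpq
  have := hpq _ (hs.preimage_comp (Sum.map e.symm e'.symm)) (by
      intro c c' d d' hc hd
      rw [mem_preimage, mem_preimage, Sum.elim_comp_map, Sum.elim_comp_map]
      exact hi _ _ _ _ ((he _ _).1 hc) ((he' _ _).1 hd))
  rw [mem_preimage, mem_preimage, Sum.elim_comp_map, Sum.elim_comp_map] at this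
  simp only [Function.comp_assoc, Equiv.self_comp_symm, Function.comp_id] at this
  rw [← hX1 s hs hi 0, ← hY1 s hs hi]
  exact this

end Sorts


section Core
open Filter
variable {M : Type w} [L.Structure M]

/-- reindexing a tuple of pairs into two blocks with parameters -/
def QQ {M : Type w} {α β : Type} {K r : ℕ} (m : Fin r → M) (y : Fin K → α ⊕ β → M) :
    (Fin K × α) ⊕ ((Fin K × β) ⊕ Fin r) → M :=
  Sum.elim (fun p => y p.1 (Sum.inl p.2)) (Sum.elim (fun p => y p.1 (Sum.inr p.2)) m)

theorem QQ_def {α β : Type} {K r : ℕ} (m : Fin r → M)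
    {s : Set ((Fin K × α) ⊕ ((Fin K × β) ⊕ Fin r) → M)} (hs : (∅ : Set M).Definable L s) :
    ∃ s' : Set (Fin K × (α ⊕ β) → M), (univ : Set M).Definable L s' ∧
      ∀ y : Fin K → α ⊕ β → M, QQ m y ∈ s ↔ flat y ∈ s' := by
  let h : (Fin K × α) ⊕ ((Fin K × β) ⊕ Fin r) → (Fin K × (α ⊕ β)) ⊕ Fin r :=
    Sum.elim (fun p => Sum.inl (p.1, Sum.inl p.2)) (Sum.elim (fun p => Sum.inl (p.1, Sum.inr p.2)) Sum.inr)
  refine ⟨_, sec_left ((hs.mono (empty_subset univ)).preimage_comp h) m, fun y => ?_⟩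
  rw [Set.mem_ofPred_eq, mem_preimage]
  have : Sum.elim (flat y) m ∘ h = QQ m y := by
    funext z
    rcases z with z | z | z <;> rfl
  rw [this]

theorem witness [Nonempty M] (hM : WSat L M) (hN : NoOrd L M) {α β : Type} [Finite α] [Finite β]
    {K r : ℕ} (m : Fin r → M) (W : Fin K → Ultrafilter (Conf M α β)) (hW : ∀ i, UInd L univ (W i)) :
    ∃ (a : ℕ → Fin K × α → M) (b : Fin K × β → M), IsIndiscernible (L := L) a ∧
      ∀ (j : ℕ) (U : Fin K → Ultrafilter (α ⊕ β → M)), (∀ i, UEq L ((W i).map (pr j)) (U i)) →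
        ∀ s : Set ((Fin K × α) ⊕ ((Fin K × β) ⊕ Fin r) → M), (∅ : Set M).Definable L s →
          (Sum.elim (a j) (Sum.elim b m) ∈ s ↔ ∀ᶠ y in mu K U, QQ m y ∈ s) := by
  let F : (Fin K → Conf M α β) → (ℕ × (Fin K × α)) ⊕ (Fin K × β) → M := fun ω =>
    Sum.elim (fun q => (ω q.2.1).1 q.1 q.2.2) (fun q => (ω q.1).2 q.2)
  obtain ⟨x, hx⟩ := real hM (mu K W) F m
  have hx' : ∀ {ξ : Type} (h : ξ → ((ℕ × (Fin K × α)) ⊕ (Fin K × β)) ⊕ Fin r) (s : Set (ξ → M)),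
      (∅ : Set M).Definable L s → (Sum.elim x m ∘ h ∈ s ↔
        ∀ᶠ ω : Fin K → Conf M α β in mu K W, Sum.elim (F ω) m ∘ h ∈ s) := by
    intro ξ h s hs
    obtain ⟨φ, rfl⟩ := empty_definable_iff.1 hs
    have := hx (φ.relabel h)
    simp only [Formula.realize_relabel] at this
    exact this
  refine ⟨fun j z => x (Sum.inl (j, z)), fun z => x (Sum.inr z), ?_, ?_⟩
  · rw [indisc_iff]
    intro t s hs J J' hJ hJ'
    have key : ∀ J : Fin t → ℕ, (fun p : Fin t × (Fin K × α) => x (Sum.inl (J p.1, p.2))) ∈ s ↔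
        ∀ᶠ y in mu K (fun i => (W i).map (fun ω : Conf M α β => fun p : Fin t × α => ω.1 (J p.1) p.2)),
          flat y ∈ (fun v : Fin K × (Fin t × α) → M => v ∘
            (fun p : Fin t × (Fin K × α) => (p.2.1, (p.1, p.2.2)))) ⁻¹' s := by
      intro J
      rw [mu_map]
      exact hx' (fun p : Fin t × (Fin K × α) => Sum.inl (Sum.inl (J p.1, p.2))) s hs
    rw [key, key]
    apply te hN
    · intro i s hs
      exact hW i t J J' hJ hJ' s hs
    · exact (hs.mono (empty_subset univ)).preimage_comp _
  · intro j U hU s hs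
    obtain ⟨s', hs', hh⟩ := QQ_def m hs
    simp only [hh]
    rw [← te hN _ _ hU s' hs', mu_map]
    simp only [← hh]
    have := hx' (Sum.elim (fun z => Sum.inl (Sum.inl (j, z))) (Sum.elim (fun z => Sum.inl (Sum.inr z)) Sum.inr)) s hs
    have e1 : Sum.elim x m ∘ (Sum.elim (fun z => Sum.inl (Sum.inl (j, z))) (Sum.elim (fun z => Sum.inl (Sum.inr z)) Sum.inr)) =
      Sum.elim (fun z => x (Sum.inl (j, z))) (Sum.elim (fun z => x (Sum.inr z)) m) := by
      funext z; rcases z with z | z | z <;> rfl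
    rw [e1] at this
    rw [this]
    apply iff_of_eq
    congr 1
    funext ω
    congr 1
    funext z; rcases z with z | z | z <;> rfl

/-- equality up to permuting blocks -/
def EP {M : Type w} {α : Type} {K : ℕ} (c c' : Fin K × α → M) : Prop :=
  ∃ σ : Equiv.Perm (Fin K), ∀ p, c' p = c (σ p.1, p.2)

/-- equality up to permuting blocks, with parameters -/
def EP' {M : Type w} {β : Type} {K r : ℕ} (d d' : (Fin K × β) ⊕ Fin r → M) : Prop :=
  EP (d ∘ Sum.inl) (d' ∘ Sum.inl) ∧ ∀ t, d' (Sum.inr t) = d (Sum.inr t)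

theorem EP_equiv {α : Type} {K : ℕ} : Equivalence (EP : (Fin K × α → M) → (Fin K × α → M) → Prop) := by
  refine ⟨fun c => ⟨1, fun p => rfl⟩, ?_, ?_⟩
  · rintro c c' ⟨σ, h⟩
    refine ⟨σ.symm, fun p => ?_⟩
    rw [h]; simp
  · rintro c c' c'' ⟨σ, h⟩ ⟨τ, h'⟩
    refine ⟨τ.trans σ, fun p => ?_⟩
    rw [h', h]; simp

theorem EP'_equiv {β : Type} {K r : ℕ} :
    Equivalence (EP' : ((Fin K × β) ⊕ Fin r → M) → ((Fin K × β) ⊕ Fin r → M) → Prop) := by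
  refine ⟨fun c => ⟨EP_equiv.refl _, fun p => rfl⟩, ?_, ?_⟩
  · rintro c c' ⟨h1, h2⟩
    exact ⟨EP_equiv.symm h1, fun t => (h2 t).symm⟩
  · rintro c c' c'' ⟨h1, h2⟩ ⟨h3, h4⟩
    exact ⟨EP_equiv.trans h1 h3, fun t => (h4 t).trans (h2 t)⟩

theorem eq_def {γ : Type*} (i j : γ) : (∅ : Set M).Definable L {v : γ → M | v i = v j} := by
  convert empty_def_of (L := L) (M := M) (Term.equal (var i) (var j)) using 1
  ext v
  simp [Formula.realize_equal, Term.realize_var]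

theorem EP_def {α : Type} [Finite α] {K : ℕ} : (∅ : Set M).Definable L
    {v : (Fin K × α) ⊕ (Fin K × α) → M | EP (v ∘ Sum.inl) (v ∘ Sum.inr)} :=
  definable_exists _ fun σ : Equiv.Perm (Fin K) => definable_forall _ fun p =>
    eq_def (Sum.inr p) (Sum.inl (σ p.1, p.2))

theorem EP'_def {β : Type} [Finite β] {K r : ℕ} : (∅ : Set M).Definable L
    {v : ((Fin K × β) ⊕ Fin r) ⊕ ((Fin K × β) ⊕ Fin r) → M | EP' (v ∘ Sum.inl) (v ∘ Sum.inr)} :=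
  ((EP_def (α := β) (K := K)).preimage_comp (Sum.map Sum.inl Sum.inl :
      (Fin K × β) ⊕ (Fin K × β) → ((Fin K × β) ⊕ Fin r) ⊕ ((Fin K × β) ⊕ Fin r))).inter
    (definable_forall _ fun t => eq_def (Sum.inr (Sum.inr t)) (Sum.inl (Sum.inr t)))

theorem rot (hN : NoOrd L M) {α β : Type} [Finite α] [Finite β] {K r : ℕ} (m : Fin r → M)
    (U U' : Fin (K+1) → Ultrafilter (α ⊕ β → M)) (h1 : U 0 = U' (Fin.last K))
    (h2 : ∀ i : Fin K, U i.succ = U' i.castSucc)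
    (s : Set ((Fin (K+1) × α) ⊕ ((Fin (K+1) × β) ⊕ Fin r) → M)) (hs : (∅ : Set M).Definable L s)
    (hi : Inv2 EP EP' s) :
    (∀ᶠ y in mu (K+1) U, QQ m y ∈ s) ↔ ∀ᶠ y in mu (K+1) U', QQ m y ∈ s := by
  rw [mu_succ, mu_snoc, h1, funext h2]
  obtain ⟨s', hs', hh⟩ := QQ_def m hs
  have h3 := comm' hN (U' (Fin.last K)) (mu K fun i => U' i.castSucc) flat
    (fun p : Fin (K+1) × (α ⊕ β) => (Fin.cases (Sum.inl p.2) (fun i => Sum.inr (i, p.2)) p.1 :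
        (α ⊕ β) ⊕ (Fin K × (α ⊕ β)))) hs'
  simp only [← flat_cons, ← hh] at h3
  rw [h3]
  refine eventually_congr (Eventually.of_forall fun x => eventually_congr (Eventually.of_forall fun a => ?_))
  have h4 : ∀ i, (Fin.snoc x a : Fin (K+1) → (α ⊕ β) → M) i =
      (Fin.cons a x : Fin (K+1) → (α ⊕ β) → M) (finRotate _ i) := fun i =>
    congrFun (Fin.snoc_eq_cons_rotate x a) i
  refine hi _ _ _ _ ⟨finRotate _, fun p => ?_⟩ ⟨⟨finRotate _, fun p => ?_⟩, fun t => rfl⟩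
  · change (Fin.snoc x a : Fin (K+1) → (α ⊕ β) → M) p.1 (Sum.inl p.2) = _
    rw [h4]
  · change (Fin.snoc x a : Fin (K+1) → (α ⊕ β) → M) p.1 (Sum.inr p.2) = _
    rw [h4]
    rfl

theorem single_marg {A : Type*} {K : ℕ} (U : Fin K → Ultrafilter A) (i : Fin K) (P : A → Prop) :
    (∀ᶠ y : Fin K → A in mu K U, P (y i)) ↔ ∀ᶠ a in U i, P a := by
  have := mu_comp U ![i] (Subsingleton.strictMono _) (fun x => P (x 0))
  rw [mu_succ] at this
  exact this

theorem pair_marg (hN : NoOrd L M) {Γ : Type} [Finite Γ] {K : ℕ} (U : Fin K → Ultrafilter (Γ → M))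
    {i j : Fin K} (hij : i ≠ j) {s : Set (Γ ⊕ Γ → M)} (hs : (univ : Set M).Definable L s) :
    (∀ᶠ y : Fin K → Γ → M in mu K U, Sum.elim (y i) (y j) ∈ s) ↔ ∀ᶠ a in U i, ∀ᶠ b in U j, Sum.elim a b ∈ s := by
  rcases lt_or_gt_of_ne hij with h | h
  · have := mu_comp U ![i, j] (by
      rw [Fin.strictMono_iff_lt_succ]
      intro a
      obtain rfl : a = 0 := Subsingleton.elim _ _
      exact h) (fun x => Sum.elim (x 0) (x 1) ∈ s)
    rw [mu_succ] at this
    exact this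
  · have := mu_comp U ![j, i] (by
      rw [Fin.strictMono_iff_lt_succ]
      intro a
      obtain rfl : a = 0 := Subsingleton.elim _ _
      exact h) (fun x => Sum.elim (x 1) (x 0) ∈ s)
    rw [mu_succ] at this
    rw [comm hN _ _ hs]
    exact this

end Core


section Core2
open Filter
variable {M : Type w} [L.Structure M]

theorem core [Nonempty M] (hM : WSat L M) (hN : NoOrd L M)
    (hyp : ∀ (S S' : ImSort L M) (p q : Set (L.Formula (SortVars S ⊕ SortVars S'))),
        (∃ (c : SortVars S → M) (d : SortVars S' → M), imTypeOf (L := L) S S' c d = p) →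
        (∃ (c : SortVars S → M) (d : SortVars S' → M), imTypeOf (L := L) S S' c d = q) →
        PfTeq (L := L) S S' p q → PfTeq (L := L) S S' q p → p = q)
    {α β : Type} [Finite α] [Finite β] (K : ℕ) (W : ℕ → Ultrafilter (Conf M α β))
    (p : ℕ → Ultrafilter (α ⊕ β → M)) (hW : ∀ i, UInd L univ (W i))
    (h1 : ∀ i j, UEq L ((W i).map (pr (j+1))) (p i)) (h0 : ∀ i, UEq L ((W i).map (pr 0)) (p (i+1)))
    (hper : UEq L (p (K+2)) (p 0)) {r : ℕ} (m : Fin r → M) (φ : L.Formula ((α ⊕ β) ⊕ Fin r))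
    (hφ0 : ∀ᶠ v : α ⊕ β → M in p 0, φ.Realize (Sum.elim v m))
    (hφ : ∀ i, i < K + 1 → ∀ᶠ v : α ⊕ β → M in p (i+1), ¬ φ.Realize (Sum.elim v m))
    (hφG : ∀ i j, ∀ᶠ a : α ⊕ β → M in p i, ∀ᶠ b : α ⊕ β → M in p j,
      ¬ φ.Realize (Sum.elim (Sum.elim (a ∘ Sum.inl) (b ∘ Sum.inr)) m)) : False := by
  -- the two witnesses
  let X : Fin (K+1) → Ultrafilter (α ⊕ β → M) := fun i => p i
  let Y : Fin (K+1) → Ultrafilter (α ⊕ β → M) := fun i => p (i+1)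
  let Y' : Fin (K+1) → Ultrafilter (α ⊕ β → M) := Fin.cons (p (K+1)) (fun i => p (i+1))
  obtain ⟨a1, b1, hi1, hw1⟩ := witness hM hN m (fun i : Fin (K+1) => W i) (fun i => hW i)
  let cst : Ultrafilter (α ⊕ β → M) → Ultrafilter (Conf M α β) := fun U =>
    U.map (fun v => (fun _ z => v (Sum.inl z), fun y => v (Sum.inr y)))
  have hcst : ∀ U, UInd L (univ : Set M) (cst U) := fun U r J J' hJ hJ' s hs => Iff.rfl
  have hcst' : ∀ (U : Ultrafilter (α ⊕ β → M)) j, UEq L ((cst U).map (pr j)) U := by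
    intro U j s hs
    rw [map_iff, map_iff]
    apply iff_of_eq
    congr 1
    funext v
    congr 1
    funext z; rcases z with z | z <;> rfl
  let W2 : Fin (K+1) → Ultrafilter (Conf M α β) := Fin.cons (W (K+1)) (fun i => cst (p (i+1)))
  obtain ⟨a2, b2, hi2, hw2⟩ := witness hM hN m W2 (by
    intro i
    refine Fin.cases (hW (K+1)) (fun i => hcst _) i)
  let Θ : Set ((Fin (K+1) × α) ⊕ ((Fin (K+1) × β) ⊕ Fin r) → M) :=
    {v | ∃ q : Fin (K+1) × Fin (K+1), v ∈ (fun v => v ∘ (Sum.elim (Sum.elim (fun z => Sum.inl (q.1, z))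
      (fun z => Sum.inr (Sum.inl (q.2, z)))) (fun t => Sum.inr (Sum.inr t)) :
        (α ⊕ β) ⊕ Fin r → (Fin (K+1) × α) ⊕ ((Fin (K+1) × β) ⊕ Fin r))) ⁻¹' {v | φ.Realize v}}
  have hΘd : (∅ : Set M).Definable L Θ :=
    definable_exists _ fun q => (empty_def_of φ).preimage_comp _
  have hmem : ∀ c d m', Sum.elim c (Sum.elim d m') ∈ Θ ↔ ∃ i j : Fin (K+1),
      φ.Realize (Sum.elim (Sum.elim (fun z => c (i, z)) (fun z => d (j, z))) m') := by
    intro c d m'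
    have e : ∀ i j : Fin (K+1), Sum.elim c (Sum.elim d m') ∘ (Sum.elim (Sum.elim (fun z => Sum.inl (i, z))
      (fun z => Sum.inr (Sum.inl (j, z)))) (fun t => Sum.inr (Sum.inr t)) :
        (α ⊕ β) ⊕ Fin r → (Fin (K+1) × α) ⊕ ((Fin (K+1) × β) ⊕ Fin r)) =
        Sum.elim (Sum.elim (fun z => c (i, z)) (fun z => d (j, z))) m' := by
      intro i j
      funext z; rcases z with (z | z) | z <;> rfl
    constructor
    · rintro ⟨⟨i, j⟩, h⟩
      refine ⟨i, j, ?_⟩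
      rw [← e]; exact h
    · rintro ⟨i, j, h⟩
      refine ⟨⟨i, j⟩, ?_⟩
      rw [← e] at h; exact h
  have hΘ1 : ∀ (c c' : Fin (K+1) × α → M) (d d' : (Fin (K+1) × β) ⊕ Fin r → M), EP c c' → EP' d d' →
      Sum.elim c' d' ∈ Θ → Sum.elim c d ∈ Θ := by
    rintro c c' d d' ⟨σ, h⟩ ⟨⟨τ, h2⟩, h3⟩ h4
    have e1 : d = Sum.elim (d ∘ Sum.inl) (d ∘ Sum.inr) := (Sum.elim_comp_inl_inr d).symm
    have e2 : d' = Sum.elim (d' ∘ Sum.inl) (d ∘ Sum.inr) := by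
      funext z; rcases z with z | z
      · rfl
      · exact h3 z
    rw [e2, hmem] at h4
    rw [e1, hmem]
    obtain ⟨i, j, h4⟩ := h4
    refine ⟨σ i, τ j, ?_⟩
    simp only [h, h2] at h4
    exact h4
  have hΘi : Inv2 EP EP' Θ := by
    intro c c' d d' hc hd
    exact ⟨hΘ1 _ _ _ _ (EP_equiv.symm hc) (EP'_equiv.symm hd), hΘ1 _ _ _ _ hc hd⟩
  have hXY := no_two_general hyp EP EP_equiv EP_def EP' EP'_equiv EP'_def a1 a2 (Sum.elim b1 m)
    (Sum.elim b2 m) hi1 hi2 (fun s => ∀ᶠ y in mu (K+1) X, QQ m y ∈ s)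
    (fun s => ∀ᶠ y in mu (K+1) Y, QQ m y ∈ s)
    (fun s hs _ j => hw1 (j+1) X (fun i => h1 i j) s hs)
    (fun s hs _ => hw1 0 Y (fun i => h0 i) s hs)
    (fun s hs hi j => by
      rw [hw2 (j+1) Y' ?_ s hs]
      · exact rot hN m Y' Y (by simp [Y, Y']) (fun i => by simp [Y, Y']) s hs hi
      · intro i
        refine Fin.cases ?_ (fun i => ?_) i
        · exact h1 (K+1) j
        · exact hcst' _ _)
    (fun s hs _ => by
      rw [hw2 0 X ?_ s hs]
      intro i
      refine Fin.cases ?_ (fun i => ?_) i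
      · intro s hs
        exact (h0 (K+1) s hs).trans (hper s hs)
      · exact hcst' (p (i+1)) 0)
    Θ hΘd hΘi
  have hX : ∀ᶠ y in mu (K+1) X, QQ m y ∈ Θ := by
    have := (single_marg X 0 (fun v => φ.Realize (Sum.elim v m))).2 hφ0
    filter_upwards [this] with y hy
    rw [QQ, hmem]
    refine ⟨0, 0, ?_⟩
    have e : (Sum.elim (fun z => y 0 (Sum.inl z)) (fun z => y 0 (Sum.inr z)) : α ⊕ β → M) = y 0 :=
      Sum.elim_comp_inl_inr (y 0)
    rw [e]
    exact hy
  have hY := hXY.1 hX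
  have hnot : ∀ i j : Fin (K+1), ∀ᶠ y : Fin (K+1) → α ⊕ β → M in mu (K+1) Y,
      ¬ φ.Realize (Sum.elim (Sum.elim (y i ∘ Sum.inl) (y j ∘ Sum.inr)) m) := by
    intro i j
    by_cases hij : i = j
    · subst hij
      have := (single_marg Y i (fun v => ¬ φ.Realize (Sum.elim v m))).2 (hφ i i.2)
      simpa only [Sum.elim_comp_inl_inr] using this
    · have hd := univ_def_of m (φ.relabel (Sum.map (Sum.map Sum.inl Sum.inr) id :
        (α ⊕ β) ⊕ Fin r → ((α ⊕ β) ⊕ (α ⊕ β)) ⊕ Fin r)).not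
      have := (pair_marg hN Y hij hd).2
      simp only [Set.mem_ofPred_eq, Formula.realize_not, Formula.realize_relabel, Sum.elim_comp_map,
        Function.comp_id] at this
      exact this (hφG _ _)
  have hall : ∀ᶠ y : Fin (K+1) → α ⊕ β → M in mu (K+1) Y, ∀ i j : Fin (K+1),
      ¬ φ.Realize (Sum.elim (Sum.elim (y i ∘ Sum.inl) (y j ∘ Sum.inr)) m) :=
    eventually_all.2 fun i => eventually_all.2 fun j => hnot i j
  obtain ⟨y, hy1, hy2⟩ := (hY.and hall).exists
  rw [QQ, hmem] at hy1
  obtain ⟨i, j, h⟩ := hy1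
  exact hy2 i j h

end Core2


section Final
open Filter
variable {M : Type w} [L.Structure M]

theorem no_cycle_ne [Nonempty M] (hM : WSat L M) (hN : NoOrd L M)
    (hyp : ∀ (S S' : ImSort L M) (p q : Set (L.Formula (SortVars S ⊕ SortVars S'))),
        (∃ (c : SortVars S → M) (d : SortVars S' → M), imTypeOf (L := L) S S' c d = p) →
        (∃ (c : SortVars S → M) (d : SortVars S' → M), imTypeOf (L := L) S S' c d = q) →
        PfTeq (L := L) S S' p q → PfTeq (L := L) S S' q p → p = q)
    {α β : Type} [Finite α] [Finite β] (K : ℕ) (W : ℕ → Ultrafilter (Conf M α β))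
    (p : ℕ → Ultrafilter (α ⊕ β → M)) (hW : ∀ i, UInd L univ (W i))
    (h1 : ∀ i j, UEq L ((W i).map (pr (j+1))) (p i)) (h0 : ∀ i, UEq L ((W i).map (pr 0)) (p (i+1)))
    (hper : UEq L (p (K+2)) (p 0)) (hne : ∀ i, i < K + 1 → ¬ UEq L (p (i+1)) (p 0))
    (s₀ : Set (α ⊕ β → M)) (hs₀ : (univ : Set M).Definable L s₀)
    (hp₀ : ∀ᶠ v : α ⊕ β → M in p 0, v ∈ s₀)
    (hG₀ : ∀ i j, ∀ᶠ a : α ⊕ β → M in p i, ∀ᶠ b : α ⊕ β → M in p j,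
      ¬ (Sum.elim (a ∘ Sum.inl) (b ∘ Sum.inr) : α ⊕ β → M) ∈ s₀) : False := by
  have hsep : ∀ i : Fin (K+1), ∃ s : Set (α ⊕ β → M), (univ : Set M).Definable L s ∧
      (∀ᶠ v : α ⊕ β → M in p 0, v ∈ s) ∧ ∀ᶠ v : α ⊕ β → M in p (i+1), v ∉ s := by
    intro i
    have := hne i i.2
    unfold UEq at this
    push Not at this
    obtain ⟨s, hs, hh⟩ := this
    rcases hh with ⟨h2, h3⟩ | ⟨h2, h3⟩
    · refine ⟨sᶜ, hs.compl, ?_, ?_⟩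
      · exact h3
      · simpa using h2
    · exact ⟨s, hs, h3, h2⟩
  choose s hs hs0 hs1 using hsep
  have hdef : (univ : Set M).Definable L (s₀ ∩ {v | ∀ i, v ∈ s i}) :=
    hs₀.inter (definable_forall s hs)
  obtain ⟨r, m, φ, hφ⟩ := univ_def_iff.1 hdef
  have hφ' : ∀ v : α ⊕ β → M, φ.Realize (Sum.elim v m) ↔ v ∈ s₀ ∧ ∀ i, v ∈ s i := by
    intro v
    have : v ∈ s₀ ∩ {v | ∀ i, v ∈ s i} ↔ v ∈ {v : α ⊕ β → M | φ.Realize (Sum.elim v m)} := by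
      rw [hφ]
    exact this.symm
  refine core hM hN hyp K W p hW h1 h0 hper m φ ?_ ?_ ?_
  · simp only [hφ']
    exact hp₀.and (eventually_all.2 hs0)
  · intro i hi
    refine (hs1 ⟨i, hi⟩).mono fun v hv h => hv (((hφ' v).1 h).2 _)
  · intro i j
    refine (hG₀ i j).mono fun a ha => ha.mono fun b hb h => hb ((hφ' _).1 h).1

theorem no_cycle [Nonempty M] (hM : WSat L M) (hN : NoOrd L M)
    (hyp : ∀ (S S' : ImSort L M) (p q : Set (L.Formula (SortVars S ⊕ SortVars S'))),
        (∃ (c : SortVars S → M) (d : SortVars S' → M), imTypeOf (L := L) S S' c d = p) →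
        (∃ (c : SortVars S → M) (d : SortVars S' → M), imTypeOf (L := L) S S' c d = q) →
        PfTeq (L := L) S S' p q → PfTeq (L := L) S S' q p → p = q)
    {α β : Type} [Finite α] [Finite β] (N : ℕ) (hN2 : 2 ≤ N)
    (f : ℕ → Inst L (univ : Set M) (α ⊕ β) → Bool) (hper : ∀ i, f (i + N) = f i)
    (hRA : ∀ i, RA L univ (f i) (f (i+1)))
    (hinj : ∀ i j, i < N → j < N → f i = f j → i = j) : False := by
  choose W hW h1 h0 using hRA
  obtain ⟨K, rfl⟩ : ∃ K, N = K + 2 := ⟨N - 2, by omega⟩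
  let p : ℕ → Ultrafilter (α ⊕ β → M) := fun i => (W i).map (pr 1)
  have hp : ∀ i, ty L univ (id : (α ⊕ β → M) → α ⊕ β → M) (p i) = f i := fun i => h1 i 0
  have hpe : ∀ i j, UEq L (p i) (p j) ↔ f i = f j := by
    intro i j
    rw [← hp i, ← hp j, ty_eq]
    rfl
  have h1' : ∀ i j, UEq L ((W i).map (pr (j+1))) (p i) := fun i j =>
    ty_eq.1 ((h1 i j).trans (h1 i 0).symm)
  have h0' : ∀ i, UEq L ((W i).map (pr 0)) (p (i+1)) := fun i =>
    ty_eq.1 ((h0 i).trans (h1 (i+1) 0).symm)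
  -- marginals
  have hx : ∀ i (s : Set (α → M)), (univ : Set M).Definable L s →
      ((∀ᶠ v : α ⊕ β → M in p i, v ∘ Sum.inl ∈ s) ↔
        ∀ᶠ v : α ⊕ β → M in p (i+1), v ∘ Sum.inl ∈ s) := by
    intro i s hs
    have e0 := h0' i _ (hs.preimage_comp (Sum.inl : α → α ⊕ β))
    refine Iff.trans ?_ e0
    have := hW i 1 (fun _ => 1) (fun _ => 0) (Subsingleton.strictMono _) (Subsingleton.strictMono _)
      _ (hs.preimage_comp (fun z : α => ((0 : Fin 1), z)))
    exact this
  have hy : ∀ i (s : Set (β → M)), (univ : Set M).Definable L s →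
      ((∀ᶠ v : α ⊕ β → M in p i, v ∘ Sum.inr ∈ s) ↔
        ∀ᶠ v : α ⊕ β → M in p (i+1), v ∘ Sum.inr ∈ s) := by
    intro i s hs
    exact h0' i _ (hs.preimage_comp (Sum.inr : β → α ⊕ β))
  have hx0 : ∀ i (s : Set (α → M)), (univ : Set M).Definable L s →
      ((∀ᶠ v : α ⊕ β → M in p i, v ∘ Sum.inl ∈ s) ↔
        ∀ᶠ v : α ⊕ β → M in p 0, v ∘ Sum.inl ∈ s) := by
    intro i s hs
    induction i with
    | zero => rfl
    | succ i ih => exact (hx i s hs).symm.trans ih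
  have hy0 : ∀ i (s : Set (β → M)), (univ : Set M).Definable L s →
      ((∀ᶠ v : α ⊕ β → M in p i, v ∘ Sum.inr ∈ s) ↔
        ∀ᶠ v : α ⊕ β → M in p 0, v ∘ Sum.inr ∈ s) := by
    intro i s hs
    induction i with
    | zero => rfl
    | succ i ih => exact (hy i s hs).symm.trans ih
  let G : ℕ → ℕ → Set (α ⊕ β → M) → Prop := fun i j s =>
    ∀ᶠ a : α ⊕ β → M in p i, ∀ᶠ b : α ⊕ β → M in p j,
      (Sum.elim (a ∘ Sum.inl) (b ∘ Sum.inr) : α ⊕ β → M) ∈ s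
  have hG : ∀ i j s, (univ : Set M).Definable L s → (G i j s ↔ G 0 0 s) := by
    intro i j s hs
    have hc : ∀ i j, G i j s ↔ ∀ᶠ b : α ⊕ β → M in p j, ∀ᶠ a : α ⊕ β → M in p i,
        (Sum.elim (a ∘ Sum.inl) (b ∘ Sum.inr) : α ⊕ β → M) ∈ s := fun i j =>
      comm hN ((p i).map (fun v => v ∘ Sum.inl)) ((p j).map (fun v => v ∘ Sum.inr)) hs
    have e1 : G i j s ↔ G i 0 s := by
      apply eventually_congr
      exact Eventually.of_forall fun a => hy0 j _ (sec_right hs (a ∘ Sum.inl))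
    have e2 : G i 0 s ↔ G 0 0 s := by
      rw [hc, hc]
      apply eventually_congr
      exact Eventually.of_forall fun b => hx0 i _ (sec_left hs (b ∘ Sum.inr))
    exact e1.trans e2
  have hGnot : ∀ i j s, (∀ᶠ a : α ⊕ β → M in p i, ∀ᶠ b : α ⊕ β → M in p j,
      ¬ (Sum.elim (a ∘ Sum.inl) (b ∘ Sum.inr) : α ⊕ β → M) ∈ s) ↔ ¬ G i j s := by
    intro i j s
    simp only [Ultrafilter.eventually_not, G]
  -- choice of the starting point
  have ht : ∃ t < 2, ∃ s, (univ : Set M).Definable L s ∧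
      (∀ᶠ v : α ⊕ β → M in p t, v ∈ s) ∧ ¬ G 0 0 s := by
    by_contra hcon
    push Not at hcon
    have key : ∀ t < 2, ∀ s, (univ : Set M).Definable L s →
        ((∀ᶠ v : α ⊕ β → M in p t, v ∈ s) ↔ G 0 0 s) := by
      intro t ht s hs
      refine ⟨hcon t ht s hs, fun h => ?_⟩
      by_contra h'
      have h2 := hcon t ht sᶜ hs.compl ((Ultrafilter.eventually_not).2 h')
      exact (hGnot 0 0 s).1 h2 h
    have : f 0 = f 1 := (hpe 0 1).1 fun s hs => (key 0 (by omega) s hs).trans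
      (key 1 (by omega) s hs).symm
    have := hinj 0 1 (by omega) (by omega) this
    omega
  obtain ⟨t, ht, s₀, hs₀, hps, hGs⟩ := ht
  refine no_cycle_ne hM hN hyp K (fun i => W (t+i)) (fun i => p (t+i)) (fun i => hW _)
    (fun i j => h1' _ _) (fun i => h0' _) ((hpe _ _).2 (hper t)) ?_ s₀ hs₀ hps ?_
  · intro i hi h
    have h2 : f (t + (i+1)) = f t := (hpe _ _).1 h
    rcases Nat.lt_or_ge (t + (i+1)) (K+2) with hlt | hge
    · have := hinj _ _ hlt (by omega) h2
      omega
    · have h3 : t + (i+1) = 0 + (K+2) := by omega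
      rw [h3, hper] at h2
      have := hinj _ _ (by omega) (by omega) h2
      omega
  · intro i j
    rw [hGnot, hG _ _ _ hs₀]
    exact hGs

theorem dir2 {T : L.Theory} (hT : T.IsComplete) (M : Theory.ModelType.{u, v, max u v} T)
    (hTT : TT L M) (hN : NoOrd L M) (hM : WSat L M)
    (hyp : ∀ (S S' : ImSort L M) (p q : Set (L.Formula (SortVars S ⊕ SortVars S'))),
        (∃ (c : SortVars S → M) (d : SortVars S' → M), imTypeOf (L := L) S S' c d = p) →
        (∃ (c : SortVars S → M) (d : SortVars S' → M), imTypeOf (L := L) S S' c d = q) →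
        PfTeq (L := L) S S' p q → PfTeq (L := L) S S' q p → p = q) : IsIndAcyclic T := by
  intro n hn k l p hreal hper hPf
  by_contra hcon
  push Not at hcon
  have hmul : ∀ a i, p (i + a * n) = p i := by
    intro a i
    induction a with
    | zero => simp
    | succ a ih => rw [Nat.succ_mul, ← add_assoc, hper, ih]
  have hmod : ∀ i, p i = p (i % n) := by
    intro i
    conv_lhs => rw [← Nat.mod_add_div i n, mul_comm, hmul]
  have hne1 : ∀ i, p i ≠ p (i+1) := by
    intro i h
    rw [hmod i, hmod (i+1)] at h
    refine hcon (i % n) ((i+1) % n) (Nat.mod_lt _ (by omega)) (Nat.mod_lt _ (by omega)) ?_ h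
    intro h2
    have h3 : (i + 0) % n = (i + 1) % n := h2
    have h4 : 0 ≡ 1 [MOD n] := Nat.ModEq.add_left_cancel' i h3
    have h5 : 0 % n = 1 % n := h4
    rw [Nat.zero_mod, Nat.mod_eq_of_lt (by omega)] at h5
    omega
  let q : ℕ → Set (L.Formula (Fin k ⊕ Fin l)) := fun i => p (i * (n-1))
  have hstep : ∀ i, p ((i+1) * (n-1) + 1) = p (i * (n-1)) := by
    intro i
    have : (i+1) * (n-1) + 1 = i * (n-1) + n := by
      rw [Nat.succ_mul]; omega
    rw [this, hper]
  obtain ⟨N₀, a₀, ha₀⟩ := hreal 0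
  obtain ⟨x, hx⟩ := transfer hM (eqT_empty hT N₀ M) a₀
  have hx2 := hx.comp (Sum.inl : Fin k ⊕ Fin l → (Fin k ⊕ Fin l) ⊕ Empty)
  have hxx : typeOf (L := L) (Sum.elim (x ∘ Sum.inl) (x ∘ Sum.inr)) = q 0 := by
    rw [Sum.elim_comp_inl_inr]
    change _ = p (0 * (n-1))
    rw [zero_mul, ← ha₀]
    exact (typeOf_eq_iff.2 hx2).symm
  obtain ⟨N, hN2, f, hf1, hf2, hf3⟩ := cycle_types (T := T) hM hTT (q := q) (by
      intro i
      have := hPf ((i+1) * (n-1))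
      rw [hstep] at this
      exact this) _ _ hxx n (by omega) (by
      intro i
      change p ((i + n) * (n-1)) = p (i * (n-1))
      rw [add_mul, mul_comm n, hmul]) (by
      intro i h
      have h' : p (i * (n-1)) = p ((i+1) * (n-1)) := h
      rw [← hstep] at h'
      exact hne1 _ h'.symm)
  exact no_cycle hM hN hyp N hN2 f hf1 hf2 hf3

theorem main_iff {T : L.Theory} (hT : T.IsComplete) (htt : IsTotallyTranscendental T)
    (M : Theory.ModelType.{u, v, max u v} T) (hM : IsMonster (L := L) M) :
    IsIndAcyclic T ↔
      ∀ (S S' : ImSort L ↥M) (p q : Set (L.Formula (SortVars S ⊕ SortVars S'))),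
        (∃ (c : SortVars S → ↥M) (d : SortVars S' → ↥M), imTypeOf (L := L) S S' c d = p) →
        (∃ (c : SortVars S → ↥M) (d : SortVars S' → ↥M), imTypeOf (L := L) S S' c d = q) →
        PfTeq (L := L) S S' p q → PfTeq (L := L) S S' q p → p = q := by
  have hTT : TT L M := fun n => htt M n
  refine ⟨fun hac => dir1 M hTT hM.wsat hac, fun hyp => ?_⟩
  have hmod : ((hyperfilter ℕ : Ultrafilter ℕ) : Filter ℕ).Product (fun _ => (M : Type max u v)) ⊨ T := by
    rw [Theory.model_iff]
    intro φ hφ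
    rw [Ultraproduct.sentence_realize]
    exact Eventually.of_forall fun _ => Theory.realize_sentence_of_mem T hφ
  have hTT2 : TT L (((hyperfilter ℕ : Ultrafilter ℕ) : Filter ℕ).Product
      (fun _ => (M : Type max u v))) :=
    fun n => htt (Theory.ModelType.of T (((hyperfilter ℕ : Ultrafilter ℕ) : Filter ℕ).Product
      (fun _ => (M : Type max u v)))) n
  exact dir2 hT M hTT (noOrd hTT2) hM.wsat hyp

end Final

/-- If `T` is totally transcendental, then `T` is indiscernibly acyclic if and
only if there is no proper cycle of types of length `2` in `T^eq`, i.e. no two distinct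
complete imaginary types `p ≠ q` with `p ⟶ q` and `q ⟶ p` (imaginaries computed in a
monster model of `T`). -/
theorem tt_acyclic_iff_no_two_cycle_teq (hT : T.IsComplete) (htt : IsTotallyTranscendental T)
    (M : Theory.ModelType.{u, v, max u v} T) (hM : IsMonster (L := L) M) :
    IsIndAcyclic T ↔
      ∀ (S S' : ImSort L ↥M) (p q : Set (L.Formula (SortVars S ⊕ SortVars S'))),
        (∃ (c : SortVars S → ↥M) (d : SortVars S' → ↥M), imTypeOf (L := L) S S' c d = p) →
        (∃ (c : SortVars S → ↥M) (d : SortVars S' → ↥M), imTypeOf (L := L) S S' c d = q) →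
        PfTeq (L := L) S S' p q → PfTeq (L := L) S S' q p → p = q := by
  exact main_iff hT htt M hM

end Equationality
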